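/- arXiv:1610.06900 — 3 statements merged into one kernel-verified Lean document; each statement's English description precedes it below -/
import Mathlib

section
/- Fix an integer k ≥ 2 and real δ > 0. For every ε > 0 there exists Q₀ such that for all Q ≥ Q₀ and all X with Q^δ ≤ X ≤ Q / log log Q, one has |Δ_k(Q;X) − ã_k · (c^{k²−1}/(k²−1)!) · Q X (log Q)^{k²−1}| ≤ ε · Q X (log Q)^{k²−1}, where c = log X / log Q. -/
open MeasureTheory Complex

/-- `d_k(n)`: number of ordered k-tuples of positive integers with product n. -/
noncomputable def dk (k n : ℕ) : ℕ :=
  Nat.card {f : Fin k → ℕ // (∀ i, 0 < f i) ∧ ∏ i, f i = n}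

/-- `𝔞_p`. -/
noncomputable def frakA (k p : ℕ) : ℝ :=
  ∑' ℓ : ℕ, (((k + ℓ - 1).choose (k - 1) : ℝ))^2 / (p : ℝ)^ℓ

/-- `a_k`. -/
noncomputable def aCst (k : ℕ) : ℝ :=
  ∏' p : Nat.Primes, ((1 - 1/((p : ℕ) : ℝ))^(k^2) * frakA k p)

/-- `a_k(q)`. -/
noncomputable def aCstQ (k q : ℕ) : ℝ :=
  aCst k * ∏ p ∈ q.primeFactors, (frakA k p)⁻¹

/-- `ã_k`. -/
noncomputable def aTilde (k : ℕ) : ℝ :=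
  aCst k * ∏' p : Nat.Primes, (1 - (1 - (frakA k p)⁻¹)/((p : ℕ) : ℝ))

/-- sum over `n ≡ a (mod q)` of `d_k(n) Ψ(n/X)`. -/
noncomputable def progSum (k : ℕ) (Ψ : ℝ → ℝ) (q a : ℕ) (X : ℝ) : ℝ :=
  ∑' n : ℕ, if (n : ZMod q) = (a : ZMod q) then (dk k n : ℝ) * Ψ (n / X) else 0

/-- sum over `n` coprime to `q` of `d_k(n) Ψ(n/X)`. -/
noncomputable def copSum (k : ℕ) (Ψ : ℝ → ℝ) (q : ℕ) (X : ℝ) : ℝ :=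
  ∑' n : ℕ, if Nat.gcd n q = 1 then (dk k n : ℝ) * Ψ (n / X) else 0

/-- `V_k(q; X)`. -/
noncomputable def Vk (k : ℕ) (Ψ : ℝ → ℝ) (q : ℕ) (X : ℝ) : ℝ :=
  ∑ a ∈ Finset.Icc 1 q, if Nat.gcd a q = 1 then
    (progSum k Ψ q a X - (1 / (Nat.totient q : ℝ)) * copSum k Ψ q X)^2 else 0

/-- `Δ_k(Q; X)`. -/
noncomputable def DeltaK (k : ℕ) (Φ Ψ : ℝ → ℝ) (Q X : ℝ) : ℝ :=
  ∑' q : ℕ, if 1 ≤ q then Vk k Ψ q X * Φ ((q : ℝ) / Q) else 0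

/-- The polynomial `P_k(c)`. -/
noncomputable def Pk (k : ℕ) (c : ℝ) : ℝ :=
  ((-1 : ℝ)^k / ((k^2 - 1).factorial : ℝ)) *
    ∑' a : ℕ, ∑' b : ℕ, ∑' α : ℕ, ∑' β : ℕ,
      (-1 : ℝ)^(a + b + α + β) * c^(a + b) * (1 - c)^(k^2 - 1 - a - b) *
        (if a + b ≤ k^2 - 1 then
          ((k^2 - 1).factorial : ℝ) /
            ((a.factorial : ℝ) * (b.factorial : ℝ) * ((k^2 - 1 - a - b).factorial : ℝ))
         else 0) *
        (((k^2 - 1 + α + β).factorial : ℝ) /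
          ((α.factorial : ℝ) * (β.factorial : ℝ) * ((k^2 - 1).factorial : ℝ))) *
        (k.choose (a + α + 1) : ℝ) * (k.choose (b + β + 1) : ℝ)

section PrimePowers
open ArithmeticFunction
open scoped ArithmeticFunction.zeta ArithmeticFunction.Moebius

theorem mul_zeta_apply_prime_pow_succ (f : ArithmeticFunction ℝ) {p : ℕ} (hp : p.Prime) (l : ℕ) :
    (f * (ζ : ArithmeticFunction ℝ)) (p ^ (l + 1)) =
      (f * (ζ : ArithmeticFunction ℝ)) (p ^ l) + f (p ^ (l + 1)) := by
  rw [coe_mul_zeta_apply, coe_mul_zeta_apply, Nat.sum_divisors_prime_pow hp,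
    Nat.sum_divisors_prime_pow hp, Finset.sum_range_succ]

theorem mul_moebius_apply_prime_pow_succ (f : ArithmeticFunction ℝ) {p : ℕ} (hp : p.Prime)
    (l : ℕ) :
    (f * (μ : ArithmeticFunction ℝ)) (p ^ (l + 1)) = f (p ^ (l + 1)) - f (p ^ l) := by
  have h := mul_zeta_apply_prime_pow_succ (f * (μ : ArithmeticFunction ℝ)) hp l
  rw [mul_assoc, coe_moebius_mul_coe_zeta, mul_one] at h
  linarith

theorem mul_moebius_apply_one (f : ArithmeticFunction ℝ) :
    (f * (μ : ArithmeticFunction ℝ)) 1 = f 1 := by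
  simp

theorem zeta_pow_apply_prime_pow (k : ℕ) {p : ℕ} (hp : p.Prime) (l : ℕ) :
    ((ζ : ArithmeticFunction ℝ) ^ (k + 1)) (p ^ l) = ((l + k).choose k : ℝ) := by
  induction k generalizing l with
  | zero => simp [zeta_apply, hp.ne_zero]
  | succ k ih =>
    rw [pow_succ]
    induction l with
    | zero => 
      have := ih 0
      simp only [pow_zero] at this
      simp [this]
    | succ l ihl =>
      rw [mul_zeta_apply_prime_pow_succ _ hp, ihl, ih]
      have : (l + 1 + (k + 1)).choose (k + 1) =
          (l + (k + 1)).choose (k + 1) + (l + 1 + k).choose k := by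
        rw [show l + 1 + (k + 1) = (l + (k + 1)) + 1 by ring, Nat.choose_succ_succ, add_comm,
          show l + (k + 1) = l + 1 + k by ring]
      rw [this]
      push_cast
      ring

theorem dk_zero {k : ℕ} : dk k 0 = 0 := by
  rw [dk, Nat.card_eq_zero]
  left
  constructor
  rintro ⟨f, hf, h⟩
  rw [Finset.prod_eq_zero_iff] at h
  obtain ⟨i, -, hi⟩ := h
  exact absurd hi (Nat.pos_iff_ne_zero.1 (hf i))

/-- Splitting off the first factor of an ordered factorization. -/
noncomputable def factorizationSuccEquiv (k n : ℕ) (hn : n ≠ 0) :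
    {f : Fin (k + 1) → ℕ // (∀ i, 0 < f i) ∧ ∏ i, f i = n} ≃
      (Σ x : n.divisorsAntidiagonal,
        {f : Fin k → ℕ // (∀ i, 0 < f i) ∧ ∏ i, f i = x.1.2}) where
  toFun f := ⟨⟨(f.1 0, ∏ i : Fin k, f.1 i.succ), by
      rw [Nat.mem_divisorsAntidiagonal]
      exact ⟨by rw [← Fin.prod_univ_succ, f.2.2], hn⟩⟩,
    ⟨fun i => f.1 i.succ, fun i => f.2.1 _, rfl⟩⟩
  invFun y := ⟨Fin.cons y.1.1.1 y.2.1, by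
      have hy := Nat.mem_divisorsAntidiagonal.1 y.1.2
      constructor
      · intro i
        refine Fin.cases ?_ (fun j => ?_) i
        · refine Nat.pos_of_ne_zero fun h => hn ?_
          rw [← hy.1]
          simp_all
        · simpa using y.2.2.1 j
      · rw [Fin.prod_univ_succ]
        simp only [Fin.cons_zero, Fin.cons_succ]
        rw [y.2.2.2, hy.1]⟩
  left_inv f := by
    apply Subtype.ext
    funext i
    refine Fin.cases ?_ (fun j => ?_) i <;> simp
  right_inv := by
    rintro ⟨⟨⟨a, b⟩, hx⟩, ⟨f, hf, h⟩⟩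
    dsimp only at h
    subst h
    rfl

theorem snd_ne_zero_of_mem_divisorsAntidiagonal {n : ℕ} {x : ℕ × ℕ}
    (hx : x ∈ n.divisorsAntidiagonal) : x.2 ≠ 0 := by
  intro h
  obtain ⟨h1, h2⟩ := Nat.mem_divisorsAntidiagonal.1 hx
  exact h2 (by rw [← h1, h, mul_zero])

theorem finite_factorizations (k n : ℕ) (hn : n ≠ 0) :
    Finite {f : Fin k → ℕ // (∀ i, 0 < f i) ∧ ∏ i, f i = n} := by
  induction k generalizing n with
  | zero => infer_instance
  | succ k ih =>
    have : ∀ x : n.divisorsAntidiagonal,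
        Finite {f : Fin k → ℕ // (∀ i, 0 < f i) ∧ ∏ i, f i = x.1.2} := fun x =>
      ih _ (snd_ne_zero_of_mem_divisorsAntidiagonal x.2)
    exact Finite.of_equiv _ (factorizationSuccEquiv k n hn).symm

theorem dk_succ (k n : ℕ) (hn : n ≠ 0) :
    dk (k + 1) n = ∑ x ∈ n.divisorsAntidiagonal, dk k x.2 := by
  have : ∀ x : n.divisorsAntidiagonal,
      Finite {f : Fin k → ℕ // (∀ i, 0 < f i) ∧ ∏ i, f i = x.1.2} := fun x =>
    finite_factorizations _ _ (snd_ne_zero_of_mem_divisorsAntidiagonal x.2)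
  rw [dk, Nat.card_congr (factorizationSuccEquiv k n hn), Nat.card_sigma,
    ← Finset.sum_coe_sort n.divisorsAntidiagonal]
  rfl

theorem dk_eq_zeta_pow (k n : ℕ) : dk k n = (ζ ^ k) n := by
  induction k generalizing n with
  | zero =>
    rcases eq_or_ne n 0 with rfl | hn
    · rw [dk_zero]; simp
    · rw [pow_zero, one_apply, dk]
      split_ifs with h
      · subst h
        simp
      · rw [Nat.card_eq_zero]
        left
        constructor
        rintro ⟨f, hf, h'⟩
        simp at h'
        exact h h'.symm
  | succ k ih =>
    rcases eq_or_ne n 0 with rfl | hn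
    · rw [dk_zero]; simp
    · rw [dk_succ _ _ hn, pow_succ', mul_apply]
      refine Finset.sum_congr rfl fun x hx => ?_
      rw [ih, zeta_apply_ne, one_mul]
      exact fun h => hn (by rw [← (Nat.mem_divisorsAntidiagonal.1 hx).1, h, zero_mul])

theorem natCoe_zeta_pow (k : ℕ) :
    ((ζ ^ k : ArithmeticFunction ℕ) : ArithmeticFunction ℝ) = (ζ : ArithmeticFunction ℝ) ^ k := by
  induction k with
  | zero => simp
  | succ k ih => rw [pow_succ, pow_succ, natCoe_mul, ih]

theorem dk_cast (k n : ℕ) : (dk k n : ℝ) = ((ζ : ArithmeticFunction ℝ) ^ k) n := by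
  rw [dk_eq_zeta_pow, ← natCoe_zeta_pow, natCoe_apply]

end PrimePowers

section DivisorSums
open Filter Topology
open scoped ArithmeticFunction.zeta

theorem pow_mul_sub_le_pow_sub_pow (j : ℕ) {a b : ℝ} (hb : 0 ≤ b) (hab : b ≤ a) :
    (j + 1) * (b ^ j * (a - b)) ≤ a ^ (j + 1) - b ^ (j + 1) := by
  induction j with
  | zero => simp
  | succ j ih =>
    have h1 : a ^ (j + 1 + 1) - b ^ (j + 1 + 1)
        = a * (a ^ (j + 1) - b ^ (j + 1)) + b ^ (j + 1) * (a - b) := by ring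
    have h2 : a * ((j + 1) * (b ^ j * (a - b))) ≤ a * (a ^ (j + 1) - b ^ (j + 1)) :=
      mul_le_mul_of_nonneg_left ih (hb.trans hab)
    have h3 : b * ((j + 1) * (b ^ j * (a - b))) ≤ a * ((j + 1) * (b ^ j * (a - b))) :=
      mul_le_mul_of_nonneg_right hab
        (mul_nonneg (by positivity) (mul_nonneg (by positivity) (sub_nonneg.2 hab)))
    rw [h1]
    push_cast
    have h4 : b * ((j + 1) * (b ^ j * (a - b))) = (j + 1) * (b ^ (j + 1) * (a - b)) := by ring
    linarith

theorem pow_sub_pow_le_pow_mul_sub (j : ℕ) {a b : ℝ} (hb : 0 ≤ b) (hab : b ≤ a) :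
    a ^ (j + 1) - b ^ (j + 1) ≤ (j + 1) * (a ^ j * (a - b)) := by
  induction j with
  | zero => simp
  | succ j ih =>
    have h1 : a ^ (j + 1 + 1) - b ^ (j + 1 + 1)
        = a * (a ^ (j + 1) - b ^ (j + 1)) + b ^ (j + 1) * (a - b) := by ring
    have h2 : a * (a ^ (j + 1) - b ^ (j + 1)) ≤ a * ((j + 1) * (a ^ j * (a - b))) :=
      mul_le_mul_of_nonneg_left ih (hb.trans hab)
    have h3 : b ^ (j + 1) * (a - b) ≤ a ^ (j + 1) * (a - b) :=
      mul_le_mul_of_nonneg_right (pow_le_pow_left₀ hb hab _) (sub_nonneg.2 hab)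
    rw [h1]
    push_cast
    have h4 : a * ((j + 1) * (a ^ j * (a - b))) = (j + 1) * (a ^ (j + 1) * (a - b)) := by ring
    linarith

theorem log_succ_sub_log_le {m : ℕ} (hm : 0 < m) :
    Real.log ((m + 1 : ℕ) : ℝ) - Real.log m ≤ 1 / m := by
  have hm' : (0 : ℝ) < m := by exact_mod_cast hm
  rw [← Real.log_div (by positivity) hm'.ne']
  refine (Real.log_le_sub_one_of_pos (by positivity)).trans (le_of_eq ?_)
  push_cast
  field_simp
  ring

theorem le_log_succ_sub_log {m : ℕ} (hm : 0 < m) :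
    1 / ((m + 1 : ℕ) : ℝ) ≤ Real.log ((m + 1 : ℕ) : ℝ) - Real.log m := by
  have hm' : (0 : ℝ) < m := by exact_mod_cast hm
  rw [← Real.log_div (by positivity) hm'.ne']
  refine le_trans (le_of_eq ?_) (Real.one_sub_inv_le_log_of_pos (by positivity))
  push_cast
  field_simp
  ring

theorem sum_log_pow_div_bounds (j : ℕ) {x : ℝ} (N : ℕ) (hN : 1 ≤ N) (hNx : (N : ℝ) ≤ x) :
    (Real.log x ^ (j + 1) - Real.log (x / N) ^ (j + 1)) / (j + 1) + Real.log (x / N) ^ j / N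
        ≤ ∑ m ∈ Finset.Ioc 0 N, Real.log (x / m) ^ j / m ∧
      ∑ m ∈ Finset.Ioc 0 N, Real.log (x / m) ^ j / m ≤
        (Real.log x ^ (j + 1) - Real.log (x / N) ^ (j + 1)) / (j + 1) + Real.log x ^ j := by
  induction N, hN using Nat.le_induction with
  | base => simp
  | succ N hN ih =>
    have hN' : (0 : ℝ) < N := by exact_mod_cast hN
    have hNx' : (N : ℝ) ≤ x := le_trans (by push_cast; linarith) hNx
    have hx : 0 < x := hN'.trans_le hNx'
    obtain ⟨ih1, ih2⟩ := ih hNx'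
    rw [Finset.sum_Ioc_succ_top (by omega)]
    have hb : 0 ≤ Real.log (x / (N + 1 : ℕ)) :=
      Real.log_nonneg ((one_le_div (by positivity)).2 hNx)
    have hdiff : Real.log (x / N) - Real.log (x / (N + 1 : ℕ)) =
        Real.log ((N + 1 : ℕ) : ℝ) - Real.log N := by
      rw [Real.log_div hx.ne' hN'.ne', Real.log_div hx.ne' (by positivity)]
      ring
    have hd1 := log_succ_sub_log_le (m := N) hN
    have hd2 := le_log_succ_sub_log (m := N) hN
    rw [← hdiff] at hd1 hd2
    set a := Real.log (x / N) with ha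
    set b := Real.log (x / (N + 1 : ℕ)) with hbdef
    have hab : b ≤ a := by
      have : (0 : ℝ) < 1 / ((N + 1 : ℕ) : ℝ) := by positivity
      linarith
    have hj : (0 : ℝ) < (j : ℝ) + 1 := by positivity
    have key1 : (a ^ (j + 1) - b ^ (j + 1)) / (j + 1) ≤ a ^ j / N := by
      rw [div_le_iff₀ hj]
      refine (pow_sub_pow_le_pow_mul_sub j hb hab).trans ?_
      have := mul_le_mul_of_nonneg_left hd1 (pow_nonneg (hb.trans hab) j)
      rw [mul_one_div] at this
      nlinarith
    have key2 : b ^ j / ((N + 1 : ℕ) : ℝ) ≤ (a ^ (j + 1) - b ^ (j + 1)) / (j + 1) := by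
      rw [le_div_iff₀ hj]
      refine le_trans ?_ (pow_mul_sub_le_pow_sub_pow j hb hab)
      have := mul_le_mul_of_nonneg_left hd2 (pow_nonneg hb j)
      rw [mul_one_div] at this
      nlinarith
    have e : (Real.log x ^ (j + 1) - b ^ (j + 1)) / (j + 1) =
        (Real.log x ^ (j + 1) - a ^ (j + 1)) / (j + 1) + (a ^ (j + 1) - b ^ (j + 1)) / (j + 1) := by
      ring
    rw [e]
    constructor <;> linarith

theorem abs_sum_log_pow_div_sub_le (j : ℕ) {x : ℝ} (hx : 1 ≤ x) :
    |∑ m ∈ Finset.Ioc 0 ⌊x⌋₊, Real.log (x / m) ^ j / m - Real.log x ^ (j + 1) / (j + 1)| ≤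
      Real.log x ^ j := by
  have hN : 1 ≤ ⌊x⌋₊ := Nat.one_le_floor_iff _ |>.2 hx
  have hNx : (⌊x⌋₊ : ℝ) ≤ x := Nat.floor_le (by linarith)
  have hN' : (0 : ℝ) < ⌊x⌋₊ := by exact_mod_cast hN
  obtain ⟨h1, h2⟩ := sum_log_pow_div_bounds j ⌊x⌋₊ hN hNx
  set b := Real.log (x / ⌊x⌋₊) with hb
  have hb0 : 0 ≤ b := Real.log_nonneg ((one_le_div hN').2 hNx)
  have hb1 : b ≤ 1 / ⌊x⌋₊ := by
    refine (Real.log_le_sub_one_of_pos (by positivity)).trans ?_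
    have := Nat.lt_floor_add_one x
    rw [← sub_nonneg]
    have e : 1 / (⌊x⌋₊ : ℝ) - (x / ⌊x⌋₊ - 1) = (⌊x⌋₊ + 1 - x) / ⌊x⌋₊ := by
      field_simp; ring
    rw [e]
    exact div_nonneg (by linarith) hN'.le
  have hL : 0 ≤ Real.log x := Real.log_nonneg hx
  have h3 : b ^ (j + 1) / (j + 1) ≤ b ^ j / ⌊x⌋₊ := by
    have h4 : b ^ (j + 1) / (j + 1) ≤ b ^ (j + 1) :=
      div_le_self (by positivity) (by linarith [(Nat.cast_nonneg j : (0 : ℝ) ≤ j)])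
    refine h4.trans ?_
    rw [pow_succ, div_eq_mul_one_div (b ^ j)]
    exact mul_le_mul_of_nonneg_left hb1 (by positivity)
  have h5 : 0 ≤ b ^ (j + 1) / (j + 1) := by positivity
  have h6 : 0 ≤ Real.log x ^ j := by positivity
  rw [sub_div] at h1 h2
  rw [abs_le]
  constructor <;> linarith

theorem sum_one_div_le_one_add_log {x : ℝ} (hx : 1 ≤ x) :
    ∑ m ∈ Finset.Ioc 0 ⌊x⌋₊, (1 : ℝ) / m ≤ 1 + Real.log x := by
  have h := abs_sum_log_pow_div_sub_le 0 hx
  simp only [pow_zero, zero_add, pow_one, Nat.cast_zero, div_one] at h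
  linarith [(abs_le.1 h).2]

/-- The summatory function of the `K`-fold divisor function. -/
noncomputable def divisorSum (K : ℕ) (x : ℝ) : ℝ :=
  ∑ n ∈ Finset.Ioc 0 ⌊x⌋₊, ((ζ : ArithmeticFunction ℝ) ^ K) n

theorem divisorSum_of_lt_one (K : ℕ) {x : ℝ} (hx : x < 1) : divisorSum K x = 0 := by
  rw [divisorSum, Nat.floor_eq_zero.2 hx]
  simp

theorem divisorSum_one (x : ℝ) : divisorSum 1 x = ⌊x⌋₊ := by
  rw [divisorSum, pow_one]
  have := ArithmeticFunction.sum_Ioc_zeta ⌊x⌋₊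
  simp only [ArithmeticFunction.natCoe_apply]
  exact_mod_cast this

theorem divisorSum_nonneg (K : ℕ) (x : ℝ) : 0 ≤ divisorSum K x := by
  refine Finset.sum_nonneg fun n _ => ?_
  rw [← dk_cast]
  positivity

theorem divisorSum_mul (f : ArithmeticFunction ℝ) (K : ℕ) (x : ℝ) :
    ∑ n ∈ Finset.Ioc 0 ⌊x⌋₊, (f * (ζ : ArithmeticFunction ℝ) ^ K) n =
      ∑ m ∈ Finset.Ioc 0 ⌊x⌋₊, f m * divisorSum K (x / m) := by
  rw [ArithmeticFunction.sum_Ioc_mul_eq_sum_sum]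
  simp only [divisorSum, Nat.floor_div_natCast]

theorem divisorSum_succ (K : ℕ) (x : ℝ) :
    divisorSum (K + 1) x = ∑ m ∈ Finset.Ioc 0 ⌊x⌋₊, divisorSum K (x / m) := by
  rw [divisorSum, pow_succ', divisorSum_mul]
  refine Finset.sum_congr rfl fun m hm => ?_
  have : m ≠ 0 := by simp at hm; omega
  simp [ArithmeticFunction.natCoe_apply, ArithmeticFunction.zeta_apply, this]

theorem one_le_div_of_mem_Ioc_floor {x : ℝ} {m : ℕ} (hm : m ∈ Finset.Ioc 0 ⌊x⌋₊) :
    (0 : ℝ) < m ∧ 1 ≤ x / m ∧ Real.log (x / m) ≤ Real.log x := by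
  rw [Finset.mem_Ioc] at hm
  have h0 : (0 : ℝ) < m := by exact_mod_cast hm.1
  have h1 : (1 : ℝ) ≤ m := by exact_mod_cast hm.1
  have h2 : (m : ℝ) ≤ x := (Nat.le_floor_iff' hm.1.ne').1 hm.2
  have hx : 0 < x := h0.trans_le h2
  refine ⟨h0, (one_le_div h0).2 h2, Real.log_le_log (by positivity) (div_le_self hx.le h1)⟩

theorem divisorSum_le (K : ℕ) {x : ℝ} (hx : 1 ≤ x) :
    divisorSum (K + 1) x ≤ x * (1 + Real.log x) ^ K := by
  induction K generalizing x with
  | zero =>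
    rw [divisorSum_one]
    simpa using Nat.floor_le (by linarith)
  | succ K ih =>
    have hL : 0 ≤ Real.log x := Real.log_nonneg hx
    rw [divisorSum_succ]
    calc ∑ m ∈ Finset.Ioc 0 ⌊x⌋₊, divisorSum (K + 1) (x / m)
        ≤ ∑ m ∈ Finset.Ioc 0 ⌊x⌋₊, x * (1 + Real.log x) ^ K * (1 / m) := by
          refine Finset.sum_le_sum fun m hm => ?_
          obtain ⟨h0, h1, h2⟩ := one_le_div_of_mem_Ioc_floor hm
          refine (ih h1).trans ?_
          have h3 : 0 ≤ Real.log (x / m) := Real.log_nonneg h1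
          have : (1 + Real.log (x / m)) ^ K ≤ (1 + Real.log x) ^ K := by gcongr
          calc x / m * (1 + Real.log (x / m)) ^ K ≤ x / m * (1 + Real.log x) ^ K := by gcongr
            _ = _ := by ring
      _ = x * (1 + Real.log x) ^ K * ∑ m ∈ Finset.Ioc 0 ⌊x⌋₊, (1 : ℝ) / m := by
          rw [Finset.mul_sum]
      _ ≤ x * (1 + Real.log x) ^ K * (1 + Real.log x) := by
          gcongr
          exact sum_one_div_le_one_add_log hx
      _ = _ := by ring

theorem abs_divisorSum_sub_le (i : ℕ) :
    ∃ C : ℝ, 0 ≤ C ∧ ∀ x : ℝ, 1 ≤ x →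
      |divisorSum (i + 2) x - x * (Real.log x ^ (i + 1) / (i + 1).factorial)| ≤
        C * (x * (1 + Real.log x) ^ i) := by
  have main : ∀ (j : ℕ) (x : ℝ), 1 ≤ x →
      |divisorSum (j + 2) x - x * (Real.log x ^ (j + 1) / (j + 1).factorial)| ≤
        ∑ m ∈ Finset.Ioc 0 ⌊x⌋₊,
          |divisorSum (j + 1) (x / m) - x / m * (Real.log (x / m) ^ j / j.factorial)| +
        x * (1 + Real.log x) ^ j := by
    intro j x hx
    have hL : 0 ≤ Real.log x := Real.log_nonneg hx
    have e : divisorSum (j + 2) x - x * (Real.log x ^ (j + 1) / (j + 1).factorial) =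
        ∑ m ∈ Finset.Ioc 0 ⌊x⌋₊,
          (divisorSum (j + 1) (x / m) - x / m * (Real.log (x / m) ^ j / j.factorial)) +
        x / j.factorial * (∑ m ∈ Finset.Ioc 0 ⌊x⌋₊, Real.log (x / m) ^ j / m -
          Real.log x ^ (j + 1) / (j + 1)) := by
      rw [divisorSum_succ, Finset.sum_sub_distrib, mul_sub, Finset.mul_sum]
      have : ∀ m ∈ Finset.Ioc 0 ⌊x⌋₊, x / m * (Real.log (x / m) ^ j / j.factorial) =
          x / j.factorial * (Real.log (x / m) ^ j / m) := fun m _ => by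
        field_simp
      rw [Finset.sum_congr rfl this, Nat.factorial_succ]
      push_cast
      field_simp
      ring
    rw [e]
    refine (abs_add_le _ _).trans (add_le_add (Finset.abs_sum_le_sum_abs _ _) ?_)
    rw [abs_mul, abs_of_nonneg (by positivity)]
    have h1 : x / j.factorial ≤ x :=
      div_le_self (by linarith) (by exact_mod_cast Nat.factorial_pos j)
    have h2 : Real.log x ^ j ≤ (1 + Real.log x) ^ j := by gcongr; linarith
    exact mul_le_mul h1 ((abs_sum_log_pow_div_sub_le j hx).trans h2) (abs_nonneg _) (by linarith)
  induction i with
  | zero =>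
    refine ⟨2, by norm_num, fun x hx => (main 0 x hx).trans ?_⟩
    have : ∑ m ∈ Finset.Ioc 0 ⌊x⌋₊,
        |divisorSum (0 + 1) (x / m) - x / m * (Real.log (x / m) ^ 0 / Nat.factorial 0)| ≤
        ∑ m ∈ Finset.Ioc 0 ⌊x⌋₊, (1 : ℝ) := by
      refine Finset.sum_le_sum fun m hm => ?_
      obtain ⟨h0, h1, h2⟩ := one_le_div_of_mem_Ioc_floor hm
      rw [zero_add, divisorSum_one]
      have h3 := Nat.floor_le (show 0 ≤ x / m by linarith)
      have h4 := Nat.lt_floor_add_one (x / m)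
      simp only [pow_zero, Nat.factorial_zero, Nat.cast_one, div_one, mul_one]
      rw [abs_le]
      constructor <;> linarith
    have h5 := Nat.floor_le (show 0 ≤ x by linarith)
    simp at this ⊢
    linarith
  | succ i ih =>
    obtain ⟨C, hC, h⟩ := ih
    refine ⟨C + 1, by linarith, fun x hx => (main (i + 1) x hx).trans ?_⟩
    have hL : 0 ≤ Real.log x := Real.log_nonneg hx
    have : ∑ m ∈ Finset.Ioc 0 ⌊x⌋₊, |divisorSum (i + 1 + 1) (x / m) -
          x / m * (Real.log (x / m) ^ (i + 1) / (i + 1).factorial)| ≤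
        ∑ m ∈ Finset.Ioc 0 ⌊x⌋₊, C * (x * (1 + Real.log x) ^ i) * (1 / m) := by
      refine Finset.sum_le_sum fun m hm => ?_
      obtain ⟨h0, h1, h2⟩ := one_le_div_of_mem_Ioc_floor hm
      refine (h _ h1).trans ?_
      have h3 : 0 ≤ Real.log (x / m) := Real.log_nonneg h1
      calc C * (x / m * (1 + Real.log (x / m)) ^ i) ≤ C * (x / m * (1 + Real.log x) ^ i) := by
            gcongr
        _ = _ := by ring
    rw [← Finset.mul_sum] at this
    have h6 : C * (x * (1 + Real.log x) ^ i) * ∑ m ∈ Finset.Ioc 0 ⌊x⌋₊, (1 : ℝ) / m ≤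
        C * (x * (1 + Real.log x) ^ i) * (1 + Real.log x) := by
      gcongr
      exact sum_one_div_le_one_add_log hx
    calc _ ≤ C * (x * (1 + Real.log x) ^ i) * (1 + Real.log x) +
          x * (1 + Real.log x) ^ (i + 1) := by linarith
      _ = _ := by ring

theorem tendsto_divisorSum_div (i : ℕ) :
    Tendsto (fun x : ℝ => divisorSum (i + 2) x / (x * Real.log x ^ (i + 1))) atTop
      (𝓝 (1 / ((i + 1).factorial : ℝ))) := by
  obtain ⟨C, hC, h⟩ := abs_divisorSum_sub_le i
  rw [tendsto_iff_norm_sub_tendsto_zero]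
  have hlim : Tendsto (fun x : ℝ => C * 2 ^ i / Real.log x) atTop (𝓝 0) :=
    tendsto_const_nhds.div_atTop Real.tendsto_log_atTop
  refine squeeze_zero' (Eventually.of_forall fun _ => norm_nonneg _) ?_ hlim
  filter_upwards [eventually_ge_atTop (Real.exp 1)] with x hx
  have hx1 : 1 ≤ x := (Real.one_le_exp zero_le_one).trans hx
  have hL : 1 ≤ Real.log x := (Real.le_log_iff_exp_le (by linarith)).2 hx
  have h0 : 0 < x * Real.log x ^ (i + 1) := by positivity
  have e : divisorSum (i + 2) x / (x * Real.log x ^ (i + 1)) - 1 / ((i + 1).factorial : ℝ) =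
      (divisorSum (i + 2) x - x * (Real.log x ^ (i + 1) / (i + 1).factorial)) /
        (x * Real.log x ^ (i + 1)) := by
    field_simp
  rw [e, Real.norm_eq_abs, abs_div, abs_of_pos h0, div_le_iff₀ h0]
  refine (h x hx1).trans ?_
  calc C * (x * (1 + Real.log x) ^ i) ≤ C * (x * (2 * Real.log x) ^ i) := by
        gcongr; linarith
    _ = _ := by field_simp; ring

end DivisorSums

section MeanValue
open Filter Topology
open scoped ArithmeticFunction.zeta

theorem tendsto_log_div_div_log {a : ℝ} (ha : 0 < a) :
    Tendsto (fun x : ℝ => Real.log (x / a) / Real.log x) atTop (𝓝 1) := by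
  have h1 : Tendsto (fun x : ℝ => 1 - Real.log a / Real.log x) atTop (𝓝 (1 - 0)) :=
    tendsto_const_nhds.sub (tendsto_const_nhds.div_atTop Real.tendsto_log_atTop)
  rw [sub_zero] at h1
  refine h1.congr' ?_
  filter_upwards [eventually_gt_atTop (1 : ℝ)] with x hx
  have : 0 < Real.log x := Real.log_pos hx
  rw [Real.log_div (by linarith) ha.ne']
  field_simp

theorem tendsto_sum_mul_zeta_pow_div (h : ArithmeticFunction ℝ)
    (hs : Summable fun n : ℕ => |h n / n|) (i : ℕ) :
    Tendsto (fun x : ℝ => (∑ n ∈ Finset.Ioc 0 ⌊x⌋₊,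
        (h * (ζ : ArithmeticFunction ℝ) ^ (i + 2)) n) / (x * Real.log x ^ (i + 1))) atTop
      (𝓝 ((∑' n : ℕ, h n / n) / ((i + 1).factorial : ℝ))) := by
  set c : ℝ := 1 / ((i + 1).factorial : ℝ) with hc
  set G : ℝ → ℕ → ℝ := fun x m => h m * divisorSum (i + 2) (x / m) / (x * Real.log x ^ (i + 1))
    with hG
  have hlim : Tendsto (fun x => ∑' m, G x m) atTop (𝓝 (∑' m : ℕ, h m / m * c)) := by
    refine tendsto_tsum_of_dominated_convergence (bound := fun m => |h m / m| * 2 ^ (i + 1))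
      (hs.mul_right _) (fun m => ?_) ?_
    · rcases Nat.eq_zero_or_pos m with rfl | hm
      · simp [hG]
      have hm' : (0 : ℝ) < m := by exact_mod_cast hm
      have h1 : Tendsto (fun x : ℝ => x / m) atTop atTop := tendsto_id.atTop_div_const hm'
      have h2 := (tendsto_divisorSum_div i).comp h1
      have h3 := (tendsto_log_div_div_log hm').pow (i + 1)
      have h4 := (h2.mul h3).const_mul (h m / m)
      rw [one_pow, mul_one] at h4
      refine h4.congr' ?_
      filter_upwards [eventually_gt_atTop (m : ℝ), eventually_gt_atTop (1 : ℝ)] with x hx hx1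
      have hL : 0 < Real.log x := Real.log_pos hx1
      have hLm : 0 < Real.log (x / m) := Real.log_pos ((one_lt_div hm').2 hx)
      simp only [Function.comp, hG, div_pow]
      field_simp
    · filter_upwards [eventually_ge_atTop (Real.exp 1)] with x hx m
      have hx1 : 1 ≤ x := (Real.one_le_exp zero_le_one).trans hx
      have hL : 1 ≤ Real.log x := (Real.le_log_iff_exp_le (by linarith)).2 hx
      rcases Nat.eq_zero_or_pos m with rfl | hm
      · simp [hG]
      have hm' : (0 : ℝ) < m := by exact_mod_cast hm
      rcases lt_or_ge (x / m) 1 with hlt | hge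
      · simp only [hG, divisorSum_of_lt_one _ hlt]
        simp only [mul_zero, zero_div, norm_zero]
        positivity
      · have h0 : 0 < x * Real.log x ^ (i + 1) := by positivity
        have hlog : Real.log (x / m) ≤ Real.log x :=
          Real.log_le_log (by positivity) (div_le_self (by linarith) (by exact_mod_cast hm))
        have hlog0 : 0 ≤ Real.log (x / m) := Real.log_nonneg hge
        simp only [hG]
        rw [Real.norm_eq_abs, abs_div, abs_mul, abs_of_pos h0,
          abs_of_nonneg (divisorSum_nonneg _ _), div_le_iff₀ h0, abs_div, abs_of_pos hm']
        have h1 : divisorSum (i + 2) (x / m) ≤ x / m * (2 * Real.log x) ^ (i + 1) :=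
          (divisorSum_le (i + 1) hge).trans (by gcongr; linarith)
        calc |h m| * divisorSum (i + 2) (x / m)
            ≤ |h m| * (x / m * (2 * Real.log x) ^ (i + 1)) := by gcongr
          _ = _ := by rw [mul_pow]; ring
  have e1 : ∑' m : ℕ, h m / m * c = (∑' n : ℕ, h n / n) / ((i + 1).factorial : ℝ) := by
    rw [tsum_mul_right, hc, mul_one_div]
  rw [e1] at hlim
  refine hlim.congr' ?_
  filter_upwards [eventually_ge_atTop (0 : ℝ)] with x hx
  rw [divisorSum_mul, Finset.sum_div]
  refine tsum_eq_sum fun m hm => ?_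
  rcases Nat.eq_zero_or_pos m with rfl | hm0
  · simp [hG]
  have hm' : (0 : ℝ) < m := by exact_mod_cast hm0
  have : ⌊x⌋₊ < m := by
    by_contra hcon
    exact hm (Finset.mem_Ioc.2 ⟨hm0, not_lt.1 hcon⟩)
  have hlt : x / m < 1 := (div_lt_one hm').2 ((Nat.floor_lt hx).1 this)
  simp [hG, divisorSum_of_lt_one _ hlt]

/-- Partial summation against a smooth weight supported away from `0` and `∞`. -/
theorem tendsto_weighted_sum_div (f : ℕ → ℝ) (hf0 : f 0 = 0) (J : ℕ) (c : ℝ)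
    (hf : Tendsto (fun x : ℝ => (∑ n ∈ Finset.Ioc 0 ⌊x⌋₊, f n) / (x * Real.log x ^ J)) atTop
      (𝓝 c))
    (g : ℝ → ℝ) (hg : ContDiff ℝ 1 g) {α M : ℝ} (hα : 0 < α) (hαM : α < M)
    (hgl : ∀ u < α, g u = 0) (hgr : ∀ u, M ≤ u → g u = 0) :
    Tendsto (fun X : ℝ => (∑' n : ℕ, f n * g (n / X)) / (X * Real.log X ^ J)) atTop
      (𝓝 (c * ∫ u, g u)) := by
  have hM : 0 < M := hα.trans hαM
  have hgd : Differentiable ℝ g := hg.differentiable one_ne_zero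
  have hg'c : Continuous (deriv g) := hg.continuous_deriv le_rfl
  have hg'l : ∀ u < α, deriv g u = 0 := fun u hu => by
    have : g =ᶠ[𝓝 u] fun _ => 0 := by
      filter_upwards [Iio_mem_nhds hu] with v hv using hgl v hv
    rw [this.deriv_eq]; simp
  set F : ℝ → ℝ := fun x => ∑ n ∈ Finset.Ioc 0 ⌊x⌋₊, f n with hF
  have hFm : Measurable F :=
    (measurable_from_nat (f := fun N : ℕ => ∑ n ∈ Finset.Ioc 0 N, f n)).comp Nat.measurable_floor
  have hFI : ∀ x, ∑ n ∈ Finset.Icc 0 ⌊x⌋₊, f n = F x := fun x => by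
    rw [Finset.Icc_eq_cons_Ioc (Nat.zero_le _), Finset.sum_cons, hf0, zero_add]
  have hibp : ∫ u, g u = - ∫ u in (0 : ℝ)..M, deriv g u * u := by
    have h1 := intervalIntegral.integral_mul_deriv_eq_deriv_mul (a := 0) (b := M)
      (u := fun u => u) (v := g) (u' := fun _ => 1) (v' := deriv g)
      (fun x _ => hasDerivAt_id x) (fun x _ => (hgd x).hasDerivAt)
      intervalIntegrable_const (hg'c.intervalIntegrable _ _)
    simp only [hgr M le_rfl, mul_zero, zero_mul, sub_zero, one_mul, zero_sub] at h1
    have h2 : ∫ u, g u = ∫ u in (0 : ℝ)..M, g u := by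
      rw [intervalIntegral.integral_of_le hM.le, setIntegral_eq_integral_of_forall_compl_eq_zero]
      intro u hu
      simp only [Set.mem_Ioc, not_and_or, not_lt, not_le] at hu
      rcases hu with hu | hu
      · exact hgl u (by linarith)
      · exact hgr u hu.le
    rw [h2]
    have h3 : ∫ u in (0 : ℝ)..M, deriv g u * u = ∫ u in (0 : ℝ)..M, u * deriv g u := by
      simp only [mul_comm]
    rw [h3, h1, neg_neg]
  have hparts : ∀ X : ℝ, 0 < X →
      ∑' n : ℕ, f n * g (n / X) = - ∫ u in (0 : ℝ)..M, deriv g u * F (u * X) := by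
    intro X hX
    have h1 := sum_mul_eq_sub_integral_mul (f := fun t => g (t / X)) f
      (b := M * X) (by positivity)
      (fun t _ => (hgd _).comp t (differentiableAt_id.div_const X)) (by
        apply Continuous.integrableOn_Icc
        have : deriv (fun t => g (t / X)) = fun t => deriv g (t / X) * (1 / X) := by
          funext t
          exact ((hgd (t / X)).hasDerivAt.comp t ((hasDerivAt_id t).div_const X)).deriv
        rw [this]
        fun_prop)
    have hd : ∀ t, deriv (fun t => g (t / X)) t = deriv g (t / X) * (1 / X) := fun t =>
      ((hgd (t / X)).hasDerivAt.comp t ((hasDerivAt_id t).div_const X)).deriv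
    rw [tsum_eq_sum (s := Finset.Icc 0 ⌊M * X⌋₊)]
    · rw [mul_div_cancel_right₀ _ hX.ne', hgr M le_rfl, zero_mul, zero_sub] at h1
      simp only [mul_comm (f _)]
      rw [h1, ← intervalIntegral.integral_of_le (by positivity)]
      congr 1
      have h2 := intervalIntegral.integral_comp_mul_right
        (fun t => deriv g (t / X) * F t) (a := 0) (b := M) hX.ne'
      simp only [zero_mul, mul_div_cancel_right₀ _ hX.ne'] at h2
      rw [h2, smul_eq_mul, ← intervalIntegral.integral_const_mul]
      refine intervalIntegral.integral_congr fun t _ => ?_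
      simp only [hd, hFI]
      ring
    · intro n hn
      rw [hgr, mul_zero]
      rw [le_div_iff₀ hX]
      have : ⌊M * X⌋₊ < n := by simpa using hn
      exact ((Nat.floor_lt (by positivity)).1 this).le
  obtain ⟨B, hB⟩ : ∃ B, ∀ u ∈ Set.Icc 0 M, |deriv g u| ≤ B := by
    obtain ⟨B, hB⟩ := isCompact_Icc.exists_bound_of_continuousOn
      (s := Set.Icc 0 M) hg'c.continuousOn
    exact ⟨B, fun u hu => hB u hu⟩
  have hev : ∀ᶠ t : ℝ in atTop, |F t| ≤ (|c| + 1) * (t * Real.log t ^ J) := by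
    have h1 : ∀ᶠ t : ℝ in atTop, |F t / (t * Real.log t ^ J)| < |c| + 1 :=
      hf.abs.eventually (gt_mem_nhds (by linarith))
    filter_upwards [h1, eventually_gt_atTop (1 : ℝ)] with t ht ht1
    have h0 : 0 < t * Real.log t ^ J := mul_pos (by linarith) (pow_pos (Real.log_pos ht1) _)
    rw [abs_div, abs_of_pos h0, div_lt_iff₀ h0] at ht
    exact ht.le
  obtain ⟨T, hT⟩ := eventually_atTop.1 hev
  have hlim : Tendsto (fun X : ℝ => ∫ u in (0 : ℝ)..M,
      deriv g u * F (u * X) / (X * Real.log X ^ J)) atTop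
      (𝓝 (∫ u in (0 : ℝ)..M, deriv g u * u * c)) := by
    refine intervalIntegral.tendsto_integral_filter_of_dominated_convergence
      (fun _ => B * ((|c| + 1) * (M * 2 ^ J))) ?_ ?_ intervalIntegrable_const ?_
    · refine Eventually.of_forall fun X => ?_
      refine Measurable.aestronglyMeasurable ?_
      exact (hg'c.measurable.mul (hFm.comp (measurable_id.mul_const X))).div_const _
    · filter_upwards [eventually_ge_atTop (T / α), eventually_ge_atTop (Real.exp 1),
        eventually_ge_atTop (1 / α), eventually_ge_atTop M] with X h1 h2 h3 h4
      refine Eventually.of_forall fun u hu => ?_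
      rw [Set.uIoc_of_le hM.le] at hu
      have hX1 : 1 ≤ X := (Real.one_le_exp zero_le_one).trans h2
      have hX0 : 0 < X := by linarith
      have hL : 1 ≤ Real.log X := (Real.le_log_iff_exp_le (by linarith)).2 h2
      have hB' := hB u ⟨hu.1.le, hu.2⟩
      have hB0 : 0 ≤ B := (abs_nonneg _).trans hB'
      rcases lt_or_ge u α with hlt | hge
      · rw [hg'l u hlt]
        simp only [zero_mul, zero_div, norm_zero]
        positivity
      · have huX : α * X ≤ u * X := by gcongr
        have hTu : T ≤ u * X := by
          rw [div_le_iff₀ hα] at h1; linarith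
        have h1u : 1 ≤ u * X := by
          rw [div_le_iff₀ hα] at h3; linarith
        have h0 : 0 < X * Real.log X ^ J := by positivity
        have hlog0 : 0 ≤ Real.log (u * X) := Real.log_nonneg h1u
        have hlog : Real.log (u * X) ≤ 2 * Real.log X := by
          calc Real.log (u * X) ≤ Real.log (X * X) :=
                Real.log_le_log (by linarith) (by gcongr; linarith [hu.2])
            _ = 2 * Real.log X := by rw [Real.log_mul hX0.ne' hX0.ne']; ring
        rw [Real.norm_eq_abs, abs_div, abs_mul, abs_of_pos h0, div_le_iff₀ h0]
        calc |deriv g u| * |F (u * X)|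
            ≤ B * ((|c| + 1) * (u * X * Real.log (u * X) ^ J)) := by
              gcongr
              exact hT _ hTu
          _ ≤ B * ((|c| + 1) * (M * X * (2 * Real.log X) ^ J)) := by
              gcongr
              exact hu.2
          _ = _ := by rw [mul_pow]; ring
    · refine Eventually.of_forall fun u hu => ?_
      rw [Set.uIoc_of_le hM.le] at hu
      have hu0 : 0 < u := hu.1
      have h1 : Tendsto (fun X : ℝ => u * X) atTop atTop := tendsto_id.const_mul_atTop hu0
      have h2 := hf.comp h1
      have h3 : Tendsto (fun X : ℝ => Real.log (X / u⁻¹) / Real.log X) atTop (𝓝 1) :=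
        tendsto_log_div_div_log (by positivity)
      have h4 := (h2.mul (h3.pow J)).const_mul (deriv g u * u)
      rw [one_pow, mul_one] at h4
      refine h4.congr' ?_
      filter_upwards [eventually_gt_atTop (1 : ℝ), eventually_gt_atTop (1 / u)] with X hX1 hXu
      have hX0 : 0 < X := by linarith
      have hL : 0 < Real.log X := Real.log_pos hX1
      have huX : 1 < u * X := by
        rw [div_lt_iff₀ hu0] at hXu; linarith
      have hLu : 0 < Real.log (u * X) := Real.log_pos huX
      simp only [Function.comp, hF, div_pow]
      rw [div_inv_eq_mul, mul_comm X u]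
      field_simp
  have hlim' := hlim.neg
  have e : -∫ u in (0 : ℝ)..M, deriv g u * u * c = c * ∫ u, g u := by
    rw [hibp, intervalIntegral.integral_mul_const]
    ring
  rw [e] at hlim'
  refine hlim'.congr' ?_
  filter_upwards [eventually_gt_atTop (0 : ℝ)] with X hX
  rw [hparts X hX, intervalIntegral.integral_div, neg_div]

end MeanValue

section EulerFactors
open Filter Topology ArithmeticFunction
open scoped ArithmeticFunction.zeta ArithmeticFunction.Moebius

theorem summable_abs_div_of_prime_pow_bound {h : ArithmeticFunction ℝ} (hm : h.IsMultiplicative)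
    {B C r : ℝ} (hr0 : 0 ≤ r) (hr : r < 2)
    (hB : ∀ p : ℕ, p.Prime → ∀ l, |h (p ^ l)| ≤ B * r ^ l)
    (hC : ∀ p : ℕ, p.Prime → |h p| ≤ C / p) :
    Summable fun n : ℕ => |h n / n| := by
  set F : ℕ → ℝ := fun n => |h n / n| with hF
  have hF0 : F 0 = 0 := by simp [hF]
  have hF1 : F 1 = 1 := by simp [hF, hm.map_one]
  have hFmul : ∀ {m n : ℕ}, Nat.Coprime m n → F (m * n) = F m * F n := by
    intro m n hmn
    simp only [hF]
    rw [hm.map_mul_of_coprime hmn, ← abs_mul]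
    congr 1
    push_cast
    rw [mul_div_mul_comm]
  have hB0 : 0 ≤ B := by simpa using (abs_nonneg _).trans (hB 2 Nat.prime_two 0)
  have hC0 : 0 ≤ C := by
    have := (abs_nonneg _).trans (hC 2 Nat.prime_two)
    by_contra hneg
    push Not at hneg
    have : C / ((2 : ℕ) : ℝ) < 0 := div_neg_of_neg_of_pos hneg (by norm_num)
    linarith
  have hrho : r / 2 < 1 := by linarith
  have hrho0 : 0 ≤ r / 2 := by linarith
  have hgeo := summable_geometric_of_lt_one hrho0 hrho
  have htail : ∀ p : ℕ, p.Prime → ∀ l : ℕ,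
      F (p ^ (l + 2)) ≤ B * r ^ 2 / (p : ℝ) ^ 2 * (r / 2) ^ l := by
    intro p hp l
    have hp2 : (2 : ℝ) ≤ p := by exact_mod_cast hp.two_le
    simp only [hF]
    rw [abs_div, abs_of_nonneg (Nat.cast_nonneg (p ^ (l + 2)) : (0 : ℝ) ≤ ((p ^ (l + 2) : ℕ) : ℝ))]
    push_cast
    calc |h (p ^ (l + 2))| / (p : ℝ) ^ (l + 2) ≤ B * r ^ (l + 2) / (p : ℝ) ^ (l + 2) := by
          gcongr
          exact hB p hp _
      _ = B * r ^ 2 / (p : ℝ) ^ 2 * (r / p) ^ l := by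
          rw [div_pow, pow_add, pow_add]; field_simp
      _ ≤ _ := by gcongr
  have hsum : ∀ p : ℕ, p.Prime → Summable fun l : ℕ => F (p ^ l) := fun p hp =>
    (summable_nat_add_iff 2).1
      (Summable.of_nonneg_of_le (fun _ => abs_nonneg _) (htail p hp) (hgeo.mul_left _))
  set D : ℝ := C + B * r ^ 2 * (1 - r / 2)⁻¹ with hD
  have hD0 : 0 ≤ D := by
    have : 0 < 1 - r / 2 := by linarith
    positivity
  have htsum : ∀ p : ℕ, p.Prime → ∑' l : ℕ, F (p ^ l) ≤ Real.exp (D / (p : ℝ) ^ 2) := by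
    intro p hp
    have hp0 : (0 : ℝ) < p := by exact_mod_cast hp.pos
    rw [← (hsum p hp).sum_add_tsum_nat_add 2, Finset.sum_range_succ, Finset.sum_range_one,
      pow_zero, pow_one, hF1]
    have h1 : F p ≤ C / (p : ℝ) ^ 2 := by
      simp only [hF]
      rw [abs_div, abs_of_pos hp0, div_le_iff₀ hp0]
      refine (hC p hp).trans (le_of_eq ?_)
      field_simp
    have h2 : ∑' l : ℕ, F (p ^ (l + 2)) ≤ B * r ^ 2 / (p : ℝ) ^ 2 * (1 - r / 2)⁻¹ := by
      rw [← tsum_geometric_of_lt_one hrho0 hrho, ← tsum_mul_left]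
      exact ((summable_nat_add_iff 2).2 (hsum p hp)).tsum_le_tsum (htail p hp) (hgeo.mul_left _)
    have h3 := Real.add_one_le_exp (D / (p : ℝ) ^ 2)
    have h4 : D / (p : ℝ) ^ 2 = C / (p : ℝ) ^ 2 + B * r ^ 2 / (p : ℝ) ^ 2 * (1 - r / 2)⁻¹ := by
      rw [hD]; ring
    linarith
  have hsq : Summable fun n : ℕ => D / (n : ℝ) ^ 2 := by
    have := (Real.summable_one_div_nat_pow (p := 2)).2 (by norm_num)
    simpa [div_eq_mul_inv] using this.mul_left D
  refine summable_of_sum_range_le (c := Real.exp (∑' n : ℕ, D / (n : ℝ) ^ 2))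
    (fun _ => abs_nonneg _) fun N => ?_
  obtain ⟨hs1, hs2⟩ := EulerProduct.summable_and_hasSum_smoothNumbers_prod_primesBelow_tsum
    (f := F) hF1 hFmul (fun {p} hp => (hsum p hp).norm) N
  have hle : ∑ n ∈ Finset.range N, F n ≤ ∏ p ∈ N.primesBelow, ∑' l : ℕ, F (p ^ l) := by
    rw [← hs2.tsum_eq]
    have hsub : ∀ n ∈ (Finset.range N).filter (· ≠ 0), n ∈ N.smoothNumbers := by
      intro n hn
      rw [Finset.mem_filter, Finset.mem_range] at hn
      rw [Nat.mem_smoothNumbers']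
      intro p hp hpn
      exact (Nat.le_of_dvd (Nat.pos_of_ne_zero hn.2) hpn).trans_lt hn.1
    rw [← Finset.sum_filter_of_ne (p := (· ≠ 0)) (s := Finset.range N) (f := F)
      (fun n _ hn h0 => hn (by rw [h0, hF0]))]
    have := hs2.summable.sum_le_tsum
      (((Finset.range N).filter (· ≠ 0)).subtype (· ∈ N.smoothNumbers))
      (fun _ _ => abs_nonneg _)
    refine le_trans (le_of_eq ?_) this
    exact (Finset.sum_subtype_of_mem F hsub).symm
  refine hle.trans ?_
  calc ∏ p ∈ N.primesBelow, ∑' l : ℕ, F (p ^ l)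
      ≤ ∏ p ∈ N.primesBelow, Real.exp (D / (p : ℝ) ^ 2) :=
        Finset.prod_le_prod (fun p _ => tsum_nonneg fun _ => abs_nonneg _)
          fun p hp => htsum p (Nat.prime_of_mem_primesBelow hp)
    _ = Real.exp (∑ p ∈ N.primesBelow, D / (p : ℝ) ^ 2) := (Real.exp_sum _ _).symm
    _ ≤ _ := Real.exp_le_exp.2 (hsq.sum_le_tsum _ fun _ _ => by positivity)

theorem mul_moebius_pow_apply_one (f : ArithmeticFunction ℝ) (j : ℕ) :
    (f * (μ : ArithmeticFunction ℝ) ^ j) 1 = f 1 := by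
  induction j with
  | zero => simp
  | succ j ih => rw [pow_succ, ← mul_assoc, mul_moebius_apply_one, ih]

theorem mul_moebius_pow_apply_prime (f : ArithmeticFunction ℝ) (j : ℕ) {p : ℕ} (hp : p.Prime) :
    (f * (μ : ArithmeticFunction ℝ) ^ j) p = f p - j * f 1 := by
  induction j with
  | zero => simp
  | succ j ih =>
    have := mul_moebius_apply_prime_pow_succ (f * (μ : ArithmeticFunction ℝ) ^ j) hp 0
    rw [zero_add, pow_one, pow_zero, ih, mul_moebius_pow_apply_one] at this
    rw [pow_succ, ← mul_assoc, this]
    push_cast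
    ring

theorem abs_mul_moebius_pow_apply_prime_pow_le (f : ArithmeticFunction ℝ) {p : ℕ} (hp : p.Prime)
    {B r : ℝ} (hr : 1 ≤ r) (hB : ∀ l, |f (p ^ l)| ≤ B * r ^ l) (j l : ℕ) :
    |(f * (μ : ArithmeticFunction ℝ) ^ j) (p ^ l)| ≤ 2 ^ j * B * r ^ l := by
  have hB0 : 0 ≤ B := by simpa using (abs_nonneg _).trans (hB 0)
  induction j generalizing l with
  | zero => simpa using hB l
  | succ j ih =>
    rw [pow_succ, ← mul_assoc]
    cases l with
    | zero =>
      rw [pow_zero, mul_moebius_apply_one]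
      have := ih 0
      rw [pow_zero] at this
      refine this.trans ?_
      simp only [pow_zero, mul_one, pow_succ]
      have : 0 ≤ 2 ^ j * B := by positivity
      linarith
    | succ l =>
      rw [mul_moebius_apply_prime_pow_succ _ hp]
      refine (abs_sub _ _).trans ((add_le_add (ih (l + 1)) (ih l)).trans ?_)
      have : 2 ^ j * B * r ^ l ≤ 2 ^ j * B * r ^ (l + 1) :=
        mul_le_mul_of_nonneg_left (pow_le_pow_right₀ hr (Nat.le_succ l)) (by positivity)
      rw [pow_succ 2 j]
      linarith

theorem hasSum_mul_moebius_pow (f : ArithmeticFunction ℝ) {p : ℕ} (hp : p.Prime) {s : ℝ}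
    (hs : HasSum (fun l : ℕ => f (p ^ l) / (p : ℝ) ^ l) s) (j : ℕ) :
    HasSum (fun l : ℕ => (f * (μ : ArithmeticFunction ℝ) ^ j) (p ^ l) / (p : ℝ) ^ l)
      ((1 - 1 / (p : ℝ)) ^ j * s) := by
  have hp0 : (p : ℝ) ≠ 0 := by exact_mod_cast hp.ne_zero
  induction j with
  | zero => simpa using hs
  | succ j ih =>
    set h := f * (μ : ArithmeticFunction ℝ) ^ j with hh
    rw [pow_succ, ← mul_assoc, ← hh]
    have h1 : HasSum (fun l : ℕ => h (p ^ (l + 1)) / (p : ℝ) ^ (l + 1))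
        ((1 - 1 / (p : ℝ)) ^ j * s - h 1) := by
      have := (hasSum_nat_add_iff' 1).2 ih
      simpa using this
    have h2 := h1.sub (ih.mul_left (1 / (p : ℝ)))
    have h3 : HasSum (fun l : ℕ =>
        (h * (μ : ArithmeticFunction ℝ)) (p ^ (l + 1)) / (p : ℝ) ^ (l + 1))
        ((1 - 1 / (p : ℝ)) ^ j * s - h 1 - 1 / (p : ℝ) * ((1 - 1 / (p : ℝ)) ^ j * s)) := by
      refine h2.congr_fun fun l => ?_
      rw [mul_moebius_apply_prime_pow_succ _ hp]
      field_simp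
      ring
    have h4 := (hasSum_nat_add_iff (f := fun l : ℕ =>
      (h * (μ : ArithmeticFunction ℝ)) (p ^ l) / (p : ℝ) ^ l) 1).1 h3
    simp only [Finset.sum_range_one, pow_zero, mul_moebius_apply_one, div_one] at h4
    have e : (1 - 1 / (p : ℝ)) ^ (j + 1) * s = (1 - 1 / (p : ℝ)) ^ j * s - h 1 -
        1 / (p : ℝ) * ((1 - 1 / (p : ℝ)) ^ j * s) + h 1 := by ring
    rw [e]
    exact h4

theorem hasProd_mul_moebius_pow {f : ArithmeticFunction ℝ} (hf : f.IsMultiplicative)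
    {B C r : ℝ} (hr1 : 1 ≤ r) (hr2 : r < 2) (K : ℕ)
    (hB : ∀ p : ℕ, p.Prime → ∀ l, |f (p ^ l)| ≤ B * r ^ l)
    (hC : ∀ p : ℕ, p.Prime → |f p - K| ≤ C / p) {s : ℕ → ℝ}
    (hs : ∀ p : ℕ, p.Prime → HasSum (fun l : ℕ => f (p ^ l) / (p : ℝ) ^ l) (s p)) :
    (Summable fun n : ℕ => |(f * (μ : ArithmeticFunction ℝ) ^ K) n / n|) ∧
    HasProd (fun p : Nat.Primes => (1 - 1 / ((p : ℕ) : ℝ)) ^ K * s p)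
      (∑' n : ℕ, (f * (μ : ArithmeticFunction ℝ) ^ K) n / n) := by
  set h := f * (μ : ArithmeticFunction ℝ) ^ K with hh
  have hm : h.IsMultiplicative :=
    hf.mul (isMultiplicative_moebius.intCast.pow (k := K))
  have hsum : Summable fun n : ℕ => |h n / n| := by
    refine summable_abs_div_of_prime_pow_bound hm (by linarith) hr2 (B := 2 ^ K * B) (C := C)
      (fun p hp l => abs_mul_moebius_pow_apply_prime_pow_le f hp hr1 (hB p hp) K l)
      fun p hp => ?_
    rw [hh, mul_moebius_pow_apply_prime _ _ hp, hf.map_one, mul_one]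
    exact hC p hp
  refine ⟨hsum, ?_⟩
  have := EulerProduct.eulerProduct_hasProd (f := fun n : ℕ => h n / n)
    (by simp [hm.map_one])
    (fun {m n} hmn => by
      simp only [hm.map_mul_of_coprime hmn]; push_cast; rw [mul_div_mul_comm])
    (by simpa only [Real.norm_eq_abs] using hsum) (by simp)
  have e : (fun p : Nat.Primes => (1 - 1 / ((p : ℕ) : ℝ)) ^ K * s p) =
      fun p : Nat.Primes => ∑' e : ℕ, h ((p : ℕ) ^ e) / (((p : ℕ) ^ e : ℕ) : ℝ) := by
    funext p
    rw [← (hasSum_mul_moebius_pow f p.2 (hs p p.2) K).tsum_eq]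
    push_cast
    rfl
  rw [e]
  exact this

end EulerFactors

section DivisorSquare
open Filter Topology ArithmeticFunction
open scoped ArithmeticFunction.zeta ArithmeticFunction.Moebius

/-- The arithmetic function `n ↦ d_k(n)²`. -/
noncomputable def dkSq (k : ℕ) : ArithmeticFunction ℝ :=
  ((ζ : ArithmeticFunction ℝ) ^ k).pmul ((ζ : ArithmeticFunction ℝ) ^ k)

/-- The arithmetic function `n ↦ φ(n) / n`. -/
noncomputable def totientRatio : ArithmeticFunction ℝ :=
  ⟨fun n => (n.totient : ℝ) / n, by simp⟩

theorem totientRatio_apply (n : ℕ) : totientRatio n = (n.totient : ℝ) / n := rfl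

theorem dkSq_apply (k n : ℕ) : dkSq k n = (dk k n : ℝ) ^ 2 := by
  rw [dkSq, pmul_apply, dk_cast, sq]

theorem isMultiplicative_dkSq (k : ℕ) : (dkSq k).IsMultiplicative := by
  have : ((ζ : ArithmeticFunction ℝ) ^ k).IsMultiplicative :=
    (isMultiplicative_zeta.natCast).pow
  exact this.pmul this

theorem isMultiplicative_totientRatio : totientRatio.IsMultiplicative := by
  refine ⟨by simp [totientRatio_apply], fun {m n} hmn => ?_⟩
  simp only [totientRatio_apply]
  rw [Nat.totient_mul hmn]
  push_cast
  rw [mul_div_mul_comm]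

theorem totientRatio_apply_prime_pow_succ {p : ℕ} (hp : p.Prime) (l : ℕ) :
    totientRatio (p ^ (l + 1)) = 1 - 1 / (p : ℝ) := by
  have hp0 : (p : ℝ) ≠ 0 := by exact_mod_cast hp.ne_zero
  rw [totientRatio_apply, Nat.totient_prime_pow_succ hp]
  push_cast [Nat.cast_sub hp.one_le]
  field_simp
  ring

theorem totientRatio_nonneg (n : ℕ) : 0 ≤ totientRatio n := by
  rw [totientRatio_apply]; positivity

theorem totientRatio_le_one (n : ℕ) : totientRatio n ≤ 1 := by
  rw [totientRatio_apply]
  exact div_le_one_of_le₀ (by exact_mod_cast Nat.totient_le n) (Nat.cast_nonneg n)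

theorem dkSq_apply_prime_pow (m : ℕ) {p : ℕ} (hp : p.Prime) (l : ℕ) :
    dkSq (m + 1) (p ^ l) = ((l + m).choose m : ℝ) ^ 2 := by
  rw [dkSq, pmul_apply, zeta_pow_apply_prime_pow m hp, sq]

theorem exists_choose_sq_le (m : ℕ) :
    ∃ B : ℝ, 0 ≤ B ∧ ∀ l : ℕ, ((l + m).choose m : ℝ) ^ 2 ≤ B * (25 / 16) ^ l := by
  have hs := summable_choose_mul_geometric_of_norm_lt_one m (r := (4 / 5 : ℝ)) (by norm_num)
  refine ⟨(∑' l : ℕ, ((l + m).choose m : ℝ) * (4 / 5) ^ l) ^ 2, sq_nonneg _, fun l => ?_⟩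
  have h := hs.le_tsum l fun _ _ => by positivity
  have e : (25 / 16 : ℝ) ^ l = ((5 / 4) ^ l) ^ 2 := by
    rw [← pow_mul, mul_comm, pow_mul]; norm_num
  rw [e, ← mul_pow]
  refine pow_le_pow_left₀ (by positivity) ?_ 2
  calc ((l + m).choose m : ℝ) = ((l + m).choose m : ℝ) * (4 / 5) ^ l * (5 / 4) ^ l := by
        rw [mul_assoc, ← mul_pow]; norm_num
    _ ≤ _ := by gcongr

theorem summable_choose_sq_div (m : ℕ) {p : ℕ} (hp : p.Prime) :
    Summable fun l : ℕ => ((l + m).choose m : ℝ) ^ 2 / (p : ℝ) ^ l := by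
  obtain ⟨B, hB0, hB⟩ := exists_choose_sq_le m
  have hp2 : (2 : ℝ) ≤ p := by exact_mod_cast hp.two_le
  refine Summable.of_nonneg_of_le (fun _ => by positivity) (fun l => ?_)
    ((summable_geometric_of_lt_one (r := (25 / 32 : ℝ)) (by norm_num) (by norm_num)).mul_left B)
  calc ((l + m).choose m : ℝ) ^ 2 / (p : ℝ) ^ l ≤ B * (25 / 16) ^ l / 2 ^ l := by
        gcongr
        exact hB l
    _ = B * (25 / 32) ^ l := by rw [mul_div_assoc, ← div_pow]; norm_num

theorem frakA_eq_tsum (m p : ℕ) :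
    frakA (m + 1) p = ∑' l : ℕ, ((l + m).choose m : ℝ) ^ 2 / (p : ℝ) ^ l := by
  refine tsum_congr fun l => ?_
  rw [Nat.add_sub_cancel, show m + 1 + l - 1 = l + m by omega]

theorem one_le_frakA (m : ℕ) {p : ℕ} (hp : p.Prime) : 1 ≤ frakA (m + 1) p := by
  rw [frakA_eq_tsum]
  have := (summable_choose_sq_div m hp).le_tsum 0 fun _ _ => by positivity
  simpa using this

theorem exists_frakA_sub_one_le (m : ℕ) :
    ∃ C : ℝ, ∀ p : ℕ, p.Prime → frakA (m + 1) p - 1 ≤ C / p := by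
  obtain ⟨B, hB0, hB⟩ := exists_choose_sq_le m
  have hg := summable_geometric_of_lt_one (r := (25 / 32 : ℝ)) (by norm_num) (by norm_num)
  refine ⟨∑' l : ℕ, B * (25 / 16) * (25 / 32) ^ l, fun p hp => ?_⟩
  have hp2 : (2 : ℝ) ≤ p := by exact_mod_cast hp.two_le
  have hs := summable_choose_sq_div m hp
  rw [frakA_eq_tsum, hs.tsum_eq_zero_add, ← tsum_div_const]
  have h0 : ((0 + m).choose m : ℝ) ^ 2 / (p : ℝ) ^ 0 = 1 := by simp
  rw [h0, add_sub_cancel_left]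
  refine ((summable_nat_add_iff 1).2 hs).tsum_le_tsum (fun l => ?_)
    ((hg.mul_left _).div_const _)
  calc ((l + 1 + m).choose m : ℝ) ^ 2 / (p : ℝ) ^ (l + 1)
      ≤ B * (25 / 16) ^ (l + 1) / (p : ℝ) ^ (l + 1) := by
        gcongr
        exact hB _
    _ = B * (25 / 16) * (25 / 16 / p) ^ l / p := by
        rw [div_pow (25 / 16) (p : ℝ)]; ring
    _ ≤ B * (25 / 16) * (25 / 16 / 2) ^ l / p := by gcongr
    _ = _ := by norm_num

theorem summable_and_hasProd_dkSq (m : ℕ) :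
    (Summable fun n : ℕ => |(dkSq (m + 1) * (μ : ArithmeticFunction ℝ) ^ (m + 1) ^ 2) n / n|) ∧
    HasProd (fun p : Nat.Primes => (1 - 1 / ((p : ℕ) : ℝ)) ^ (m + 1) ^ 2 * frakA (m + 1) p)
      (∑' n : ℕ, (dkSq (m + 1) * (μ : ArithmeticFunction ℝ) ^ (m + 1) ^ 2) n / n) := by
  obtain ⟨B, hB0, hB⟩ := exists_choose_sq_le m
  refine hasProd_mul_moebius_pow (isMultiplicative_dkSq _) (B := B) (C := 0) (r := 25 / 16)
    (by norm_num) (by norm_num) _ (fun p hp l => ?_) (fun p hp => ?_) (fun p hp => ?_)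
  · rw [dkSq_apply_prime_pow m hp, abs_of_nonneg (sq_nonneg _)]
    exact hB l
  · have := dkSq_apply_prime_pow m hp 1
    rw [pow_one] at this
    rw [this, add_comm 1 m, Nat.choose_symm_of_eq_add (show m + 1 = m + 1 from rfl)]
    simp
  · simp only [dkSq_apply_prime_pow m hp]
    rw [frakA_eq_tsum]
    exact (summable_choose_sq_div m hp).hasSum

theorem summable_and_hasProd_dkSq_totient (m : ℕ) :
    (Summable fun n : ℕ =>
      |((dkSq (m + 1)).pmul totientRatio * (μ : ArithmeticFunction ℝ) ^ (m + 1) ^ 2) n / n|) ∧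
    HasProd (fun p : Nat.Primes => (1 - 1 / ((p : ℕ) : ℝ)) ^ (m + 1) ^ 2 *
        (1 + (1 - 1 / ((p : ℕ) : ℝ)) * (frakA (m + 1) p - 1)))
      (∑' n : ℕ,
        ((dkSq (m + 1)).pmul totientRatio * (μ : ArithmeticFunction ℝ) ^ (m + 1) ^ 2) n / n) := by
  obtain ⟨B, hB0, hB⟩ := exists_choose_sq_le m
  refine hasProd_mul_moebius_pow ((isMultiplicative_dkSq _).pmul isMultiplicative_totientRatio)
    (B := B) (C := (m + 1) ^ 2) (r := 25 / 16) (by norm_num) (by norm_num) _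
    (s := fun p => 1 + (1 - 1 / (p : ℝ)) * (frakA (m + 1) p - 1))
    (fun p hp l => ?_) (fun p hp => ?_) (fun p hp => ?_)
  · rw [pmul_apply, dkSq_apply_prime_pow m hp,
      abs_of_nonneg (mul_nonneg (sq_nonneg _) (totientRatio_nonneg _))]
    exact (mul_le_of_le_one_right (sq_nonneg _) (totientRatio_le_one _)).trans (hB l)
  · have h1 := dkSq_apply_prime_pow m hp 1
    have h2 := totientRatio_apply_prime_pow_succ hp 0
    rw [zero_add, pow_one] at h2
    rw [pow_one, add_comm 1 m, Nat.choose_symm_of_eq_add (show m + 1 = m + 1 from rfl)] at h1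
    rw [pmul_apply, h1, h2]
    have hp0 : (0 : ℝ) < p := by exact_mod_cast hp.pos
    refine le_of_eq ?_
    have e : ((m + 1).choose 1 : ℝ) ^ 2 * (1 - 1 / (p : ℝ)) - (((m + 1) ^ 2 : ℕ) : ℝ) =
        -((m + 1) ^ 2 / p) := by
      rw [Nat.choose_one_right]
      push_cast
      ring
    rw [e, abs_neg, abs_of_nonneg (by positivity)]
  · have hs := summable_choose_sq_div m hp
    have h3 : HasSum (fun l : ℕ => ((l + 1 + m).choose m : ℝ) ^ 2 / (p : ℝ) ^ (l + 1))
        (frakA (m + 1) p - 1) := by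
      have := (hasSum_nat_add_iff' 1).2 hs.hasSum
      rw [frakA_eq_tsum]
      simpa using this
    have h4 : HasSum (fun l : ℕ =>
        (dkSq (m + 1)).pmul totientRatio (p ^ (l + 1)) / (p : ℝ) ^ (l + 1))
        ((1 - 1 / (p : ℝ)) * (frakA (m + 1) p - 1)) := by
      refine (h3.mul_left (1 - 1 / (p : ℝ))).congr_fun fun l => ?_
      rw [pmul_apply, dkSq_apply_prime_pow m hp, totientRatio_apply_prime_pow_succ hp]
      ring
    have h5 := (hasSum_nat_add_iff (f := fun l : ℕ =>
      (dkSq (m + 1)).pmul totientRatio (p ^ l) / (p : ℝ) ^ l) 1).1 h4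
    have h6 : (dkSq (m + 1)).pmul totientRatio 1 = 1 :=
      ((isMultiplicative_dkSq _).pmul isMultiplicative_totientRatio).map_one
    simp only [Finset.sum_range_one, pow_zero, div_one, h6] at h5
    rw [add_comm (_ * _) (1 : ℝ)] at h5
    exact h5

theorem multipliable_one_sub_frakA_inv_div (m : ℕ) :
    Multipliable fun p : Nat.Primes => (1 - (1 - (frakA (m + 1) p)⁻¹) / ((p : ℕ) : ℝ)) := by
  obtain ⟨C, hC⟩ := exists_frakA_sub_one_le m
  have hsq : Summable fun p : Nat.Primes => C / ((p : ℕ) : ℝ) ^ 2 := by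
    have := (Real.summable_one_div_nat_pow (p := 2)).2 (by norm_num)
    have h2 : Summable fun n : ℕ => C / (n : ℝ) ^ 2 := by
      simpa [div_eq_mul_inv] using this.mul_left C
    exact h2.comp_injective (i := fun p : Nat.Primes => (p : ℕ)) Subtype.val_injective
  have hs : Summable fun p : Nat.Primes => (1 - (frakA (m + 1) p)⁻¹) / ((p : ℕ) : ℝ) := by
    refine Summable.of_nonneg_of_le (fun p => ?_) (fun p => ?_) hsq
    · have := inv_le_one_of_one_le₀ (one_le_frakA m p.2)
      exact div_nonneg (by linarith) (Nat.cast_nonneg _)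
    · have h1 := one_le_frakA m p.2
      have hp0 : (0 : ℝ) < (p : ℕ) := by exact_mod_cast p.2.pos
      have h2 : 1 - (frakA (m + 1) p)⁻¹ ≤ frakA (m + 1) p - 1 := by
        have : 0 < frakA (m + 1) p := by linarith
        have h3 : (frakA (m + 1) p)⁻¹ * frakA (m + 1) p = 1 := inv_mul_cancel₀ this.ne'
        nlinarith [sq_nonneg (frakA (m + 1) p - 1), inv_pos.2 this]
      calc (1 - (frakA (m + 1) p)⁻¹) / ((p : ℕ) : ℝ) ≤ C / ((p : ℕ) : ℝ) / ((p : ℕ) : ℝ) := by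
            gcongr
            exact h2.trans (hC p p.2)
        _ = _ := by rw [div_div, sq]
  simpa only [← sub_eq_add_neg] using Real.multipliable_one_add_of_summable hs.neg

theorem aTilde_eq_tsum (m : ℕ) :
    aTilde (m + 1) = ∑' n : ℕ,
      ((dkSq (m + 1)).pmul totientRatio * (μ : ArithmeticFunction ℝ) ^ (m + 1) ^ 2) n / n := by
  have h0 := (summable_and_hasProd_dkSq m).2
  have h1 := (summable_and_hasProd_dkSq_totient m).2
  rw [aTilde, aCst, ← h0.multipliable.tprod_mul (multipliable_one_sub_frakA_inv_div m),
    ← h1.tprod_eq]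
  refine tprod_congr fun p => ?_
  have hp0 : ((p : ℕ) : ℝ) ≠ 0 := by exact_mod_cast p.2.ne_zero
  have h1 : frakA (m + 1) p ≠ 0 := by linarith [one_le_frakA m p.2]
  rw [mul_assoc]
  congr 1
  field_simp
  ring

theorem mul_moebius_pow_mul_zeta_pow (f : ArithmeticFunction ℝ) (K : ℕ) :
    f * (μ : ArithmeticFunction ℝ) ^ K * (ζ : ArithmeticFunction ℝ) ^ K = f := by
  rw [mul_assoc, ← mul_pow, coe_moebius_mul_coe_zeta, one_pow, mul_one]

theorem tendsto_tsum_dkSq_totient {k : ℕ} (hk : 2 ≤ k) {g : ℝ → ℝ} (hg : ContDiff ℝ 1 g)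
    {α M : ℝ} (hα : 0 < α) (hαM : α < M) (hgl : ∀ u < α, g u = 0) (hgr : ∀ u, M ≤ u → g u = 0) :
    Tendsto (fun X : ℝ => (∑' n : ℕ, (dk k n : ℝ) ^ 2 * totientRatio n * g (n / X)) /
      (X * Real.log X ^ (k ^ 2 - 1))) atTop
      (𝓝 (aTilde k / (k ^ 2 - 1).factorial * ∫ u, g u)) := by
  obtain ⟨m, rfl⟩ : ∃ m, k = m + 1 := ⟨k - 1, by omega⟩
  obtain ⟨i, hi⟩ := Nat.exists_eq_add_of_le' (show 2 ≤ (m + 1) ^ 2 by nlinarith)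
  have h := tendsto_sum_mul_zeta_pow_div _ (summable_and_hasProd_dkSq_totient m).1 i
  rw [← aTilde_eq_tsum, ← hi, mul_moebius_pow_mul_zeta_pow] at h
  have := tendsto_weighted_sum_div _ (by simp) _ _ h g hg hα hαM hgl hgr
  rw [hi, show i + 2 - 1 = i + 1 from rfl]
  simpa only [pmul_apply, dkSq_apply] using this

theorem tendsto_tsum_dkSq {k : ℕ} (hk : 2 ≤ k) {g : ℝ → ℝ} (hg : ContDiff ℝ 1 g)
    {α M : ℝ} (hα : 0 < α) (hαM : α < M) (hgl : ∀ u < α, g u = 0) (hgr : ∀ u, M ≤ u → g u = 0) :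
    Tendsto (fun X : ℝ => (∑' n : ℕ, (dk k n : ℝ) ^ 2 * g (n / X)) /
      (X * Real.log X ^ (k ^ 2 - 1))) atTop
      (𝓝 (aCst k / (k ^ 2 - 1).factorial * ∫ u, g u)) := by
  obtain ⟨m, rfl⟩ : ∃ m, k = m + 1 := ⟨k - 1, by omega⟩
  obtain ⟨i, hi⟩ := Nat.exists_eq_add_of_le' (show 2 ≤ (m + 1) ^ 2 by nlinarith)
  have h := tendsto_sum_mul_zeta_pow_div _ (summable_and_hasProd_dkSq m).1 i
  rw [← (summable_and_hasProd_dkSq m).2.tprod_eq, ← aCst, ← hi, mul_moebius_pow_mul_zeta_pow] at h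
  have := tendsto_weighted_sum_div _ (by simp) _ _ h g hg hα hαM hgl hgr
  rw [hi, show i + 2 - 1 = i + 1 from rfl]
  simpa only [dkSq_apply] using this

end DivisorSquare

section Totient
open Filter Topology

theorem inv_card_add_one_le_prod_one_sub_inv (S : Finset ℕ) (hS : ∀ a ∈ S, 2 ≤ a) :
    1 / ((S.card : ℝ) + 1) ≤ ∏ a ∈ S, (1 - 1 / (a : ℝ)) := by
  induction S using Finset.induction_on_max with
  | empty => simp
  | insert a s has ih =>
    have hn : a ∉ s := fun h => lt_irrefl _ (has a h)
    have ha2 : 2 ≤ a := hS a (Finset.mem_insert_self _ _)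
    have hcard : s.card + 2 ≤ a := by
      have hsub : s ⊆ Finset.Ico 2 a := fun b hb =>
        Finset.mem_Ico.2 ⟨hS b (Finset.mem_insert_of_mem hb), has b hb⟩
      have := Finset.card_le_card hsub
      rw [Nat.card_Ico] at this
      omega
    have hcard' : (s.card : ℝ) + 2 ≤ a := by exact_mod_cast hcard
    have h1 := ih fun b hb => hS b (Finset.mem_insert_of_mem hb)
    have h2 : ((s.card : ℝ) + 1) / (s.card + 2) ≤ 1 - 1 / (a : ℝ) := by
      have : 1 / (a : ℝ) ≤ 1 / ((s.card : ℝ) + 2) :=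
        one_div_le_one_div_of_le (by positivity) hcard'
      have e : ((s.card : ℝ) + 1) / (s.card + 2) = 1 - 1 / ((s.card : ℝ) + 2) := by
        field_simp
        ring
      linarith
    have h3 : 0 ≤ 1 - 1 / (a : ℝ) := le_trans (by positivity) h2
    rw [Finset.prod_insert hn, Finset.card_insert_of_notMem hn]
    push_cast
    calc 1 / ((s.card : ℝ) + 1 + 1)
        = ((s.card : ℝ) + 1) / (s.card + 2) * (1 / ((s.card : ℝ) + 1)) := by
          field_simp
          ring
      _ ≤ _ := by gcongr

theorem card_primeFactors_mul_log_two_le {q : ℕ} (hq : q ≠ 0) :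
    (q.primeFactors.card : ℝ) * Real.log 2 ≤ Real.log q := by
  have h : 2 ^ q.primeFactors.card ≤ q :=
    (Finset.pow_card_le_prod _ _ _ fun p hp => (Nat.prime_of_mem_primeFactors hp).two_le).trans
      (Nat.le_of_dvd (Nat.pos_of_ne_zero hq) (Nat.prod_primeFactors_dvd q))
  rw [← Real.log_pow]
  exact Real.log_le_log (by positivity) (by exact_mod_cast h)

theorem one_div_totient_le {q : ℕ} (hq : q ≠ 0) :
    1 / (q.totient : ℝ) ≤ (Real.log q / Real.log 2 + 1) / q := by
  have hq0 : (0 : ℝ) < q := by exact_mod_cast Nat.pos_of_ne_zero hq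
  have hl2 := Real.log_pos one_lt_two
  have h1 : (q.totient : ℝ) = q * ∏ p ∈ q.primeFactors, (1 - 1 / (p : ℝ)) := by
    have := Nat.totient_eq_mul_prod_factors q
    have h2 : ((q.totient : ℚ) : ℝ) = ((q * ∏ p ∈ q.primeFactors, (1 - (p : ℚ)⁻¹) : ℚ) : ℝ) := by
      rw [this]
    push_cast at h2
    simpa [one_div] using h2
  have h3 := inv_card_add_one_le_prod_one_sub_inv q.primeFactors
    fun p hp => (Nat.prime_of_mem_primeFactors hp).two_le
  have h4 : (q.primeFactors.card : ℝ) ≤ Real.log q / Real.log 2 := by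
    rw [le_div_iff₀ hl2]
    exact card_primeFactors_mul_log_two_le hq
  have h5 : (0 : ℝ) < 1 / ((q.primeFactors.card : ℝ) + 1) := by positivity
  calc 1 / (q.totient : ℝ) ≤ 1 / (q * (1 / ((q.primeFactors.card : ℝ) + 1))) := by
        rw [h1]
        exact one_div_le_one_div_of_le (by positivity) (by gcongr)
    _ = (q.primeFactors.card + 1) / q := by field_simp
    _ ≤ _ := by gcongr

end Totient

section CoprimeSum
open Filter Topology

theorem abs_sum_coprime_block_sub_le {Φ : ℝ → ℝ} {L : ℝ}
    (hL : ∀ x y, |Φ x - Φ y| ≤ L * |x - y|) (hc : Continuous Φ) {Q : ℝ} (hQ : 0 < Q)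
    {n : ℕ} (hn : 0 < n) (a : ℕ) :
    |(∑ q ∈ Finset.Ico a (a + n), if Nat.gcd n q = 1 then Φ (q / Q) else 0) -
      n.totient / n * ∫ t in (a : ℝ)..((a + n : ℕ) : ℝ), Φ (t / Q)| ≤ 2 * L * n ^ 2 / Q := by
  have hn0 : (0 : ℝ) < n := by exact_mod_cast hn
  have hL0 : 0 ≤ L := by
    have := (abs_nonneg _).trans (hL 0 1)
    simpa using this
  have hφ : (n.totient : ℝ) ≤ n := by exact_mod_cast n.totient_le
  have hcont : Continuous fun t : ℝ => Φ (t / Q) := hc.comp (continuous_id.div_const Q)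
  set A : ℝ := Φ (a / Q) with hA
  have h1 : |(∑ q ∈ Finset.Ico a (a + n), if Nat.gcd n q = 1 then Φ (q / Q) else 0) -
      n.totient * A| ≤ n.totient * (L * (n / Q)) := by
    have hcard := Nat.filter_coprime_Ico_eq_totient n a
    rw [← Finset.sum_filter]
    have e : (n.totient : ℝ) * A =
        ∑ q ∈ (Finset.Ico a (a + n)).filter (fun q => Nat.gcd n q = 1), A := by
      rw [Finset.sum_const, nsmul_eq_mul]
      congr 2
      exact hcard.symm
    rw [e, ← Finset.sum_sub_distrib]
    refine (Finset.abs_sum_le_sum_abs _ _).trans ?_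
    refine (Finset.sum_le_card_nsmul _ _ (L * (n / Q)) fun q hq => ?_).trans ?_
    · rw [Finset.mem_filter, Finset.mem_Ico] at hq
      refine (hL _ _).trans ?_
      have h2 : (a : ℝ) ≤ q := by exact_mod_cast hq.1.1
      have h3 : (q : ℝ) ≤ a + n := by exact_mod_cast hq.1.2.le
      rw [← sub_div, abs_of_nonneg (div_nonneg (by linarith) hQ.le)]
      gcongr
      linarith
    · rw [nsmul_eq_mul]
      refine le_of_eq ?_
      congr 2
  have h2 : |(∫ t in (a : ℝ)..((a + n : ℕ) : ℝ), Φ (t / Q)) - n * A| ≤ L * (n / Q) * n := by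
    have e : (n : ℝ) * A = ∫ _t in (a : ℝ)..((a + n : ℕ) : ℝ), A := by
      rw [intervalIntegral.integral_const]
      push_cast
      simp
    rw [e, ← intervalIntegral.integral_sub (hcont.intervalIntegrable _ _)
      (continuous_const.intervalIntegrable _ _)]
    have := intervalIntegral.norm_integral_le_of_norm_le_const (a := (a : ℝ))
      (b := ((a + n : ℕ) : ℝ)) (f := fun t => Φ (t / Q) - A) (C := L * (n / Q)) (fun t ht => by
        rw [Set.uIoc_of_le (by push_cast; linarith)] at ht
        push_cast at ht
        refine (hL _ _).trans ?_
        rw [← sub_div, abs_of_nonneg (div_nonneg (by linarith [ht.1]) hQ.le)]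
        gcongr
        linarith [ht.2])
    rw [Real.norm_eq_abs] at this
    refine this.trans (le_of_eq ?_)
    push_cast
    rw [add_sub_cancel_left, abs_of_pos hn0]
  set S := ∑ q ∈ Finset.Ico a (a + n), if Nat.gcd n q = 1 then Φ (q / Q) else 0
  set I := ∫ t in (a : ℝ)..((a + n : ℕ) : ℝ), Φ (t / Q)
  have e : S - n.totient / n * I = (S - n.totient * A) - n.totient / n * (I - n * A) := by
    field_simp
    ring
  rw [e]
  refine (abs_sub _ _).trans ?_
  rw [abs_mul, abs_of_nonneg (by positivity : (0 : ℝ) ≤ n.totient / n)]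
  calc |S - n.totient * A| + n.totient / n * |I - n * A|
      ≤ n.totient * (L * (n / Q)) + n.totient / n * (L * (n / Q) * n) := by gcongr
    _ = 2 * L * (n.totient * n) / Q := by field_simp; ring
    _ ≤ 2 * L * (n * n) / Q := by gcongr
    _ = _ := by ring

theorem abs_sum_coprime_range_sub_le {Φ : ℝ → ℝ} {L : ℝ}
    (hL : ∀ x y, |Φ x - Φ y| ≤ L * |x - y|) (hc : Continuous Φ) {Q : ℝ} (hQ : 0 < Q)
    {n : ℕ} (hn : 0 < n) (N : ℕ) :
    |(∑ q ∈ Finset.range (N * n), if Nat.gcd n q = 1 then Φ (q / Q) else 0) -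
      n.totient / n * ∫ t in (0 : ℝ)..((N * n : ℕ) : ℝ), Φ (t / Q)| ≤
      N * (2 * L * n ^ 2 / Q) := by
  have hcont : Continuous fun t : ℝ => Φ (t / Q) := hc.comp (continuous_id.div_const Q)
  induction N with
  | zero => simp
  | succ N ih =>
    have hb := abs_sum_coprime_block_sub_le hL hc hQ hn (N * n)
    have e1 := intervalIntegral.integral_add_adjacent_intervals
      (hcont.intervalIntegrable (μ := volume) 0 ((N * n : ℕ) : ℝ))
      (hcont.intervalIntegrable (μ := volume) ((N * n : ℕ) : ℝ) ((N * n + n : ℕ) : ℝ))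
    have e2 := Finset.sum_range_add_sum_Ico
      (fun q : ℕ => if Nat.gcd n q = 1 then Φ (q / Q) else 0) (Nat.le_add_right (N * n) n)
    rw [Nat.succ_mul, ← e1, ← e2]
    push_cast at *
    refine le_trans (le_of_eq ?_) ((abs_add_le _ _).trans ((add_le_add ih hb).trans (le_of_eq ?_)))
    · congr 1
      ring
    · ring

theorem abs_sum_coprime_sub_le {Φ : ℝ → ℝ} {L : ℝ}
    (hL : ∀ x y, |Φ x - Φ y| ≤ L * |x - y|) (hc : Continuous Φ) {M : ℝ}
    (hΦl : ∀ u ≤ 0, Φ u = 0) (hΦr : ∀ u, M ≤ u → Φ u = 0) (hΦint : ∫ u, Φ u = 1)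
    {Q : ℝ} (hQ : 0 < Q) {n : ℕ} (hn : 0 < n) (hnQ : n ≤ M * Q) {R : ℕ} (hR : M * Q ≤ R + 1) :
    |(∑ q ∈ Finset.Icc 1 R, if Nat.gcd n q = 1 then Φ (q / Q) else 0) -
      Q * (n.totient / n)| ≤ 4 * L * M * n := by
  have hn0 : (0 : ℝ) < n := by exact_mod_cast hn
  have hL0 : 0 ≤ L := by
    have := (abs_nonneg _).trans (hL 0 1)
    simpa using this
  set N := ⌈M * Q / n⌉₊ with hN
  have hN1 : M * Q ≤ N * n := by
    rw [← div_le_iff₀ hn0]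
    exact Nat.le_ceil _
  have hMQ : 0 < M * Q := hn0.trans_le hnQ
  have hN2 : (N : ℝ) * n ≤ 2 * (M * Q) := by
    have := (Nat.ceil_lt_add_one (div_pos hMQ hn0).le).le
    calc (N : ℝ) * n ≤ (M * Q / n + 1) * n := by gcongr
      _ = M * Q + n := by field_simp
      _ ≤ _ := by linarith
  have hvan : ∀ q : ℕ, M * Q ≤ q → Φ (q / Q) = 0 := fun q hq =>
    hΦr _ (by rwa [le_div_iff₀ hQ])
  have e1 : ∑ q ∈ Finset.range (N * n), (if Nat.gcd n q = 1 then Φ (q / Q) else 0) =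
      ∑ q ∈ Finset.Icc 1 R, if Nat.gcd n q = 1 then Φ (q / Q) else 0 := by
    have h0 : ∀ q : ℕ, ((q : ℝ) < M * Q → q ≠ 0 → False) →
        (if Nat.gcd n q = 1 then Φ (q / Q) else 0) = 0 := by
      intro q hq
      have : Φ (q / Q) = 0 := by
        by_cases h : M * Q ≤ q
        · exact hvan q h
        · by_cases hq0 : q = 0
          · subst hq0
            exact hΦl _ (by simp)
          · exact (hq (not_le.1 h) hq0).elim
      simp [this]
    refine (Finset.sum_subset (Finset.subset_union_left (s₂ := Finset.Icc 1 R)) ?_).trans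
      (Finset.sum_subset (Finset.subset_union_right (s₁ := Finset.range (N * n))) ?_).symm
    · intro q _ hq
      refine h0 q fun h1 h2 => hq ?_
      rw [Finset.mem_range]
      have := h1.trans_le hN1
      exact_mod_cast this
    · intro q _ hq
      refine h0 q fun h1 h2 => hq ?_
      rw [Finset.mem_Icc]
      have : (q : ℝ) < R + 1 := h1.trans_le hR
      have : q < R + 1 := by exact_mod_cast this
      omega
  have e2 : ∫ t in (0 : ℝ)..((N * n : ℕ) : ℝ), Φ (t / Q) = Q := by
    rw [intervalIntegral.integral_comp_div (fun u => Φ u) hQ.ne', smul_eq_mul, zero_div,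
      intervalIntegral.integral_eq_integral_of_support_subset, hΦint, mul_one]
    intro u hu
    rw [Function.mem_support] at hu
    refine ⟨not_le.1 fun h => hu (hΦl u h), ?_⟩
    have : u < M := not_le.1 fun h => hu (hΦr u h)
    refine this.le.trans ?_
    rw [le_div_iff₀ hQ]
    push_cast
    exact hN1
  have h := abs_sum_coprime_range_sub_le hL hc hQ hn N
  rw [e1, e2, mul_comm _ Q] at h
  refine h.trans ?_
  calc N * (2 * L * n ^ 2 / Q) = 2 * L * n * (N * n) / Q := by ring
    _ ≤ 2 * L * n * (2 * (M * Q)) / Q := by gcongr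
    _ = _ := by field_simp; ring

end CoprimeSum

section Variance
open Filter Topology

theorem progSum_eq (k : ℕ) {Ψ : ℝ → ℝ} {M X : ℝ} (hX : 0 < X) (hΨr : ∀ u, M ≤ u → Ψ u = 0)
    {q a : ℕ} (hq : M * X ≤ q) (ha : a < q) :
    progSum k Ψ q a X = dk k a * Ψ (a / X) := by
  rw [progSum, tsum_eq_single a]
  · simp
  · intro n hn
    split_ifs with h
    · rw [ZMod.natCast_eq_natCast_iff'] at h
      have hqn : q ≤ n := by
        by_contra hlt
        rw [Nat.mod_eq_of_lt (not_le.1 hlt), Nat.mod_eq_of_lt ha] at h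
        exact hn h
      have : (q : ℝ) ≤ n := by exact_mod_cast hqn
      rw [hΨr _ (by rw [le_div_iff₀ hX]; linarith), mul_zero]
    · rfl

theorem tsum_eq_sum_Icc {F : ℕ → ℝ} (hF0 : F 0 = 0) {R : ℕ} (hF : ∀ n, R < n → F n = 0) :
    ∑' n, F n = ∑ n ∈ Finset.Icc 1 R, F n := by
  refine tsum_eq_sum fun n hn => ?_
  rw [Finset.mem_Icc] at hn
  rcases Nat.eq_zero_or_pos n with rfl | h
  · exact hF0
  · exact hF n (by omega)

theorem copSum_eq (k : ℕ) {Ψ : ℝ → ℝ} {X : ℝ} (q : ℕ) {R : ℕ}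
    (hR : ∀ n : ℕ, R < n → Ψ (n / X) = 0) :
    copSum k Ψ q X =
      ∑ n ∈ Finset.Icc 1 R, if Nat.gcd n q = 1 then (dk k n : ℝ) * Ψ (n / X) else 0 := by
  refine tsum_eq_sum_Icc (by simp [dk_zero]) fun n hn => ?_
  simp [hR n hn]

theorem Vk_eq (k : ℕ) {Ψ : ℝ → ℝ} {M X : ℝ} (hX : 0 < X) (hΨr : ∀ u, M ≤ u → Ψ u = 0)
    {q : ℕ} (hq1 : 1 < q) (hq : M * X ≤ q) :
    Vk k Ψ q X = (∑ n ∈ Finset.Icc 1 q,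
      if Nat.gcd n q = 1 then ((dk k n : ℝ) * Ψ (n / X)) ^ 2 else 0) -
      1 / (q.totient : ℝ) * copSum k Ψ q X ^ 2 := by
  have hvan : ∀ n : ℕ, q < n → Ψ (n / X) = 0 := fun n hn => hΨr _ (by
    have : (q : ℝ) ≤ n := by exact_mod_cast hn.le
    rw [le_div_iff₀ hX]
    linarith)
  have hφ : (q.totient : ℝ) ≠ 0 := by
    exact_mod_cast (Nat.totient_pos.2 (by omega)).ne'
  have hcard : (((Finset.Icc 1 q).filter fun n => Nat.gcd n q = 1).card : ℝ) = q.totient := by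
    have := Nat.filter_coprime_Ico_eq_totient q 1
    rw [← this]
    congr 2
    ext n
    simp only [Finset.mem_filter, Finset.mem_Icc, Finset.mem_Ico, Nat.coprime_iff_gcd_eq_one,
      Nat.gcd_comm q n]
    constructor <;> rintro ⟨h1, h2⟩ <;> exact ⟨by omega, h2⟩
  have hT := copSum_eq k q hvan
  rw [Vk]
  simp only [← Finset.sum_filter] at hT ⊢
  set S := (Finset.Icc 1 q).filter fun n => Nat.gcd n q = 1
  set T := copSum k Ψ q X
  have h1 : ∑ a ∈ S, (progSum k Ψ q a X - 1 / (q.totient : ℝ) * T) ^ 2 =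
      ∑ a ∈ S, ((((dk k a : ℝ) * Ψ (a / X)) ^ 2 -
        2 / (q.totient : ℝ) * T * ((dk k a : ℝ) * Ψ (a / X))) + (1 / (q.totient : ℝ) * T) ^ 2) := by
    refine Finset.sum_congr rfl fun a ha => ?_
    rw [Finset.mem_filter, Finset.mem_Icc] at ha
    have : a ≠ q := by
      rintro rfl
      rw [Nat.gcd_self] at ha
      omega
    rw [progSum_eq k hX hΨr hq (by omega)]
    ring
  rw [h1, Finset.sum_add_distrib, Finset.sum_sub_distrib, ← Finset.mul_sum, ← hT,
    Finset.sum_const, nsmul_eq_mul, hcard]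
  field_simp
  ring

theorem DeltaK_eq (k : ℕ) {Φ Ψ : ℝ → ℝ} {α M N X Q : ℝ} (hX : 0 < X) (hQ : 0 < Q)
    (hΨr : ∀ u, M ≤ u → Ψ u = 0) (hΦl : ∀ u < α, Φ u = 0) (hΦr : ∀ u, N ≤ u → Φ u = 0)
    (hXQ : M * X ≤ α * Q) (hαQ : 1 < α * Q) {R P : ℕ} (hR : M * X ≤ R + 1) (hP : N * Q ≤ P + 1) :
    DeltaK k Φ Ψ Q X =
      (∑ n ∈ Finset.Icc 1 R, ((dk k n : ℝ) * Ψ (n / X)) ^ 2 *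
        ∑ q ∈ Finset.Icc 1 P, if Nat.gcd n q = 1 then Φ (q / Q) else 0) -
      ∑ q ∈ Finset.Icc 1 P, 1 / (q.totient : ℝ) * copSum k Ψ q X ^ 2 * Φ (q / Q) := by
  have hΨ0 : ∀ n : ℕ, M * X ≤ n → Ψ (n / X) = 0 := fun n hn => hΨr _ (by rwa [le_div_iff₀ hX])
  have h1 : DeltaK k Φ Ψ Q X = ∑ q ∈ Finset.Icc 1 P, Vk k Ψ q X * Φ (q / Q) := by
    rw [DeltaK, tsum_eq_sum_Icc (R := P) (by simp)]
    · refine Finset.sum_congr rfl fun q hq => if_pos (Finset.mem_Icc.1 hq).1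
    · intro q hq
      have : (P : ℝ) + 1 ≤ q := by exact_mod_cast hq
      rw [hΦr (q / Q) (by rw [le_div_iff₀ hQ]; linarith)]
      simp
  have h2 : ∀ q ∈ Finset.Icc 1 P, Vk k Ψ q X * Φ (q / Q) =
      (∑ n ∈ Finset.Icc 1 R, ((dk k n : ℝ) * Ψ (n / X)) ^ 2 *
        if Nat.gcd n q = 1 then Φ (q / Q) else 0) -
      1 / (q.totient : ℝ) * copSum k Ψ q X ^ 2 * Φ (q / Q) := by
    intro q _
    rcases lt_or_ge ((q : ℝ) / Q) α with hlt | hge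
    · simp [hΦl _ hlt]
    · rw [le_div_iff₀ hQ] at hge
      have hq1 : 1 < q := by exact_mod_cast hαQ.trans_le hge
      have hqX : M * X ≤ q := hXQ.trans hge
      rw [Vk_eq k hX hΨr hq1 hqX, sub_mul, Finset.sum_mul]
      congr 1
      set F : ℕ → ℝ := fun n =>
        (if Nat.gcd n q = 1 then ((dk k n : ℝ) * Ψ (n / X)) ^ 2 else 0) * Φ (q / Q) with hF
      have hF0 : F 0 = 0 := by simp [hF, dk_zero]
      have hFv : ∀ n : ℕ, M * X ≤ n → F n = 0 := fun n hn => by simp [hF, hΨ0 n hn]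
      have e1 := tsum_eq_sum_Icc hF0 (R := q) fun n hn => hFv n
        (hqX.trans (by exact_mod_cast hn.le))
      have e2 := tsum_eq_sum_Icc hF0 (R := R) fun n hn => hFv n
        (hR.trans (by exact_mod_cast hn))
      rw [← e1, e2]
      refine Finset.sum_congr rfl fun n _ => ?_
      simp only [hF]
      split_ifs <;> simp
  rw [h1, Finset.sum_congr rfl h2, Finset.sum_sub_distrib, Finset.sum_comm]
  simp only [Finset.mul_sum]

theorem copSum_nonneg (k : ℕ) {Ψ : ℝ → ℝ} (hΨ : ∀ u, 0 ≤ Ψ u) (q : ℕ) (X : ℝ) :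
    0 ≤ copSum k Ψ q X := by
  refine tsum_nonneg fun n => ?_
  split_ifs
  · exact mul_nonneg (Nat.cast_nonneg _) (hΨ _)
  · rfl

theorem copSum_le (k : ℕ) {Ψ : ℝ → ℝ} {M S X : ℝ} (hX : 0 < X) (hΨ : ∀ u, 0 ≤ Ψ u)
    (hΨS : ∀ u, Ψ u ≤ S) (hΨr : ∀ u, M ≤ u → Ψ u = 0) (hMX : 1 ≤ M * X) (q : ℕ) :
    copSum (k + 1) Ψ q X ≤ S * (M * X * (1 + Real.log (M * X)) ^ k) := by
  have hS : 0 ≤ S := (hΨ 0).trans (hΨS 0)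
  rw [copSum_eq (k + 1) q (R := ⌊M * X⌋₊) fun n hn => hΨr _ (by
    rw [le_div_iff₀ hX]
    exact (Nat.lt_of_floor_lt hn).le)]
  refine le_trans ?_ (mul_le_mul_of_nonneg_left (divisorSum_le k hMX) hS)
  rw [divisorSum, Finset.mul_sum]
  refine Finset.sum_le_sum fun n _ => ?_
  rw [← dk_cast]
  split_ifs
  · rw [mul_comm]
    exact mul_le_mul_of_nonneg_right (hΨS _) (Nat.cast_nonneg _)
  · positivity

end Variance

section Asymptotic
open Filter Topology

theorem abs_DeltaK_add_sub_le (k : ℕ) {Φ Ψ : ℝ → ℝ} {L α M N X Q : ℝ} (hX : 0 < X) (hQ : 0 < Q)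
    (hL : ∀ x y, |Φ x - Φ y| ≤ L * |x - y|) (hΦc : Continuous Φ) (hΦint : ∫ u, Φ u = 1)
    (hΨr : ∀ u, M ≤ u → Ψ u = 0) (hα : 0 < α) (hαN : α ≤ N)
    (hΦl : ∀ u < α, Φ u = 0) (hΦr : ∀ u, N ≤ u → Φ u = 0)
    (hXQ : M * X ≤ α * Q) (hαQ : 1 < α * Q) :
    |DeltaK k Φ Ψ Q X +
        (∑ q ∈ Finset.Icc 1 ⌊N * Q⌋₊, 1 / (q.totient : ℝ) * copSum k Ψ q X ^ 2 * Φ (q / Q)) -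
        Q * ∑' n : ℕ, (dk k n : ℝ) ^ 2 * totientRatio n * Ψ (n / X) ^ 2| ≤
      4 * L * N * (M * X) * ∑' n : ℕ, (dk k n : ℝ) ^ 2 * Ψ (n / X) ^ 2 := by
  set R := ⌊M * X⌋₊ with hR
  have hΨ0 : ∀ n : ℕ, R < n → Ψ (n / X) = 0 := fun n hn => hΨr _ (by
    rw [le_div_iff₀ hX]
    exact (Nat.lt_of_floor_lt hn).le)
  have hL0 : 0 ≤ L := by
    have := (abs_nonneg _).trans (hL 0 1)
    simpa using this
  have hMX : M * X ≤ N * Q := hXQ.trans (by gcongr)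
  rw [DeltaK_eq k hX hQ hΨr hΦl hΦr hXQ hαQ (Nat.lt_floor_add_one _).le
    (Nat.lt_floor_add_one _).le, sub_add_cancel,
    tsum_eq_sum_Icc (R := R) (by simp [dk_zero]) (fun n hn => by simp [hΨ0 n hn]),
    tsum_eq_sum_Icc (R := R) (by simp [dk_zero]) (fun n hn => by simp [hΨ0 n hn]),
    Finset.mul_sum, Finset.mul_sum, ← Finset.sum_sub_distrib]
  refine (Finset.abs_sum_le_sum_abs _ _).trans (Finset.sum_le_sum fun n hn => ?_)
  rw [Finset.mem_Icc] at hn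
  have hn' : (n : ℝ) ≤ M * X := (Nat.le_floor_iff' (by omega)).1 hn.2
  have h := abs_sum_coprime_sub_le hL hΦc (fun u hu => hΦl u (hu.trans_lt hα)) hΦr hΦint hQ hn.1
    (hn'.trans hMX) (Nat.lt_floor_add_one (N * Q)).le
  have hN0 : 0 ≤ N := hα.le.trans hαN
  set A := ∑ q ∈ Finset.Icc 1 ⌊N * Q⌋₊, if Nat.gcd n q = 1 then Φ (q / Q) else 0
  rw [totientRatio_apply]
  calc |((dk k n : ℝ) * Ψ (n / X)) ^ 2 * A -
        Q * ((dk k n : ℝ) ^ 2 * ((n.totient : ℝ) / n) * Ψ (n / X) ^ 2)|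
      = (dk k n : ℝ) ^ 2 * Ψ (n / X) ^ 2 * |A - Q * (n.totient / n)| := by
        rw [show ((dk k n : ℝ) * Ψ (n / X)) ^ 2 * A -
            Q * ((dk k n : ℝ) ^ 2 * ((n.totient : ℝ) / n) * Ψ (n / X) ^ 2) =
            (dk k n : ℝ) ^ 2 * Ψ (n / X) ^ 2 * (A - Q * (n.totient / n)) by ring, abs_mul,
          abs_of_nonneg (show 0 ≤ (dk k n : ℝ) ^ 2 * Ψ (n / X) ^ 2 by positivity)]
    _ ≤ (dk k n : ℝ) ^ 2 * Ψ (n / X) ^ 2 * (4 * L * N * (M * X)) := by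
        refine mul_le_mul_of_nonneg_left (h.trans ?_) (by positivity)
        gcongr
    _ = _ := by ring

theorem sum_one_div_totient_mul_copSum_sq_le (k : ℕ) {Φ Ψ : ℝ → ℝ} {S T α M N X Q : ℝ}
    (hX : 0 < X) (hQ : 0 < Q) (hα : 0 < α) (hαN : α ≤ N) (hαQ : 1 ≤ α * Q)
    (hΦ : ∀ u, 0 ≤ Φ u) (hΦT : ∀ u, Φ u ≤ T) (hΦl : ∀ u < α, Φ u = 0)
    (hΨ : ∀ u, 0 ≤ Ψ u) (hΨS : ∀ u, Ψ u ≤ S) (hΨr : ∀ u, M ≤ u → Ψ u = 0) (hMX : 1 ≤ M * X) :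
    ∑ q ∈ Finset.Icc 1 ⌊N * Q⌋₊, 1 / (q.totient : ℝ) * copSum (k + 1) Ψ q X ^ 2 * Φ (q / Q) ≤
      N * Q * ((Real.log (N * Q) / Real.log 2 + 1) / (α * Q) *
        (S * (M * X * (1 + Real.log (M * X)) ^ k)) ^ 2 * T) := by
  have hl2 := Real.log_pos one_lt_two
  have hT : 0 ≤ T := (hΦ 0).trans (hΦT 0)
  have hNQ : 1 ≤ N * Q := hαQ.trans (by gcongr)
  have hlog : 0 ≤ Real.log (N * Q) := Real.log_nonneg hNQ
  set B := (Real.log (N * Q) / Real.log 2 + 1) / (α * Q) *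
    (S * (M * X * (1 + Real.log (M * X)) ^ k)) ^ 2 * T with hB
  have hb : 0 ≤ B := by positivity
  refine (Finset.sum_le_card_nsmul _ _ B fun q hq => ?_).trans ?_
  · rw [Finset.mem_Icc] at hq
    rcases lt_or_ge ((q : ℝ) / Q) α with hlt | hge
    · rw [hΦl _ hlt, mul_zero]
      exact hb
    · rw [le_div_iff₀ hQ] at hge
      have hq' : (q : ℝ) ≤ N * Q := (Nat.le_floor_iff' (by omega)).1 hq.2
      have hq0 : (0 : ℝ) < q := by linarith
      have h1 : 1 / (q.totient : ℝ) ≤ (Real.log (N * Q) / Real.log 2 + 1) / (α * Q) := by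
        refine (one_div_totient_le (by omega)).trans ?_
        have := Real.log_le_log hq0 hq'
        gcongr
      have h2 := copSum_nonneg (k + 1) hΨ q X
      have h3 := copSum_le k hX hΨ hΨS hΨr hMX q
      have h4 := hΦT (q / Q)
      have h5 := hΦ (q / Q)
      rw [hB]
      gcongr
  · rw [nsmul_eq_mul, Nat.card_Icc, Nat.add_sub_cancel]
    exact mul_le_mul_of_nonneg_right (Nat.floor_le (by linarith)) hb

theorem totient_copSum_bound_eq (m : ℕ) {S T α M N X Q Λ : ℝ} (hQ : Q ≠ 0) (hα : α ≠ 0) :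
    N * Q * (4 * Λ / (α * Q) * (S * (M * X * (3 * Λ) ^ m)) ^ 2 * T) =
      N * 4 / α * S ^ 2 * M ^ 2 * 9 ^ m * T * (X * X * Λ ^ (2 * m + 1)) := by
  have h9 : (9 : ℝ) ^ m = (3 ^ m) ^ 2 := by
    rw [← pow_mul, mul_comm, pow_mul]
    norm_num
  rw [h9, mul_pow 3 Λ, pow_succ Λ, mul_comm 2 m, pow_mul]
  field_simp

theorem exists_support_bounds {f : ℝ → ℝ} (hf : HasCompactSupport f)
    (hf' : tsupport f ⊆ Set.Ioi 0) :
    ∃ α M : ℝ, 0 < α ∧ α < M ∧ (∀ u < α, f u = 0) ∧ ∀ u, M ≤ u → f u = 0 := by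
  have hc : IsCompact (tsupport f) := hf
  have hz : ∀ u, u ∉ tsupport f → f u = 0 := fun u hu => image_eq_zero_of_notMem_tsupport hu
  rcases (tsupport f).eq_empty_or_nonempty with he | hne
  · exact ⟨1, 2, one_pos, one_lt_two, fun u _ => hz u (by simp [he]),
      fun u _ => hz u (by simp [he])⟩
  · obtain ⟨a, ha, ha'⟩ := hc.exists_isLeast hne
    obtain ⟨b, hb, hb'⟩ := hc.exists_isGreatest hne
    have h0 : (0 : ℝ) < a := hf' ha
    refine ⟨a, b + 1, h0, by linarith [ha' hb], fun u hu => hz u fun h => ?_,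
      fun u hu => hz u fun h => ?_⟩
    · exact absurd (ha' h) (not_le.2 hu)
    · linarith [hb' h]

theorem exists_abs_sub_le_of_contDiff {f : ℝ → ℝ} (hf : ContDiff ℝ 1 f)
    (hc : HasCompactSupport f) : ∃ L : ℝ, ∀ x y, |f x - f y| ≤ L * |x - y| := by
  obtain ⟨L, hL⟩ := hf.lipschitzWith_of_hasCompactSupport hc one_ne_zero
  exact ⟨L, fun x y => by simpa [Real.dist_eq] using hL.dist_le_mul x y⟩

theorem exists_le_of_hasCompactSupport {f : ℝ → ℝ} (hf : Continuous f)
    (hc : HasCompactSupport f) : ∃ S : ℝ, ∀ x, f x ≤ S := by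
  obtain ⟨S, hS⟩ := hc.exists_bound_of_continuous hf
  exact ⟨S, fun x => (le_abs_self _).trans (hS x)⟩

theorem exists_abs_DeltaK_sub_le (m : ℕ) {Φ Ψ : ℝ → ℝ}
    (hΦ1 : ContDiff ℝ 1 Φ) (hΦsupp : HasCompactSupport Φ) (hΦpos : ∀ x, 0 ≤ Φ x)
    (hΦsupp' : tsupport Φ ⊆ Set.Ioi 0) (hΦint : ∫ u, Φ u = 1)
    (hΨc : Continuous Ψ) (hΨsupp : HasCompactSupport Ψ) (hΨpos : ∀ x, 0 ≤ Ψ x)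
    (hΨsupp' : tsupport Ψ ⊆ Set.Ioi 0) :
    ∃ C K : ℝ, 0 ≤ C ∧ ∀ Q X : ℝ, 1 ≤ Real.log Q → K ≤ Q → K ≤ X → 0 < X → K * X ≤ Q →
      |DeltaK (m + 1) Φ Ψ Q X -
        Q * ∑' n : ℕ, (dk (m + 1) n : ℝ) ^ 2 * totientRatio n * Ψ (n / X) ^ 2| ≤
      C * X * ((∑' n : ℕ, (dk (m + 1) n : ℝ) ^ 2 * Ψ (n / X) ^ 2) +
        X * Real.log Q ^ (2 * m + 1)) := by
  obtain ⟨α, N, hα, hαN, hΦl, hΦr⟩ := exists_support_bounds hΦsupp hΦsupp'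
  obtain ⟨β, M, hβ, hβM, -, hΨr⟩ := exists_support_bounds hΨsupp hΨsupp'
  obtain ⟨L, hL⟩ := exists_abs_sub_le_of_contDiff hΦ1 hΦsupp
  obtain ⟨T, hT⟩ := exists_le_of_hasCompactSupport hΦ1.continuous hΦsupp
  obtain ⟨S, hS⟩ := exists_le_of_hasCompactSupport hΨc hΨsupp
  have hL0 : 0 ≤ L := by simpa using (abs_nonneg _).trans (hL 0 1)
  have hT0 : 0 ≤ T := (hΦpos 0).trans (hT 0)
  have hS0 : 0 ≤ S := (hΨpos 0).trans (hS 0)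
  have hM : 0 < M := hβ.trans hβM
  have hN : 0 < N := hα.trans hαN
  set C1 := 4 * L * N * M with hC1
  set C2 := N * 4 / α * S ^ 2 * M ^ 2 * 9 ^ m * T with hC2
  have hC10 : 0 ≤ C1 := by positivity
  have hC20 : 0 ≤ C2 := by positivity
  refine ⟨C1 + C2, 2 / α + N + 1 / M + M / α, add_nonneg hC10 hC20,
    fun Q X hlogQ hKQ hKX hX0 hKXQ => ?_⟩
  have k1 : 0 < 2 / α := by positivity
  have k2 : 0 < 1 / M := by positivity
  have k3 : 0 < M / α := by positivity
  have q6 : 2 / α ≤ Q := by linarith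
  have q7 : N ≤ Q := by linarith
  have x4 : 1 / M ≤ X := by linarith
  have q3 : M / α * X ≤ Q := le_trans (by gcongr; linarith) hKXQ
  have hQ0 : 0 < Q := hN.trans_le q7
  rw [div_le_iff₀ hM] at x4
  rw [mul_comm] at x4
  rw [div_le_iff₀ hα] at q6
  rw [div_mul_eq_mul_div, div_le_iff₀ hα, mul_comm Q α] at q3
  set Λ := Real.log Q with hΛ
  have hlogNQ : Real.log (N * Q) ≤ 2 * Λ := by
    rw [Real.log_mul hN.ne' hQ0.ne']
    linarith [Real.log_le_log hN q7]
  have hlogMX : Real.log (M * X) ≤ 2 * Λ :=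
    (Real.log_le_log (by positivity) (q3.trans (by gcongr))).trans hlogNQ
  have hlogMX0 : 0 ≤ Real.log (M * X) := Real.log_nonneg x4
  have hlog2 : Real.log (N * Q) / Real.log 2 + 1 ≤ 4 * Λ := by
    have : Real.log (N * Q) / Real.log 2 ≤ 3 * Λ := by
      rw [div_le_iff₀ (Real.log_pos one_lt_two)]
      nlinarith [Real.log_two_gt_d9]
    linarith
  have hE := sum_one_div_totient_mul_copSum_sq_le m hX0 hQ0 hα hαN.le (by linarith) hΦpos hT hΦl
    hΨpos hS hΨr x4
  have hD := abs_DeltaK_add_sub_le (m + 1) hX0 hQ0 hL hΦ1.continuous hΦint hΨr hα hαN.le hΦl hΦr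
    q3 (by linarith)
  have hE0 : 0 ≤ ∑ q ∈ Finset.Icc 1 ⌊N * Q⌋₊,
      1 / (q.totient : ℝ) * copSum (m + 1) Ψ q X ^ 2 * Φ (q / Q) :=
    Finset.sum_nonneg fun q _ => mul_nonneg (by positivity) (hΦpos _)
  have hW00 : 0 ≤ ∑' n : ℕ, (dk (m + 1) n : ℝ) ^ 2 * Ψ (n / X) ^ 2 :=
    tsum_nonneg fun n => by positivity
  set E := ∑ q ∈ Finset.Icc 1 ⌊N * Q⌋₊,
    1 / (q.totient : ℝ) * copSum (m + 1) Ψ q X ^ 2 * Φ (q / Q)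
  set W0 := ∑' n : ℕ, (dk (m + 1) n : ℝ) ^ 2 * Ψ (n / X) ^ 2
  have hE2 : E ≤ C2 * (X * X * Λ ^ (2 * m + 1)) := by
    rw [hC2, ← totient_copSum_bound_eq m hQ0.ne' hα.ne']
    refine hE.trans ?_
    gcongr
    linarith
  have e : (C1 + C2) * X * (W0 + X * Λ ^ (2 * m + 1)) =
      4 * L * N * (M * X) * W0 + C2 * (X * X * Λ ^ (2 * m + 1)) +
        (C1 * (X * X * Λ ^ (2 * m + 1)) + C2 * X * W0) := by
    rw [hC1]
    ring
  have h0 : 0 ≤ C1 * (X * X * Λ ^ (2 * m + 1)) + C2 * X * W0 := by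
    have : 0 ≤ Λ := by linarith
    positivity
  rw [e]
  rw [abs_le] at hD ⊢
  constructor <;> linarith [hD.1, hD.2]

end Asymptotic

/-- averaged variance asymptotic for `X ≤ Q / log log Q`. -/
theorem variance_small_c (k : ℕ) (hk : 2 ≤ k) (δ : ℝ) (hδ : 0 < δ)
    (Φ Ψ : ℝ → ℝ)
    (hΦsmooth : ContDiff ℝ (⊤ : ℕ∞) Φ) (hΦsupp : HasCompactSupport Φ)
    (hΦpos : ∀ x, 0 ≤ Φ x) (hΦsupp' : tsupport Φ ⊆ Set.Ioi 0)
    (hΦint : ∫ u, Φ u = 1)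
    (hΨsmooth : ContDiff ℝ (⊤ : ℕ∞) Ψ) (hΨsupp : HasCompactSupport Ψ)
    (hΨpos : ∀ x, 0 ≤ Ψ x) (hΨsupp' : tsupport Ψ ⊆ Set.Ioi 0)
    (hΨint : ∫ u, (Ψ u)^2 = 1) :
    ∀ ε > 0, ∃ Q₀ : ℝ, ∀ Q X : ℝ, Q₀ ≤ Q →
      Q ^ δ ≤ X → X ≤ Q / Real.log (Real.log Q) →
      |DeltaK k Φ Ψ Q X -
          aTilde k * ((Real.log X / Real.log Q)^(k^2 - 1) / ((k^2 - 1).factorial : ℝ)) *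
            (Q * X) * (Real.log Q)^(k^2 - 1)| ≤
        ε * (Q * X * (Real.log Q)^(k^2 - 1)) := by
  intro ε hε
  obtain ⟨m, rfl⟩ : ∃ m, k = m + 1 := ⟨k - 1, by omega⟩
  have hΦ1 : ContDiff ℝ 1 Φ := hΦsmooth.of_le (by exact_mod_cast le_top)
  have hΨ1 : ContDiff ℝ 1 Ψ := hΨsmooth.of_le (by exact_mod_cast le_top)
  obtain ⟨β, M, hβ, hβM, hΨl, hΨr⟩ := exists_support_bounds hΨsupp hΨsupp'
  obtain ⟨C, K, hC, hΔ⟩ := exists_abs_DeltaK_sub_le m hΦ1 hΦsupp hΦpos hΦsupp' hΦint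
    hΨ1.continuous hΨsupp hΨpos hΨsupp'
  set J := (m + 1) ^ 2 - 1 with hJ
  have hmJ : 2 * m + 1 ≤ J := by
    have : 2 * m + 1 + 1 ≤ (m + 1) ^ 2 := by nlinarith
    omega
  have hgl : ∀ u < β, Ψ u ^ 2 = 0 := fun u hu => by simp [hΨl u hu]
  have hgr : ∀ u, M ≤ u → Ψ u ^ 2 = 0 := fun u hu => by simp [hΨr u hu]
  have hW1 := tendsto_tsum_dkSq_totient hk (hΨ1.pow 2) hβ hβM hgl hgr
  have hW0 := tendsto_tsum_dkSq hk (hΨ1.pow 2) hβ hβM hgl hgr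
  rw [hΨint, mul_one, ← hJ] at hW1 hW0
  set c1 := aTilde (m + 1) / (J.factorial : ℝ) with hc1
  set c0 := aCst (m + 1) / (J.factorial : ℝ) with hc0
  have hXev : ∀ᶠ X : ℝ in Filter.atTop,
      |(∑' n : ℕ, (dk (m + 1) n : ℝ) ^ 2 * totientRatio n * Ψ (n / X) ^ 2) -
        c1 * (X * Real.log X ^ J)| ≤ ε / 2 * (X * Real.log X ^ J) ∧
      ∑' n : ℕ, (dk (m + 1) n : ℝ) ^ 2 * Ψ (n / X) ^ 2 ≤ (|c0| + 1) * (X * Real.log X ^ J) ∧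
      1 < X ∧ K ≤ X := by
    filter_upwards [(Metric.tendsto_nhds.1 hW1) (ε / 2) (by positivity),
      hW0.eventually_le_const (show c0 < |c0| + 1 by linarith [le_abs_self c0]),
      Filter.eventually_gt_atTop (1 : ℝ), Filter.eventually_ge_atTop K] with X h1 h2 h3 h4
    have hY : 0 < X * Real.log X ^ J := mul_pos (by linarith) (pow_pos (Real.log_pos h3) _)
    refine ⟨?_, (div_le_iff₀ hY).1 h2, h3, h4⟩
    rw [Real.dist_eq, div_sub' hY.ne', abs_div, abs_of_pos hY, div_lt_iff₀ hY] at h1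
    rw [mul_comm c1]
    exact h1.le
  obtain ⟨X₀, hX₀⟩ := Filter.eventually_atTop.1 hXev
  set D := C * (|c0| + 2) with hD
  have hloglog : Filter.Tendsto (fun Q : ℝ => Real.log (Real.log Q)) Filter.atTop Filter.atTop :=
    Real.tendsto_log_atTop.comp Real.tendsto_log_atTop
  have hQev : ∀ᶠ Q : ℝ in Filter.atTop, X₀ ≤ Q ^ δ ∧ 1 ≤ Real.log (Real.log Q) ∧
      K ≤ Real.log (Real.log Q) ∧ D / (ε / 2) ≤ Real.log (Real.log Q) ∧
      1 ≤ Real.log Q ∧ 0 < Q ∧ K ≤ Q := by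
    filter_upwards [(tendsto_rpow_atTop hδ).eventually_ge_atTop X₀,
      hloglog.eventually_ge_atTop 1, hloglog.eventually_ge_atTop K,
      hloglog.eventually_ge_atTop (D / (ε / 2)),
      Real.tendsto_log_atTop.eventually_ge_atTop 1, Filter.eventually_gt_atTop 0,
      Filter.eventually_ge_atTop K] with Q h1 h2 h3 h4 h5 h6 h7
    exact ⟨h1, h2, h3, h4, h5, h6, h7⟩
  obtain ⟨Q₀, hQ₀⟩ := Filter.eventually_atTop.1 hQev
  refine ⟨Q₀, fun Q X hQ hXδ hXQ => ?_⟩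
  obtain ⟨q1, q2, q3, q4, q5, hQ0, q7⟩ := hQ₀ Q hQ
  obtain ⟨x1, x2, x3, x4⟩ := hX₀ X (q1.trans hXδ)
  have hX0 : 0 < X := by linarith
  rw [le_div_iff₀ (by linarith)] at hXQ
  rw [div_le_iff₀ (by positivity)] at q4
  have hXQ' : X ≤ Q := by nlinarith
  have hΔ' := hΔ Q X q5 q7 x4 hX0 (by nlinarith)
  have hlogX0 : 0 ≤ Real.log X := Real.log_nonneg x3.le
  have hlogX : Real.log X ≤ Real.log Q := Real.log_le_log hX0 hXQ'
  set Λ := Real.log Q with hΛ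
  set l := Real.log Λ with hl
  set W1 := ∑' n : ℕ, (dk (m + 1) n : ℝ) ^ 2 * totientRatio n * Ψ (n / X) ^ 2
  set W0 := ∑' n : ℕ, (dk (m + 1) n : ℝ) ^ 2 * Ψ (n / X) ^ 2
  have hmain : aTilde (m + 1) * ((Real.log X / Λ) ^ J / (J.factorial : ℝ)) * (Q * X) * Λ ^ J =
      Q * (c1 * (X * Real.log X ^ J)) := by
    have : Λ ≠ 0 := by linarith
    rw [hc1, div_pow]
    field_simp
  have hW : |Q * W1 - Q * (c1 * (X * Real.log X ^ J))| ≤ ε / 2 * (Q * X * Λ ^ J) := by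
    rw [← mul_sub, abs_mul, abs_of_pos hQ0]
    calc Q * |W1 - c1 * (X * Real.log X ^ J)| ≤ Q * (ε / 2 * (X * Real.log X ^ J)) := by gcongr
      _ ≤ Q * (ε / 2 * (X * Λ ^ J)) := by gcongr
      _ = _ := by ring
  have hE : C * X * (W0 + X * Λ ^ (2 * m + 1)) ≤ ε / 2 * (Q * X * Λ ^ J) := by
    have h1 : W0 + X * Λ ^ (2 * m + 1) ≤ (|c0| + 1) * (X * Λ ^ J) + X * Λ ^ J := by
      refine add_le_add (x2.trans ?_) ?_ <;> gcongr
    calc C * X * (W0 + X * Λ ^ (2 * m + 1))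
        ≤ C * X * ((|c0| + 1) * (X * Λ ^ J) + X * Λ ^ J) := by gcongr
      _ = D * X * (X * Λ ^ J) := by rw [hD]; ring
      _ ≤ l * (ε / 2) * X * (X * Λ ^ J) := by gcongr
      _ = ε / 2 * (X * l) * (X * Λ ^ J) := by ring
      _ ≤ ε / 2 * Q * (X * Λ ^ J) := by gcongr
      _ = _ := by ring
  rw [hmain]
  rw [abs_le] at hΔ' hW ⊢
  constructor <;> linarith [hΔ'.1, hΔ'.2, hW.1, hW.2]
end

section
/- Let Ψ be a fixed smooth nonnegative real function compactly supported in (0,∞) and let w̃(s₁,s₂,z) = ∫_0^∞∫_0^∞ Ψ(x)Ψ(y) x^{s₁−1} y^{s₂−1} |x−y|^{−z} dx dy, defined for complex s₁, s₂ and Re z < 1. Then there is a function H(s₁,s₂;z), analytic in each variable for all s₁, s₂ ∈ ℂ and all z with 0 < Re z < 2, such that for Re z < 1 one has w̃(s₁,s₂;z) = (2/(1−z)) · (Ψ²)~(s₁+s₂−1) + H(s₁,s₂;z), where (Ψ²)~(w) = ∫_0^∞ Ψ(u)² u^{w−1} du. Moreover, for any fixed δ > 0 and any fixed compact set K ⊂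 ℂ², the function H(s₁,s₂;z) is bounded for (s₁,s₂) ∈ K and 0 ≤ Re z ≤ 2 − δ. -/
open MeasureTheory Complex

/-- The double Mellin-type transform
`w̃(s₁,s₂,z) = ∫₀^∞∫₀^∞ Ψ(x)Ψ(y) x^{s₁−1} y^{s₂−1} |x−y|^{−z} dx dy`. -/
noncomputable def wTilde (Ψ : ℝ → ℝ) (s₁ s₂ z : ℂ) : ℂ :=
  ∫ x in Set.Ioi (0 : ℝ), ∫ y in Set.Ioi (0 : ℝ),
    ((Ψ x * Ψ y : ℝ) : ℂ) * (x : ℂ)^(s₁ - 1) * (y : ℂ)^(s₂ - 1) * ((|x - y| : ℝ) : ℂ)^(-z)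

/-- A parametric integral of a holomorphic, locally dominated family is analytic. -/
theorem analyticAt_integral_of_dominated {α : Type*} [MeasurableSpace α] {μ : Measure α}
    {f : ℂ → α → ℂ} {w₀ : ℂ} {r : ℝ} {g : α → ℝ} (hr : 0 < r)
    (hm : ∀ w, AEStronglyMeasurable (f w) μ)
    (hd : ∀ᵐ a ∂μ, DifferentiableOn ℂ (fun w => f w a) (Metric.ball w₀ r))
    (hg : Integrable g μ) (hb : ∀ᵐ a ∂μ, ∀ w ∈ Metric.ball w₀ r, ‖f w a‖ ≤ g a) :
    AnalyticAt ℂ (fun w => ∫ a, f w a ∂μ) w₀ := by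
  have hr2 : 0 < r / 2 := by positivity
  suffices h : DifferentiableOn ℂ (fun w => ∫ a, f w a ∂μ) (Metric.ball w₀ (r / 2)) from
    h.analyticAt (Metric.ball_mem_nhds _ hr2)
  have hsub : Metric.ball w₀ (r / 2) ⊆ Metric.ball w₀ r := Metric.ball_subset_ball (by linarith)
  intro w hw
  have hderiv : ∀ᵐ a ∂μ, ∀ v ∈ Metric.ball w₀ (r / 2),
      HasDerivAt (fun w => f w a) (deriv (fun w => f w a) v) v := by
    filter_upwards [hd] with a ha v hv
    exact (ha.differentiableAt (Metric.isOpen_ball.mem_nhds (hsub hv))).hasDerivAt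
  refine (hasDerivAt_integral_of_dominated_loc_of_deriv_le (bound := fun a => g a / (r / 4))
    (F' := fun v a => deriv (fun w => f w a) v)
    (Metric.isOpen_ball.mem_nhds hw) (Filter.Eventually.of_forall hm) ?_ ?_ ?_
    (hg.div_const _) hderiv).2.differentiableAt.differentiableWithinAt
  · refine hg.mono' (hm w) ?_
    filter_upwards [hb] with a ha using ha w (hsub hw)
  · refine aestronglyMeasurable_of_tendsto_ae (nhdsWithin w {w}ᶜ)
      (f := fun v a => slope (fun w => f w a) w v) (fun v => ?_) ?_
    · simp only [slope, vsub_eq_sub]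
      exact ((hm v).sub (hm w)).const_smul (v - w)⁻¹
    · filter_upwards [hderiv] with a ha using (ha w hw).tendsto_slope
  · filter_upwards [hd, hb] with a ha hba v hv
    have hsub' : Metric.closedBall v (r / 4) ⊆ Metric.ball w₀ r := by
      intro u hu
      rw [Metric.mem_ball] at hv ⊢
      rw [Metric.mem_closedBall] at hu
      linarith [dist_triangle u v w₀]
    refine norm_deriv_le_of_forall_mem_sphere_norm_le (by positivity) ?_
      fun u hu => hba u (hsub' (Metric.sphere_subset_closedBall hu))
    exact (ha.mono hsub').diffContOnCl_ball subset_rfl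

theorem locallyIntegrable_abs_cpow_neg {z : ℂ} (hz : z.re < 1) :
    LocallyIntegrable (fun u : ℝ => ((|u| : ℝ) : ℂ) ^ (-z)) := by
  refine locallyIntegrable_of_norm_le_rpow (C := 1) (α := z.re) (by simp) (by simpa using hz) ?_ ?_
  · filter_upwards [Measure.ae_ne volume (0 : ℝ)] with u hu
    rw [norm_cpow_eq_rpow_re_of_pos (abs_pos.2 hu)]
    simp
  · exact Measurable.aestronglyMeasurable (by fun_prop)

theorem integral_abs_cpow_neg {z : ℂ} (hz : z.re < 1) :
    ∫ u in Set.Icc (-1 : ℝ) 1, ((|u| : ℝ) : ℂ) ^ (-z) = 2 / (1 - z) := by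
  have hint (a b : ℝ) :
      IntervalIntegrable (fun u : ℝ => ((|u| : ℝ) : ℂ) ^ (-z)) volume a b :=
    intervalIntegrable_iff.2 (((locallyIntegrable_abs_cpow_neg hz).integrableOn_isCompact
      isCompact_uIcc).mono_set Set.uIoc_subset_uIcc)
  have hpos : ∫ u in (0 : ℝ)..1, ((|u| : ℝ) : ℂ) ^ (-z) = 1 / (1 - z) := by
    have hne : -z + 1 ≠ 0 := by
      intro h
      have := congrArg re h
      simp at this
      linarith
    have : ∫ u in (0 : ℝ)..1, ((|u| : ℝ) : ℂ) ^ (-z) = ∫ u in (0 : ℝ)..1, (u : ℂ) ^ (-z) := by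
      refine intervalIntegral.integral_congr fun u hu => ?_
      rw [Set.uIcc_of_le zero_le_one] at hu
      simp only [abs_of_nonneg hu.1]
    rw [this, integral_cpow (Or.inl (by simpa using hz))]
    simp only [ofReal_one, one_cpow, ofReal_zero, zero_cpow hne, sub_zero]
    congr 1
    ring
  have hneg : ∫ u in (-1 : ℝ)..0, ((|u| : ℝ) : ℂ) ^ (-z) = 1 / (1 - z) := by
    rw [← hpos]
    simpa using (intervalIntegral.integral_comp_neg (a := 0) (b := 1)
      (fun u : ℝ => ((|u| : ℝ) : ℂ) ^ (-z))).symm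
  rw [integral_Icc_eq_integral_Ioc, ← intervalIntegral.integral_of_le (by norm_num),
    ← intervalIntegral.integral_add_adjacent_intervals (hint (-1) 0) (hint 0 1), hneg, hpos]
  ring

/-- The integrand `Ψ(x) x^{s-1}` of the Mellin transform of `Ψ`. -/
noncomputable def mellinWeight (Ψ : ℝ → ℝ) (s : ℂ) (x : ℝ) : ℂ :=
  (Ψ x : ℂ) * (x : ℂ) ^ (s - 1)

section mellinWeight

variable {Ψ : ℝ → ℝ}

theorem mellinWeight_eq_zero {x : ℝ} (s : ℂ) (hx : x ∉ tsupport Ψ) : mellinWeight Ψ s x = 0 := by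
  simp [mellinWeight, image_eq_zero_of_notMem_tsupport hx]

theorem hasDerivAt_mellinWeight (hΨ : Differentiable ℝ Ψ) (hpos : tsupport Ψ ⊆ Set.Ioi 0)
    (s : ℂ) (x : ℝ) :
    HasDerivAt (mellinWeight Ψ s)
      (((deriv Ψ x : ℝ) : ℂ) * (x : ℂ) ^ (s - 1) + (Ψ x : ℂ) * ((s - 1) * (x : ℂ) ^ (s - 1 - 1))) x := by
  by_cases hx : x ∈ tsupport Ψ
  · have hpow : HasDerivAt (fun y : ℝ => (y : ℂ) ^ (s - 1)) ((s - 1) * (x : ℂ) ^ (s - 1 - 1)) x := by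
      simpa using ((hasDerivAt_id (x : ℂ)).cpow_const (c := s - 1)
        (Or.inl (by simpa using hpos hx))).comp_ofReal
    exact (hΨ x).hasDerivAt.ofReal_comp.mul hpow
  · have h0 : Ψ =ᶠ[nhds x] 0 := notMem_tsupport_iff_eventuallyEq.1 hx
    have h1 : deriv Ψ x = 0 := by simpa using h0.deriv_eq
    have h2 : Ψ x = 0 := h0.self_of_nhds
    simp only [h1, h2, ofReal_zero, zero_mul, add_zero]
    refine (hasDerivAt_const x (0 : ℂ)).congr_of_eventuallyEq ?_
    filter_upwards [h0] with y hy
    simp [mellinWeight, hy]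

theorem continuous_mellinWeight (hΨ : Differentiable ℝ Ψ) (hpos : tsupport Ψ ⊆ Set.Ioi 0)
    (s : ℂ) : Continuous (mellinWeight Ψ s) :=
  continuous_iff_continuousAt.2 fun x => (hasDerivAt_mellinWeight hΨ hpos s x).continuousAt

theorem hasCompactSupport_mellinWeight (hΨ : HasCompactSupport Ψ) (s : ℂ) :
    HasCompactSupport (mellinWeight Ψ s) :=
  HasCompactSupport.intro hΨ fun _ hx => mellinWeight_eq_zero s hx

theorem differentiable_mellinWeight_left (hpos : tsupport Ψ ⊆ Set.Ioi 0) (x : ℝ) :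
    Differentiable ℂ (fun s => mellinWeight Ψ s x) := by
  by_cases hx : x ∈ tsupport Ψ
  · have hx0 : (x : ℂ) ≠ 0 := ofReal_ne_zero.2 (ne_of_gt (hpos hx))
    intro s
    exact (((differentiableAt_id (x := s)).sub_const 1).const_cpow (Or.inl hx0)).const_mul _
  · simp [mellinWeight_eq_zero _ hx]

/-- `mellinWeight Ψ s` is bounded and Lipschitz, uniformly for `s` in a compact set. -/
theorem exists_mellinWeight_bound (hΨ : ContDiff ℝ 1 Ψ) (hsupp : HasCompactSupport Ψ)
    (hpos : tsupport Ψ ⊆ Set.Ioi 0) {K : Set ℂ} (hK : IsCompact K) :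
    ∃ C : ℝ, 0 ≤ C ∧ ∀ s ∈ K, (∀ x, ‖mellinWeight Ψ s x‖ ≤ C) ∧
      ∀ x y, ‖mellinWeight Ψ s x - mellinWeight Ψ s y‖ ≤ C * |x - y| := by
  have hcpow (c : ℂ) :
      ContinuousOn (fun p : ℂ × ℝ => (p.2 : ℂ) ^ (p.1 - c)) (K ×ˢ tsupport Ψ) := by
    refine ContinuousOn.cpow (by fun_prop) (by fun_prop) fun p hp => ?_
    exact Or.inl (by simpa using hpos hp.2)
  have hdcont : Continuous (deriv Ψ) := hΨ.continuous_deriv le_rfl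
  have hcont := hΨ.continuous
  have hKT : IsCompact (K ×ˢ tsupport Ψ) := hK.prod hsupp
  obtain ⟨C₁, hC₁⟩ := hKT.exists_bound_of_continuousOn
    (f := fun p : ℂ × ℝ => (Ψ p.2 : ℂ) * (p.2 : ℂ) ^ (p.1 - 1))
    (ContinuousOn.mul (by fun_prop) (hcpow 1))
  obtain ⟨C₂, hC₂⟩ := hKT.exists_bound_of_continuousOn
    (f := fun p : ℂ × ℝ => ((deriv Ψ p.2 : ℝ) : ℂ) * (p.2 : ℂ) ^ (p.1 - 1) +
      (Ψ p.2 : ℂ) * ((p.1 - 1) * (p.2 : ℂ) ^ (p.1 - 2)))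
    ((ContinuousOn.mul (by fun_prop) (hcpow 1)).add
      (ContinuousOn.mul (by fun_prop) (ContinuousOn.mul (by fun_prop) (hcpow 2))))
  refine ⟨max 0 (max C₁ C₂), le_max_left _ _, fun s hs => ⟨fun x => ?_, fun x y => ?_⟩⟩
  · by_cases hx : x ∈ tsupport Ψ
    · exact (hC₁ (s, x) ⟨hs, hx⟩).trans ((le_max_left _ _).trans (le_max_right _ _))
    · simp [mellinWeight_eq_zero s hx]
  · refine convex_univ.norm_image_sub_le_of_norm_hasDerivWithin_le
      (fun t _ => (hasDerivAt_mellinWeight (hΨ.differentiable one_ne_zero) hpos s t).hasDerivWithinAt)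
      (fun t _ => ?_) (Set.mem_univ y) (Set.mem_univ x)
    by_cases ht : t ∈ tsupport Ψ
    · have := hC₂ (s, t) ⟨hs, ht⟩
      rw [show s - 1 - 1 = s - 2 by ring]
      exact this.trans ((le_max_right _ _).trans (le_max_right _ _))
    · have h0 : Ψ =ᶠ[nhds t] 0 := notMem_tsupport_iff_eventuallyEq.1 ht
      have h1 : deriv Ψ t = 0 := by simpa using h0.deriv_eq
      have h2 : Ψ t = 0 := h0.self_of_nhds
      simp [h1, h2]

/-- The integrand of `wTilde` in the coordinates `(x, u) = (x, x - y)`, with its singular part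
on `|u| ≤ 1` removed. -/
noncomputable def regularizedKernel (Ψ : ℝ → ℝ) (s₁ s₂ z : ℂ) (p : ℝ × ℝ) : ℂ :=
  mellinWeight Ψ s₁ p.1 * (mellinWeight Ψ s₂ (p.1 - p.2) -
    (Set.Icc (-1 : ℝ) 1).indicator (fun _ => mellinWeight Ψ s₂ p.1) p.2) *
      ((|p.2| : ℝ) : ℂ) ^ (-z)

theorem regularizedKernel_zero_right (s₁ s₂ z : ℂ) (x : ℝ) :
    regularizedKernel Ψ s₁ s₂ z (x, 0) = 0 := by
  simp [regularizedKernel]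

theorem measurable_regularizedKernel (hΨ : Differentiable ℝ Ψ) (hpos : tsupport Ψ ⊆ Set.Ioi 0)
    (s₁ s₂ z : ℂ) : Measurable (regularizedKernel Ψ s₁ s₂ z) := by
  have h₁ := (continuous_mellinWeight hΨ hpos s₁).measurable
  have h₂ := (continuous_mellinWeight hΨ hpos s₂).measurable
  have h₃ : Measurable fun p : ℝ × ℝ =>
      (Set.Icc (-1 : ℝ) 1).indicator (fun _ => mellinWeight Ψ s₂ p.1) p.2 :=
    Measurable.indicator (f := fun p : ℝ × ℝ => mellinWeight Ψ s₂ p.1)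
      (h₂.comp measurable_fst) (measurable_snd measurableSet_Icc)
  unfold regularizedKernel
  fun_prop

/-- The regularized kernel is dominated by an integrable function, uniformly for `(s₁, s₂)` in a
compact set and `z` in a closed vertical strip to the left of `Re z = 2`. -/
theorem exists_regularizedKernel_bound (hΨ : ContDiff ℝ 1 Ψ) (hsupp : HasCompactSupport Ψ)
    (hpos : tsupport Ψ ⊆ Set.Ioi 0) {K₁ K₂ : Set ℂ} (hK₁ : IsCompact K₁) (hK₂ : IsCompact K₂)
    (α : ℝ) {δ : ℝ} (hδ : 0 < δ) :
    ∃ g : ℝ × ℝ → ℝ, Integrable g ∧ ∀ s₁ ∈ K₁, ∀ s₂ ∈ K₂, ∀ z : ℂ, α ≤ z.re → z.re ≤ 2 - δ →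
      ∀ p, ‖regularizedKernel Ψ s₁ s₂ z p‖ ≤ g p := by
  obtain ⟨C₁, hC₁, h₁⟩ := exists_mellinWeight_bound hΨ hsupp hpos hK₁
  obtain ⟨C₂, hC₂, h₂⟩ := exists_mellinWeight_bound hΨ hsupp hpos hK₂
  obtain ⟨R, hR⟩ := hsupp.isBounded.exists_norm_le
  set B : ℝ := max 1 (2 * R)
  have hB : 1 ≤ B := le_max_left _ _
  have hloc : LocallyIntegrable (fun u : ℝ => |u| ^ (δ - 1)) := by
    refine locallyIntegrable_of_norm_le_rpow (C := 1) (α := 1 - δ) (by simp) (by simpa using hδ)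
      ?_ (Measurable.aestronglyMeasurable (by fun_prop))
    refine Filter.Eventually.of_forall fun u => ?_
    rw [Real.norm_of_nonneg (by positivity)]
    simp
  refine ⟨fun p => (tsupport Ψ).indicator (fun _ => C₁ * C₂) p.1 *
    (Set.Icc (-B) B).indicator (fun u => |u| ^ (δ - 1) + B ^ |α|) p.2,
    Integrable.mul_prod ?_ ?_, ?_⟩
  · exact (integrable_indicator_iff hsupp.measurableSet).2
      (integrableOn_const hsupp.measure_lt_top.ne)
  · refine (integrable_indicator_iff measurableSet_Icc).2 (IntegrableOn.add ?_ ?_)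
    · exact hloc.integrableOn_isCompact isCompact_Icc
    · exact integrableOn_const isCompact_Icc.measure_lt_top.ne
  rintro s₁ hs₁ s₂ hs₂ z hαz hzδ ⟨x, u⟩
  have hnonneg : 0 ≤ (Set.Icc (-B) B).indicator (fun u : ℝ => |u| ^ (δ - 1) + B ^ |α|) u :=
    Set.indicator_nonneg (fun u _ => by positivity) u
  by_cases hx : x ∈ tsupport Ψ
  swap
  · simp [regularizedKernel, mellinWeight_eq_zero s₁ hx, hx]
  simp only [Set.indicator_of_mem hx]
  rcases eq_or_ne u 0 with rfl | hu
  · rw [regularizedKernel_zero_right, norm_zero]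
    positivity
  have hu0 : 0 < |u| := abs_pos.2 hu
  rw [regularizedKernel, norm_mul, norm_mul, norm_cpow_eq_rpow_re_of_pos hu0, neg_re, mul_assoc,
    mul_assoc C₁]
  refine mul_le_mul ((h₁ s₁ hs₁).1 x) ?_ (by positivity) hC₁
  by_cases hu1 : |u| ≤ 1
  · have huB : u ∈ Set.Icc (-B) B := abs_le.1 (hu1.trans hB)
    have hu1' : u ∈ Set.Icc (-1 : ℝ) 1 := abs_le.1 hu1
    simp only [Set.indicator_of_mem hu1', Set.indicator_of_mem huB]
    calc ‖mellinWeight Ψ s₂ (x - u) - mellinWeight Ψ s₂ x‖ * |u| ^ (-z.re)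
        ≤ (C₂ * |u|) * |u| ^ (-z.re) := by
          gcongr
          simpa using (h₂ s₂ hs₂).2 (x - u) x
      _ = C₂ * |u| ^ (1 - z.re) := by
          rw [mul_assoc, sub_eq_add_neg, Real.rpow_add hu0, Real.rpow_one]
      _ ≤ C₂ * |u| ^ (δ - 1) := by
          gcongr ?_ * ?_
          exact Real.rpow_le_rpow_of_exponent_ge hu0 hu1 (by linarith)
      _ ≤ C₂ * (|u| ^ (δ - 1) + B ^ |α|) := by
          gcongr
          exact le_add_of_nonneg_right (by positivity)
  · rw [Set.indicator_of_notMem (fun h : u ∈ Set.Icc (-1 : ℝ) 1 => hu1 (abs_le.2 h)), sub_zero]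
    push Not at hu1
    by_cases hxu : x - u ∈ tsupport Ψ
    swap
    · rw [mellinWeight_eq_zero s₂ hxu, norm_zero, zero_mul]
      positivity
    have hle : |u| ≤ B := by
      refine le_trans ?_ (le_max_right _ _)
      have := abs_sub x (x - u)
      rw [sub_sub_cancel] at this
      have h3 := hR x hx
      have h4 := hR _ hxu
      rw [Real.norm_eq_abs] at h3 h4
      linarith
    have huB : u ∈ Set.Icc (-B) B := abs_le.1 hle
    simp only [Set.indicator_of_mem huB]
    refine mul_le_mul ((h₂ s₂ hs₂).1 _) ?_ (by positivity) hC₂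
    calc |u| ^ (-z.re) ≤ |u| ^ |α| :=
          Real.rpow_le_rpow_of_exponent_le hu1.le (by linarith [neg_abs_le α])
      _ ≤ B ^ |α| := by gcongr
      _ ≤ _ := le_add_of_nonneg_left (by positivity)

theorem integrable_regularizedKernel (hΨ : ContDiff ℝ 1 Ψ) (hsupp : HasCompactSupport Ψ)
    (hpos : tsupport Ψ ⊆ Set.Ioi 0) (s₁ s₂ : ℂ) {z : ℂ} (hz : z.re < 2) :
    Integrable (regularizedKernel Ψ s₁ s₂ z) := by
  obtain ⟨g, hg, hb⟩ := exists_regularizedKernel_bound hΨ hsupp hpos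
    (isCompact_singleton (x := s₁)) (isCompact_singleton (x := s₂)) z.re (sub_pos.2 hz)
  exact hg.mono' (measurable_regularizedKernel (hΨ.differentiable one_ne_zero) hpos
    s₁ s₂ z).aestronglyMeasurable
    (Filter.Eventually.of_forall (hb s₁ rfl s₂ rfl z le_rfl (by linarith)))

/-- The integral of the regularized kernel, analytic in each variable for `Re z < 2`. -/
noncomputable def regularizedIntegral (Ψ : ℝ → ℝ) (s₁ s₂ z : ℂ) : ℂ :=
  ∫ p, regularizedKernel Ψ s₁ s₂ z p

theorem analyticAt_regularizedIntegral_first (hΨ : ContDiff ℝ 1 Ψ) (hsupp : HasCompactSupport Ψ)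
    (hpos : tsupport Ψ ⊆ Set.Ioi 0) (s₁ s₂ : ℂ) {z : ℂ} (hz : z.re < 2) :
    AnalyticAt ℂ (fun w => regularizedIntegral Ψ w s₂ z) s₁ := by
  obtain ⟨g, hg, hb⟩ := exists_regularizedKernel_bound hΨ hsupp hpos
    (isCompact_closedBall s₁ 1) (isCompact_singleton (x := s₂)) z.re (sub_pos.2 hz)
  refine analyticAt_integral_of_dominated one_pos
    (fun w => (measurable_regularizedKernel (hΨ.differentiable one_ne_zero) hpos
      w s₂ z).aestronglyMeasurable) ?_ hg
    (Filter.Eventually.of_forall fun p w hw => hb w (Metric.ball_subset_closedBall hw) s₂ rfl z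
      le_rfl (by linarith) p)
  refine Filter.Eventually.of_forall fun p => Differentiable.differentiableOn ?_
  exact ((differentiable_mellinWeight_left hpos p.1).mul_const _).mul_const _

theorem analyticAt_regularizedIntegral_second (hΨ : ContDiff ℝ 1 Ψ) (hsupp : HasCompactSupport Ψ)
    (hpos : tsupport Ψ ⊆ Set.Ioi 0) (s₁ s₂ : ℂ) {z : ℂ} (hz : z.re < 2) :
    AnalyticAt ℂ (fun w => regularizedIntegral Ψ s₁ w z) s₂ := by
  obtain ⟨g, hg, hb⟩ := exists_regularizedKernel_bound hΨ hsupp hpos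
    (isCompact_singleton (x := s₁)) (isCompact_closedBall s₂ 1) z.re (sub_pos.2 hz)
  refine analyticAt_integral_of_dominated one_pos
    (fun w => (measurable_regularizedKernel (hΨ.differentiable one_ne_zero) hpos
      s₁ w z).aestronglyMeasurable) ?_ hg
    (Filter.Eventually.of_forall fun p w hw => hb s₁ rfl w (Metric.ball_subset_closedBall hw) z
      le_rfl (by linarith) p)
  refine Filter.Eventually.of_forall fun p => Differentiable.differentiableOn ?_
  have hind : Differentiable ℂ fun w =>
      (Set.Icc (-1 : ℝ) 1).indicator (fun _ => mellinWeight Ψ w p.1) p.2 := by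
    by_cases hp : p.2 ∈ Set.Icc (-1 : ℝ) 1
    · simpa only [Set.indicator_of_mem hp] using differentiable_mellinWeight_left hpos p.1
    · simp only [Set.indicator_of_notMem hp, differentiable_const]
  exact (((differentiable_mellinWeight_left hpos (p.1 - p.2)).sub hind).const_mul _).mul_const _

theorem analyticAt_regularizedIntegral_third (hΨ : ContDiff ℝ 1 Ψ) (hsupp : HasCompactSupport Ψ)
    (hpos : tsupport Ψ ⊆ Set.Ioi 0) (s₁ s₂ : ℂ) {z : ℂ} (hz : z.re < 2) :
    AnalyticAt ℂ (fun w => regularizedIntegral Ψ s₁ s₂ w) z := by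
  have hr : 0 < (2 - z.re) / 2 := by linarith
  obtain ⟨g, hg, hb⟩ := exists_regularizedKernel_bound hΨ hsupp hpos
    (isCompact_singleton (x := s₁)) (isCompact_singleton (x := s₂)) (z.re - (2 - z.re) / 2) hr
  refine analyticAt_integral_of_dominated hr
    (fun w => (measurable_regularizedKernel (hΨ.differentiable one_ne_zero) hpos
      s₁ s₂ w).aestronglyMeasurable) ?_ hg
    (Filter.Eventually.of_forall fun p w hw => ?_)
  · refine Filter.Eventually.of_forall fun p => Differentiable.differentiableOn ?_
    obtain ⟨x, u⟩ := p
    rcases eq_or_ne u 0 with rfl | hu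
    · simp only [regularizedKernel_zero_right, differentiable_const]
    · have hu0 : ((|u| : ℝ) : ℂ) ≠ 0 := ofReal_ne_zero.2 (abs_ne_zero.2 hu)
      intro w
      exact ((differentiableAt_id (x := w)).neg.const_cpow (Or.inl hu0)).const_mul _
  · have h := (abs_re_le_norm (w - z)).trans_lt (mem_ball_iff_norm.1 hw)
    rw [sub_re, abs_lt] at h
    exact hb s₁ rfl s₂ rfl w (by linarith) (by linarith) p

theorem wTilde_eq_integral (hpos : tsupport Ψ ⊆ Set.Ioi 0) (s₁ s₂ z : ℂ) :
    wTilde Ψ s₁ s₂ z = ∫ x, ∫ u,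
      mellinWeight Ψ s₁ x * mellinWeight Ψ s₂ (x - u) * ((|u| : ℝ) : ℂ) ^ (-z) := by
  have hzero {x : ℝ} (hx : x ∉ Set.Ioi (0 : ℝ)) : Ψ x = 0 :=
    image_eq_zero_of_notMem_tsupport fun h => hx (hpos h)
  rw [wTilde, setIntegral_eq_integral_of_forall_compl_eq_zero]
  · refine integral_congr_ae (Filter.Eventually.of_forall fun x => ?_)
    simp only
    rw [setIntegral_eq_integral_of_forall_compl_eq_zero
      (fun y hy => by simp [hzero hy]), ← integral_sub_left_eq_self _ volume x]
    refine integral_congr_ae (Filter.Eventually.of_forall fun u => ?_)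
    simp only [mellinWeight, sub_sub_cancel, ofReal_mul]
    ring
  · intro x hx
    simp [hzero hx]

theorem integral_mellinWeight_mul (hpos : tsupport Ψ ⊆ Set.Ioi 0) (s₁ s₂ : ℂ) :
    ∫ x, mellinWeight Ψ s₁ x * mellinWeight Ψ s₂ x =
      mellin (fun u : ℝ => (((Ψ u) ^ 2 : ℝ) : ℂ)) (s₁ + s₂ - 1) := by
  rw [mellin, ← setIntegral_eq_integral_of_forall_compl_eq_zero (s := Set.Ioi (0 : ℝ))
    (fun x hx => by rw [mellinWeight_eq_zero s₁ fun h => hx (hpos h), zero_mul])]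
  refine setIntegral_congr_fun measurableSet_Ioi fun x hx => ?_
  have hx0 : (x : ℂ) ≠ 0 := ofReal_ne_zero.2 (ne_of_gt hx)
  simp only [mellinWeight, smul_eq_mul, ofReal_pow]
  rw [show s₁ + s₂ - 1 - 1 = (s₁ - 1) + (s₂ - 1) by ring, cpow_add _ _ hx0]
  ring

theorem wTilde_eq_add_regularizedIntegral (hΨ : ContDiff ℝ 1 Ψ) (hsupp : HasCompactSupport Ψ)
    (hpos : tsupport Ψ ⊆ Set.Ioi 0) (s₁ s₂ : ℂ) {z : ℂ} (hz : z.re < 1) :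
    wTilde Ψ s₁ s₂ z =
      (2 / (1 - z)) * mellin (fun u : ℝ => (((Ψ u) ^ 2 : ℝ) : ℂ)) (s₁ + s₂ - 1)
        + regularizedIntegral Ψ s₁ s₂ z := by
  have hcont := continuous_mellinWeight (hΨ.differentiable one_ne_zero) hpos
  have hcs := hasCompactSupport_mellinWeight hsupp
  have hloc := locallyIntegrable_abs_cpow_neg hz
  have hker := integrable_regularizedKernel hΨ hsupp hpos s₁ s₂ (z := z) (by linarith)
  have hinner (x : ℝ) :
      ∫ u, mellinWeight Ψ s₁ x * mellinWeight Ψ s₂ (x - u) * ((|u| : ℝ) : ℂ) ^ (-z) =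
        (2 / (1 - z)) * (mellinWeight Ψ s₁ x * mellinWeight Ψ s₂ x) +
          ∫ u, regularizedKernel Ψ s₁ s₂ z (x, u) := by
    have hsing : Integrable ((Set.Icc (-1 : ℝ) 1).indicator fun u : ℝ =>
        mellinWeight Ψ s₁ x * mellinWeight Ψ s₂ x * ((|u| : ℝ) : ℂ) ^ (-z)) :=
      (integrable_indicator_iff measurableSet_Icc).2
        ((hloc.integrableOn_isCompact isCompact_Icc).const_mul _)
    have hfull : Integrable fun u : ℝ =>
        mellinWeight Ψ s₁ x * mellinWeight Ψ s₂ (x - u) * ((|u| : ℝ) : ℂ) ^ (-z) := by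
      simpa only [smul_eq_mul, mul_assoc, Function.comp_def] using
        (hloc.integrable_smul_left_of_hasCompactSupport
          ((hcont s₂).comp (continuous_sub_left x))
          ((hcs s₂).comp_homeomorph (Homeomorph.subLeft x))).const_mul (mellinWeight Ψ s₁ x)
    have hsplit (u : ℝ) : regularizedKernel Ψ s₁ s₂ z (x, u) =
        mellinWeight Ψ s₁ x * mellinWeight Ψ s₂ (x - u) * ((|u| : ℝ) : ℂ) ^ (-z) -
          (Set.Icc (-1 : ℝ) 1).indicator (fun u : ℝ =>
            mellinWeight Ψ s₁ x * mellinWeight Ψ s₂ x * ((|u| : ℝ) : ℂ) ^ (-z)) u := by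
      by_cases hu : u ∈ Set.Icc (-1 : ℝ) 1
      · simp only [regularizedKernel, Set.indicator_of_mem hu]
        ring
      · simp only [regularizedKernel, Set.indicator_of_notMem hu, sub_zero]
    simp only [hsplit]
    rw [integral_sub hfull hsing, integral_indicator measurableSet_Icc, integral_const_mul,
      integral_abs_cpow_neg hz]
    ring
  have hmul : Integrable fun x => mellinWeight Ψ s₁ x * mellinWeight Ψ s₂ x :=
    ((hcont s₁).mul (hcont s₂)).integrable_of_hasCompactSupport (hcs s₁).mul_right
  rw [wTilde_eq_integral hpos]
  simp only [hinner]
  rw [integral_add (hmul.const_mul _) hker.integral_prod_left, integral_const_mul,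
    integral_mellinWeight_mul hpos, regularizedIntegral, Measure.volume_eq_prod,
    integral_prod _ hker]

end mellinWeight

/-- analytic continuation of `w̃` past `Re z = 1`:
`w̃(s₁,s₂;z) = 2/(1−z) · (Ψ²)~(s₁+s₂−1) + H(s₁,s₂;z)` with `H` analytic in each
variable for `0 < Re z < 2` and bounded on compacta for `0 ≤ Re z ≤ 2 − δ`. -/
theorem wTilde_analytic_continuation (Ψ : ℝ → ℝ)
    (hΨsmooth : ContDiff ℝ (⊤ : ℕ∞) Ψ) (hΨsupp : HasCompactSupport Ψ)
    (hΨpos : ∀ x, 0 ≤ Ψ x) (hΨsupp' : tsupport Ψ ⊆ Set.Ioi 0) :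
    ∃ H : ℂ → ℂ → ℂ → ℂ,
      (∀ s₂ z : ℂ, 0 < z.re → z.re < 2 → ∀ s₁ : ℂ,
        AnalyticAt ℂ (fun w => H w s₂ z) s₁) ∧
      (∀ s₁ z : ℂ, 0 < z.re → z.re < 2 → ∀ s₂ : ℂ,
        AnalyticAt ℂ (fun w => H s₁ w z) s₂) ∧
      (∀ s₁ s₂ z : ℂ, 0 < z.re → z.re < 2 →
        AnalyticAt ℂ (fun w => H s₁ s₂ w) z) ∧
      (∀ s₁ s₂ z : ℂ, z.re < 1 →
        wTilde Ψ s₁ s₂ z =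
          (2 / (1 - z)) * mellin (fun u : ℝ => (((Ψ u)^2 : ℝ) : ℂ)) (s₁ + s₂ - 1)
            + H s₁ s₂ z) ∧
      (∀ δ : ℝ, 0 < δ → ∀ K : Set (ℂ × ℂ), IsCompact K → ∃ C : ℝ,
        ∀ s₁ s₂ z : ℂ, (s₁, s₂) ∈ K → 0 ≤ z.re → z.re ≤ 2 - δ →
          ‖H s₁ s₂ z‖ ≤ C) := by
  have hΨ : ContDiff ℝ 1 Ψ := hΨsmooth.of_le (by norm_cast)
  refine ⟨regularizedIntegral Ψ,
    fun s₂ z _ hz s₁ => analyticAt_regularizedIntegral_first hΨ hΨsupp hΨsupp' s₁ s₂ hz,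
    fun s₁ z _ hz s₂ => analyticAt_regularizedIntegral_second hΨ hΨsupp hΨsupp' s₁ s₂ hz,
    fun s₁ s₂ z _ hz => analyticAt_regularizedIntegral_third hΨ hΨsupp hΨsupp' s₁ s₂ hz,
    fun s₁ s₂ z hz => wTilde_eq_add_regularizedIntegral hΨ hΨsupp hΨsupp' s₁ s₂ hz,
    fun δ hδ K hK => ?_⟩
  obtain ⟨g, hg, hb⟩ := exists_regularizedKernel_bound hΨ hΨsupp hΨsupp'
    (hK.image continuous_fst) (hK.image continuous_snd) 0 hδ
  refine ⟨∫ p, g p, fun s₁ s₂ z hs hz0 hz2 => ?_⟩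
  exact norm_integral_le_of_norm_le hg (Filter.Eventually.of_forall
    (hb s₁ ⟨_, hs, rfl⟩ s₂ ⟨_, hs, rfl⟩ z hz0 hz2))
end

section
/- Let Φ and Ψ be fixed smooth nonnegative real functions compactly supported in (0,∞). Fix positive constants ε and A. For every positive integer ℓ there is a constant C_ℓ such that uniformly for complex s₁ = σ₁ + it₁, s₂ = σ₂ + it₂, z with −A ≤ Re z ≤ 1 − ε and −A ≤ σ₁, σ₂ < A, one has |W̃₃(s₁,s₂;z)| ≤ C_ℓ · (1 + |Im z|^ℓ)^{−1} · (1 + |t₁+t₂|^ℓ)^{−1} · (1 + |t₁−t₂|^{1−Re z})^{−1}. -/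
open MeasureTheory Complex

/-- `W(x,y;u) = Ψ(x)Ψ(y)Φ(u|x−y|)`. -/
noncomputable def Wfun (Φ Ψ : ℝ → ℝ) (x y u : ℝ) : ℝ := Ψ x * Ψ y * Φ (u * |x - y|)

/-- Triple Mellin transform
`W̃₃(s₁,s₂;z) = ∫₀^∞∫₀^∞∫₀^∞ W(x,y;u) u^{z−1} x^{s₁−1} y^{s₂−1} du dx dy`. -/
noncomputable def W3Tilde (Φ Ψ : ℝ → ℝ) (s₁ s₂ z : ℂ) : ℂ :=
  ∫ x in Set.Ioi (0 : ℝ), ∫ y in Set.Ioi (0 : ℝ), ∫ u in Set.Ioi (0 : ℝ),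
    ((Wfun Φ Ψ x y u : ℝ) : ℂ) * (u : ℂ)^(z - 1) * (x : ℂ)^(s₁ - 1) * (y : ℂ)^(s₂ - 1)

open Set Filter Topology
open scoped ContDiff

/-- Smooth, compactly supported real functions vanishing in a neighbourhood of the origin. -/
structure IsTest (f : ℝ → ℝ) : Prop where
  smooth : ContDiff ℝ ∞ f
  compact : HasCompactSupport f
  zero_notMem : (0 : ℝ) ∉ tsupport f

namespace IsTest

variable {f g : ℝ → ℝ}

lemma eventually_zero (hf : IsTest f) : f =ᶠ[𝓝 0] 0 :=
  notMem_tsupport_iff_eventuallyEq.1 hf.zero_notMem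

lemma differentiable (hf : IsTest f) : Differentiable ℝ f :=
  hf.smooth.differentiable (by simp)

lemma continuous (hf : IsTest f) : Continuous f := hf.smooth.continuous

lemma hasDerivAt (hf : IsTest f) (x : ℝ) : HasDerivAt f (deriv f x) x :=
  (hf.differentiable x).hasDerivAt

lemma mul_right (hf : IsTest f) (hg : ContDiff ℝ ∞ g) : IsTest (fun x => f x * g x) where
  smooth := hf.smooth.mul hg
  compact := hf.compact.mul_right
  zero_notMem := by
    rw [notMem_tsupport_iff_eventuallyEq]
    filter_upwards [hf.eventually_zero] with x hx
    simp [hx]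

lemma id_mul (hf : IsTest f) : IsTest (fun x => x * f x) := by
  simpa only [mul_comm, id] using hf.mul_right contDiff_id

lemma deriv (hf : IsTest f) : IsTest (deriv f) where
  smooth := (contDiff_infty_iff_deriv.1 hf.smooth).2
  compact := hf.compact.deriv
  zero_notMem := fun h => hf.zero_notMem (tsupport_deriv_subset h)

lemma euler (hf : IsTest f) : IsTest (fun x => x * _root_.deriv f x) := hf.deriv.id_mul

lemma comp_mul (hf : IsTest f) {d : ℝ} (hd : d ≠ 0) : IsTest (fun u => f (u * d)) where
  smooth := hf.smooth.comp (contDiff_id.mul contDiff_const)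
  compact := hf.compact.comp_homeomorph (Homeomorph.mulRight₀ d hd)
  zero_notMem := by
    rw [notMem_tsupport_iff_eventuallyEq]
    have : Tendsto (fun u : ℝ => u * d) (𝓝 0) (𝓝 0) := by
      have h : Continuous fun u : ℝ => u * d := by fun_prop
      simpa using h.tendsto 0
    exact this.eventually hf.eventually_zero

lemma add (hf : IsTest f) (hg : IsTest g) : IsTest (fun x => f x + g x) where
  smooth := hf.smooth.add hg.smooth
  compact := hf.compact.add hg.compact
  zero_notMem := by
    rw [notMem_tsupport_iff_eventuallyEq]
    filter_upwards [hf.eventually_zero, hg.eventually_zero] with x hx hy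
    simp [hx, hy]

lemma exists_pos_zero (hf : IsTest f) : ∃ c > 0, ∀ x, |x| < c → f x = 0 := by
  obtain ⟨c, hc, h⟩ := Metric.eventually_nhds_iff.1 hf.eventually_zero
  exact ⟨c, hc, fun x hx => h (by simpa using hx)⟩

lemma exists_bound_support (hf : IsTest f) : ∃ R > 0, ∀ x, R < |x| → f x = 0 := by
  obtain ⟨R, hR⟩ := hf.compact.isCompact.isBounded.subset_closedBall 0
  refine ⟨max R 1, by positivity, fun x hx => ?_⟩
  by_contra h
  have := hR (subset_tsupport f h)
  simp only [Metric.mem_closedBall, dist_zero_right, Real.norm_eq_abs] at this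
  exact absurd (le_max_left R 1) (by linarith)

lemma continuous_mul_cpow (hf : IsTest f) (w : ℂ) :
    Continuous fun x : ℝ => (f x : ℂ) * (x : ℂ) ^ w := by
  rw [continuous_iff_continuousAt]
  intro x
  rcases eq_or_ne x 0 with rfl | hx
  · refine (continuousAt_const (y := (0 : ℂ))).congr ?_
    filter_upwards [hf.eventually_zero] with y hy
    simp [hy]
  · exact (Complex.continuous_ofReal.comp hf.continuous).continuousAt.mul
      (continuousAt_ofReal_cpow_const x w (Or.inr hx))

lemma compact_mul_cpow (hf : IsTest f) (w : ℂ) :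
    HasCompactSupport fun x : ℝ => (f x : ℂ) * (x : ℂ) ^ w :=
  (hf.compact.comp_left (g := ((↑) : ℝ → ℂ)) (by simp)).mul_right

lemma integrable_mul_cpow (hf : IsTest f) (w : ℂ) :
    IntegrableOn (fun x : ℝ => (f x : ℂ) * (x : ℂ) ^ w) (Ioi 0) :=
  ((hf.continuous_mul_cpow w).integrable_of_hasCompactSupport (hf.compact_mul_cpow w)).integrableOn

/-- Integration by parts in a Mellin transform. -/
lemma mellin_euler (hf : IsTest f) (s : ℂ) :
    s * ∫ x in Ioi (0 : ℝ), (f x : ℂ) * (x : ℂ) ^ (s - 1) =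
      -∫ x in Ioi (0 : ℝ), ((x * _root_.deriv f x : ℝ) : ℂ) * (x : ℂ) ^ (s - 1) := by
  have hd : ∀ x ∈ Ioi (0 : ℝ), HasDerivAt (fun x : ℝ => (f x : ℂ) * (x : ℂ) ^ s)
      (((x * _root_.deriv f x : ℝ) : ℂ) * (x : ℂ) ^ (s - 1) +
        s * ((f x : ℂ) * (x : ℂ) ^ (s - 1))) x := by
    intro x hx
    have hx0 : (x : ℂ) ≠ 0 := by exact_mod_cast (ne_of_gt hx)
    have h1 : HasDerivAt (fun x : ℝ => (x : ℂ) ^ s) (s * (x : ℂ) ^ (s - 1) * 1) x :=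
      ((hasDerivAt_id (x : ℂ)).cpow_const
        (Complex.ofReal_mem_slitPlane.2 hx)).comp_ofReal
    have h2 := (hf.hasDerivAt x).ofReal_comp.mul h1
    refine h2.congr_deriv ?_
    rw [Complex.cpow_sub _ _ hx0, Complex.cpow_one]
    push_cast
    field_simp
  have hi1 := hf.euler.integrable_mul_cpow (s - 1)
  have hi2 := (hf.integrable_mul_cpow (s - 1)).const_mul s
  have key := integral_Ioi_of_hasDerivAt_of_tendsto
    (hf.continuous_mul_cpow s).continuousWithinAt hd (hi1.add hi2)
    (m := 0) (by
      refine tendsto_const_nhds.congr' ?_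
      obtain ⟨R, hR, h⟩ := hf.exists_bound_support
      filter_upwards [eventually_gt_atTop R] with x hx
      simp [h x (hx.trans_le (le_abs_self x))])
  have h0 : f 0 = 0 := hf.eventually_zero.self_of_nhds
  rw [integral_add hi1 hi2, integral_const_mul, h0, Complex.ofReal_zero, zero_mul] at key
  linear_combination key

lemma exists_bound_mul_rpow (hf : IsTest f) (A : ℝ) : ∃ C ≥ 0, ∃ R > 0, ∀ (s : ℂ) (x : ℝ),
    -A ≤ s.re → s.re ≤ A → 0 < x →
      ‖(f x : ℂ) * (x : ℂ) ^ (s - 1)‖ ≤ C * (Ioc 0 R).indicator 1 x := by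
  obtain ⟨R, hR, h⟩ := hf.exists_bound_support
  obtain ⟨C₁, h₁⟩ := (hf.compact_mul_cpow (A - 1)).exists_bound_of_continuous
    (hf.continuous_mul_cpow (A - 1))
  obtain ⟨C₂, h₂⟩ := (hf.compact_mul_cpow (-A - 1)).exists_bound_of_continuous
    (hf.continuous_mul_cpow (-A - 1))
  have p₁ := (norm_nonneg _).trans (h₁ 0)
  have p₂ := (norm_nonneg _).trans (h₂ 0)
  refine ⟨C₁ + C₂, by positivity, R, hR, fun s x hs hs' hx => ?_⟩
  by_cases hxR : x ≤ R
  · rw [indicator_of_mem (show x ∈ Ioc 0 R from ⟨hx, hxR⟩)]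
    have e₁ := h₁ x
    have e₂ := h₂ x
    rw [norm_mul, Complex.norm_cpow_eq_rpow_re_of_pos hx] at e₁ e₂ ⊢
    simp only [Complex.sub_re, Complex.neg_re, Complex.ofReal_re, Complex.one_re, Pi.one_apply,
      mul_one] at e₁ e₂ ⊢
    have : x ^ (s.re - 1) ≤ x ^ (A - 1) + x ^ (-A - 1) := by
      rcases le_total 1 x with h1 | h1
      · have := Real.rpow_le_rpow_of_exponent_le h1 (show s.re - 1 ≤ A - 1 by linarith)
        have := Real.rpow_nonneg hx.le (-A - 1)
        linarith
      · have := Real.rpow_le_rpow_of_exponent_ge hx h1 (show -A - 1 ≤ s.re - 1 by linarith)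
        have := Real.rpow_nonneg hx.le (A - 1)
        linarith
    calc _ ≤ ‖(f x : ℂ)‖ * (x ^ (A - 1) + x ^ (-A - 1)) := by gcongr
      _ ≤ _ := by linarith
  · rw [h x ((not_le.1 hxR).trans_le (le_abs_self x))]
    simp only [Complex.ofReal_zero, zero_mul, norm_zero]
    exact mul_nonneg (by positivity) (indicator_nonneg (by simp) _)

end IsTest

/-- Lebesgue measure on the positive half-line. -/
local notation "μ₊" => Measure.restrict (volume : Measure ℝ) (Ioi (0 : ℝ))

/-- The integrand of `W3Tilde`, with separate weights in `x` and `y`, at a fixed value of `u` and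
without the power of `u`. -/
noncomputable def sliceKernel (Ψ₁ Ψ₂ φ : ℝ → ℝ) (s₁ s₂ : ℂ) (u : ℝ) (p : ℝ × ℝ) : ℂ :=
  ((Ψ₁ p.1 * Ψ₂ p.2 * φ (u * (p.1 - p.2)) : ℝ) : ℂ) * (p.1 : ℂ) ^ (s₁ - 1) * (p.2 : ℂ) ^ (s₂ - 1)

/-- The integral of `sliceKernel` over the positive quadrant. -/
noncomputable def slice (Ψ₁ Ψ₂ φ : ℝ → ℝ) (s₁ s₂ : ℂ) (u : ℝ) : ℂ :=
  ∫ p, sliceKernel Ψ₁ Ψ₂ φ s₁ s₂ u p ∂(μ₊).prod μ₊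

lemma ae_quadrant : ∀ᵐ p ∂(μ₊).prod μ₊, 0 < p.1 ∧ 0 < p.2 := by
  rw [Measure.prod_restrict]
  filter_upwards [ae_restrict_mem (measurableSet_Ioi.prod measurableSet_Ioi)] with p hp
  exact ⟨hp.1, hp.2⟩

section Slice

variable {Ψ₁ Ψ₂ φ : ℝ → ℝ}

lemma measurable_sliceKernel_uncurry (h₁ : IsTest Ψ₁) (h₂ : IsTest Ψ₂) (hφ : IsTest φ)
    (s₁ s₂ : ℂ) :
    Measurable fun q : (ℝ × ℝ) × ℝ => sliceKernel Ψ₁ Ψ₂ φ s₁ s₂ q.2 q.1 := by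
  have m₁ := h₁.continuous.measurable
  have m₂ := h₂.continuous.measurable
  have m := hφ.continuous.measurable
  unfold sliceKernel
  fun_prop

lemma measurable_sliceKernel (h₁ : IsTest Ψ₁) (h₂ : IsTest Ψ₂) (hφ : IsTest φ)
    (s₁ s₂ : ℂ) (u : ℝ) : Measurable (sliceKernel Ψ₁ Ψ₂ φ s₁ s₂ u) := by
  have m₁ := h₁.continuous.measurable
  have m₂ := h₂.continuous.measurable
  have m := hφ.continuous.measurable
  unfold sliceKernel
  fun_prop

lemma exists_bound_sliceKernel (h₁ : IsTest Ψ₁) (h₂ : IsTest Ψ₂) (φ : ℝ → ℝ) (A : ℝ) :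
    ∃ C ≥ 0, ∃ R > 0, ∀ (s₁ s₂ : ℂ) (u : ℝ) (p : ℝ × ℝ),
      -A ≤ s₁.re → s₁.re ≤ A → -A ≤ s₂.re → s₂.re ≤ A → 0 < p.1 → 0 < p.2 →
      ‖sliceKernel Ψ₁ Ψ₂ φ s₁ s₂ u p‖ ≤
        C * ((Ioc 0 R).indicator 1 p.2 * ‖φ (u * (p.1 - p.2))‖) := by
  obtain ⟨C₁, hC₁, R₁, hR₁, b₁⟩ := h₁.exists_bound_mul_rpow A
  obtain ⟨C₂, hC₂, R₂, hR₂, b₂⟩ := h₂.exists_bound_mul_rpow A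
  refine ⟨C₁ * C₂, by positivity, R₂, hR₂, fun s₁ s₂ u p h1 h1' h2 h2' hp1 hp2 => ?_⟩
  have e₁ : ‖(Ψ₁ p.1 : ℂ) * (p.1 : ℂ) ^ (s₁ - 1)‖ ≤ C₁ := by
    refine (b₁ s₁ p.1 h1 h1' hp1).trans ?_
    have : (Ioc 0 R₁).indicator (1 : ℝ → ℝ) p.1 ≤ 1 :=
      indicator_le_self' (by simp) _
    nlinarith
  have e₂ := b₂ s₂ p.2 h2 h2' hp2
  have : sliceKernel Ψ₁ Ψ₂ φ s₁ s₂ u p = ((Ψ₁ p.1 : ℂ) * (p.1 : ℂ) ^ (s₁ - 1)) *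
      ((Ψ₂ p.2 : ℂ) * (p.2 : ℂ) ^ (s₂ - 1)) * (φ (u * (p.1 - p.2)) : ℂ) := by
    simp only [sliceKernel]; push_cast; ring
  rw [this, norm_mul, norm_mul, Complex.norm_real]
  calc _ ≤ C₁ * (C₂ * (Ioc 0 R₂).indicator 1 p.2) * ‖φ (u * (p.1 - p.2))‖ := by gcongr
    _ = _ := by ring

lemma integrable_dominator (hφ : IsTest φ) (R : ℝ) {u : ℝ} (hu : 0 < u) :
    Integrable fun p : ℝ × ℝ =>
      (Ioc 0 R).indicator (1 : ℝ → ℝ) p.2 * ‖φ (u * (p.1 - p.2))‖ := by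
  have hi : Integrable ((Ioc 0 R).indicator (1 : ℝ → ℝ)) :=
    (integrable_indicator_iff measurableSet_Ioc).2 (integrableOn_const (by simp))
  have hg : Integrable fun t : ℝ => ‖φ (u * t)‖ :=
    ((hφ.continuous.integrable_of_hasCompactSupport hφ.compact).comp_mul_left' hu.ne').norm
  exact hi.convolution_integrand (ContinuousLinearMap.mul ℝ ℝ) hg

lemma integral_dominator (hφ : IsTest φ) {R u : ℝ} (hR : 0 < R) (hu : 0 < u) :
    ∫ p : ℝ × ℝ, (Ioc 0 R).indicator (1 : ℝ → ℝ) p.2 * ‖φ (u * (p.1 - p.2))‖ =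
      R * (u⁻¹ * ∫ t, ‖φ t‖) := by
  have hi : Integrable ((Ioc 0 R).indicator (1 : ℝ → ℝ)) :=
    (integrable_indicator_iff measurableSet_Ioc).2 (integrableOn_const (by simp))
  have hg : Integrable fun t : ℝ => ‖φ (u * t)‖ :=
    ((hφ.continuous.integrable_of_hasCompactSupport hφ.compact).comp_mul_left' hu.ne').norm
  have hc := integral_convolution (μ := volume) (ν := volume)
    (ContinuousLinearMap.mul ℝ ℝ) hi hg
  rw [Measure.volume_eq_prod, integral_prod _ (integrable_dominator hφ R hu)]
  refine hc.trans ?_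
  rw [integral_indicator measurableSet_Ioc,
    Measure.integral_comp_mul_left (fun t => ‖φ t‖) u, abs_of_pos (inv_pos.2 hu)]
  simp [hR.le]

/-- Absolute integrability of the slices, with the trivial bound `O(1 / u)`. -/
lemma exists_bound_integral_norm_sliceKernel (h₁ : IsTest Ψ₁) (h₂ : IsTest Ψ₂)
    (hφ : IsTest φ) (A : ℝ) :
    ∃ C ≥ 0, ∀ (s₁ s₂ : ℂ) (u : ℝ), -A ≤ s₁.re → s₁.re ≤ A → -A ≤ s₂.re → s₂.re ≤ A → 0 < u →
      Integrable (sliceKernel Ψ₁ Ψ₂ φ s₁ s₂ u) ((μ₊).prod μ₊) ∧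
      ∫ p, ‖sliceKernel Ψ₁ Ψ₂ φ s₁ s₂ u p‖ ∂(μ₊).prod μ₊ ≤ C * u⁻¹ := by
  obtain ⟨C, hC, R, hR, b⟩ := exists_bound_sliceKernel h₁ h₂ φ A
  refine ⟨C * R * ∫ t, ‖φ t‖, by positivity, fun s₁ s₂ u h1 h1' h2 h2' hu => ?_⟩
  have hd : Integrable (fun p : ℝ × ℝ =>
      C * ((Ioc 0 R).indicator (1 : ℝ → ℝ) p.2 * ‖φ (u * (p.1 - p.2))‖)) :=
    (integrable_dominator hφ R hu).const_mul C
  have hd' : Integrable (fun p : ℝ × ℝ =>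
      C * ((Ioc 0 R).indicator (1 : ℝ → ℝ) p.2 * ‖φ (u * (p.1 - p.2))‖)) ((μ₊).prod μ₊) := by
    rw [Measure.prod_restrict]
    exact hd.restrict
  have hle : ∀ᵐ p ∂(μ₊).prod μ₊, ‖sliceKernel Ψ₁ Ψ₂ φ s₁ s₂ u p‖ ≤
      C * ((Ioc 0 R).indicator (1 : ℝ → ℝ) p.2 * ‖φ (u * (p.1 - p.2))‖) := by
    filter_upwards [ae_quadrant] with p hp
    exact b s₁ s₂ u p h1 h1' h2 h2' hp.1 hp.2
  have hint := hd'.mono' (measurable_sliceKernel h₁ h₂ hφ s₁ s₂ u).aestronglyMeasurable hle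
  refine ⟨hint, (integral_mono_ae hint.norm hd' hle).trans ?_⟩
  rw [Measure.prod_restrict]
  refine (setIntegral_le_integral hd (Eventually.of_forall fun p => ?_)).trans_eq ?_
  · have := indicator_nonneg (s := Ioc 0 R) (f := (1 : ℝ → ℝ)) (by simp) p.2
    simp only [Pi.zero_apply]
    positivity
  · rw [integral_const_mul, integral_dominator hφ hR hu]
    ring

lemma integrable_sliceKernel (h₁ : IsTest Ψ₁) (h₂ : IsTest Ψ₂) (hφ : IsTest φ)
    (s₁ s₂ : ℂ) {u : ℝ} (hu : 0 < u) :
    Integrable (sliceKernel Ψ₁ Ψ₂ φ s₁ s₂ u) ((μ₊).prod μ₊) := by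
  obtain ⟨C, -, h⟩ := exists_bound_integral_norm_sliceKernel h₁ h₂ hφ (max |s₁.re| |s₂.re|)
  have a1 := le_max_left |s₁.re| |s₂.re|
  have a2 := le_max_right |s₁.re| |s₂.re|
  have b1 := abs_le.1 a1
  have b2 := abs_le.1 a2
  exact (h s₁ s₂ u b1.1 b1.2 b2.1 b2.2 hu).1

/-- Integration by parts in `x`. -/
lemma mul_slice_left (h₁ : IsTest Ψ₁) (h₂ : IsTest Ψ₂) (hφ : IsTest φ)
    (s₁ s₂ : ℂ) {u : ℝ} (hu : 0 < u) :
    s₁ * slice Ψ₁ Ψ₂ φ s₁ s₂ u = -slice (fun x => x * deriv Ψ₁ x) Ψ₂ φ s₁ s₂ u -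
      u * slice (fun x => x * Ψ₁ x) Ψ₂ (deriv φ) s₁ s₂ u := by
  have i1 := integrable_sliceKernel h₁.euler h₂ hφ s₁ s₂ hu
  have i2 := (integrable_sliceKernel h₁.id_mul h₂ hφ.deriv s₁ s₂ hu).const_mul (u : ℂ)
  have i12 : Integrable (fun p =>
      sliceKernel (fun x => x * deriv Ψ₁ x) Ψ₂ φ s₁ s₂ u p +
      u * sliceKernel (fun x => x * Ψ₁ x) Ψ₂ (deriv φ) s₁ s₂ u p) ((μ₊).prod μ₊) := i1.add i2
  have key : s₁ * slice Ψ₁ Ψ₂ φ s₁ s₂ u = -∫ p,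
      (sliceKernel (fun x => x * deriv Ψ₁ x) Ψ₂ φ s₁ s₂ u p +
      u * sliceKernel (fun x => x * Ψ₁ x) Ψ₂ (deriv φ) s₁ s₂ u p) ∂(μ₊).prod μ₊ := by
    rw [slice, integral_prod_symm _ (integrable_sliceKernel h₁ h₂ hφ s₁ s₂ hu),
      integral_prod_symm _ i12, ← integral_const_mul, ← integral_neg]
    congr 1 with y
    have ht : IsTest fun x => Ψ₁ x * φ (u * (x - y)) :=
      h₁.mul_right (hφ.smooth.comp (contDiff_const.mul (contDiff_id.sub contDiff_const)))
    have hd (x : ℝ) : deriv (fun x => Ψ₁ x * φ (u * (x - y))) x =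
        deriv Ψ₁ x * φ (u * (x - y)) + Ψ₁ x * (deriv φ (u * (x - y)) * u) := by
      have h : HasDerivAt (fun x : ℝ => u * (x - y)) u x := by
        simpa using ((hasDerivAt_id x).sub_const y).const_mul u
      exact ((h₁.hasDerivAt x).mul ((hφ.hasDerivAt _).comp x h)).deriv
    have hm := ht.mellin_euler s₁
    simp only [hd] at hm
    have hm' := congrArg (fun w => w * ((Ψ₂ y : ℂ) * (y : ℂ) ^ (s₂ - 1))) hm
    simp only [neg_mul, mul_assoc s₁, ← integral_mul_const] at hm'
    refine Eq.trans ?_ (hm'.trans ?_)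
    · refine congrArg (s₁ * ·) (integral_congr_ae (Eventually.of_forall fun x => ?_))
      simp only [sliceKernel]; push_cast; ring
    · refine congrArg Neg.neg (integral_congr_ae (Eventually.of_forall fun x => ?_))
      simp only [sliceKernel]; push_cast; ring
  rw [key, integral_add i1 i2, integral_const_mul]
  simp only [slice]
  ring

lemma slice_swap (Ψ₁ Ψ₂ φ : ℝ → ℝ) (s₁ s₂ : ℂ) (u : ℝ) :
    slice Ψ₁ Ψ₂ φ s₁ s₂ u = slice Ψ₂ Ψ₁ (fun v => φ (-v)) s₂ s₁ u := by
  rw [slice, ← integral_prod_swap, slice]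
  congr 1 with p
  have : -(u * (p.1 - p.2)) = u * (p.2 - p.1) := by ring
  simp only [sliceKernel, Prod.fst_swap, Prod.snd_swap, this]
  push_cast
  ring

/-- Integration by parts in `y`. -/
lemma mul_slice_right (h₁ : IsTest Ψ₁) (h₂ : IsTest Ψ₂) (hφ : IsTest φ)
    (s₁ s₂ : ℂ) {u : ℝ} (hu : 0 < u) :
    s₂ * slice Ψ₁ Ψ₂ φ s₁ s₂ u = -slice Ψ₁ (fun y => y * deriv Ψ₂ y) φ s₁ s₂ u +
      u * slice Ψ₁ (fun y => y * Ψ₂ y) (deriv φ) s₁ s₂ u := by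
  have hφ' : IsTest fun v => φ (-v) := by simpa using hφ.comp_mul (d := -1) (by norm_num)
  have hd : deriv (fun v => φ (-v)) = fun v => (-1 : ℝ) * deriv φ (-v) := by
    ext v
    rw [deriv_comp_neg]
    ring
  have hs : slice (fun y => y * Ψ₂ y) Ψ₁ (fun v => (-1 : ℝ) * deriv φ (-v)) s₂ s₁ u =
      -slice (fun y => y * Ψ₂ y) Ψ₁ (fun v => deriv φ (-v)) s₂ s₁ u := by
    rw [slice, slice, ← integral_neg]
    congr 1 with p
    simp only [sliceKernel]; push_cast; ring
  rw [slice_swap Ψ₁ Ψ₂, mul_slice_left h₂ h₁ hφ' s₂ s₁ hu, hd, hs,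
    slice_swap Ψ₁ (fun y => y * deriv Ψ₂ y), slice_swap Ψ₁ (fun y => y * Ψ₂ y)]
  ring

lemma slice_euler (h₁ : IsTest Ψ₁) (h₂ : IsTest Ψ₂) (hφ : IsTest φ)
    (s₁ s₂ : ℂ) {u : ℝ} (hu : 0 < u) :
    slice Ψ₁ Ψ₂ (fun v => v * deriv φ v) s₁ s₂ u =
      u * slice (fun x => x * Ψ₁ x) Ψ₂ (deriv φ) s₁ s₂ u -
      u * slice Ψ₁ (fun y => y * Ψ₂ y) (deriv φ) s₁ s₂ u := by
  have i1 := (integrable_sliceKernel h₁.id_mul h₂ hφ.deriv s₁ s₂ hu).const_mul (u : ℂ)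
  have i2 := (integrable_sliceKernel h₁ h₂.id_mul hφ.deriv s₁ s₂ hu).const_mul (u : ℂ)
  simp only [slice]
  rw [← integral_const_mul, ← integral_const_mul, ← integral_sub i1 i2]
  congr 1 with p
  simp only [sliceKernel]; push_cast; ring

lemma add_mul_slice (h₁ : IsTest Ψ₁) (h₂ : IsTest Ψ₂) (hφ : IsTest φ)
    (s₁ s₂ : ℂ) {u : ℝ} (hu : 0 < u) :
    (s₁ + s₂) * slice Ψ₁ Ψ₂ φ s₁ s₂ u = -(slice (fun x => x * deriv Ψ₁ x) Ψ₂ φ s₁ s₂ u +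
      slice Ψ₁ (fun y => y * deriv Ψ₂ y) φ s₁ s₂ u +
      slice Ψ₁ Ψ₂ (fun v => v * deriv φ v) s₁ s₂ u) := by
  linear_combination mul_slice_left h₁ h₂ hφ s₁ s₂ hu + mul_slice_right h₁ h₂ hφ s₁ s₂ hu +
    slice_euler h₁ h₂ hφ s₁ s₂ hu

lemma sub_mul_slice (h₁ : IsTest Ψ₁) (h₂ : IsTest Ψ₂) (hφ : IsTest φ)
    (s₁ s₂ : ℂ) {u : ℝ} (hu : 0 < u) :
    (s₁ - s₂) * slice Ψ₁ Ψ₂ φ s₁ s₂ u = -slice (fun x => x * deriv Ψ₁ x) Ψ₂ φ s₁ s₂ u +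
      slice Ψ₁ (fun y => y * deriv Ψ₂ y) φ s₁ s₂ u -
      u * (slice (fun x => x * Ψ₁ x) Ψ₂ (deriv φ) s₁ s₂ u +
        slice Ψ₁ (fun y => y * Ψ₂ y) (deriv φ) s₁ s₂ u) := by
  linear_combination mul_slice_left h₁ h₂ hφ s₁ s₂ hu - mul_slice_right h₁ h₂ hφ s₁ s₂ hu

end Slice

lemma exists_bound_slice (A : ℝ) (n m : ℕ) : ∀ {Ψ₁ Ψ₂ φ : ℝ → ℝ},
    IsTest Ψ₁ → IsTest Ψ₂ → IsTest φ → ∃ C ≥ 0, ∀ (s₁ s₂ : ℂ) (u : ℝ),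
      -A ≤ s₁.re → s₁.re ≤ A → -A ≤ s₂.re → s₂.re ≤ A → 0 < u →
      ‖s₁ + s₂‖ ^ m * ‖s₁ - s₂‖ ^ n * ‖slice Ψ₁ Ψ₂ φ s₁ s₂ u‖ ≤ C * (u⁻¹ * (1 + u) ^ n) := by
  induction n with
  | zero =>
    induction m with
    | zero =>
      intro Ψ₁ Ψ₂ φ h₁ h₂ hφ
      obtain ⟨C, hC, b⟩ := exists_bound_integral_norm_sliceKernel h₁ h₂ hφ A
      refine ⟨C, hC, fun s₁ s₂ u h1 h1' h2 h2' hu => ?_⟩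
      simpa [slice] using (norm_integral_le_integral_norm _).trans (b s₁ s₂ u h1 h1' h2 h2' hu).2
    | succ m ih =>
      intro Ψ₁ Ψ₂ φ h₁ h₂ hφ
      obtain ⟨C₁, hC₁, b₁⟩ := ih h₁.euler h₂ hφ
      obtain ⟨C₂, hC₂, b₂⟩ := ih h₁ h₂.euler hφ
      obtain ⟨C₃, hC₃, b₃⟩ := ih h₁ h₂ hφ.euler
      refine ⟨C₁ + C₂ + C₃, by positivity, fun s₁ s₂ u h1 h1' h2 h2' hu => ?_⟩
      have e₁ := b₁ s₁ s₂ u h1 h1' h2 h2' hu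
      have e₂ := b₂ s₁ s₂ u h1 h1' h2 h2' hu
      have e₃ := b₃ s₁ s₂ u h1 h1' h2 h2' hu
      have key := congrArg norm (add_mul_slice h₁ h₂ hφ s₁ s₂ hu)
      rw [norm_mul, norm_neg] at key
      calc _ = ‖s₁ + s₂‖ ^ m * ‖s₁ - s₂‖ ^ 0 * (‖s₁ + s₂‖ * ‖slice Ψ₁ Ψ₂ φ s₁ s₂ u‖) := by ring
        _ ≤ ‖s₁ + s₂‖ ^ m * ‖s₁ - s₂‖ ^ 0 * (_ + _ + _) := by
          rw [key]; gcongr; exact norm_add₃_le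
        _ ≤ _ := by linarith
  | succ n ih =>
    intro Ψ₁ Ψ₂ φ h₁ h₂ hφ
    obtain ⟨C₁, hC₁, b₁⟩ := ih h₁.euler h₂ hφ
    obtain ⟨C₂, hC₂, b₂⟩ := ih h₁ h₂.euler hφ
    obtain ⟨C₃, hC₃, b₃⟩ := ih h₁.id_mul h₂ hφ.deriv
    obtain ⟨C₄, hC₄, b₄⟩ := ih h₁ h₂.id_mul hφ.deriv
    refine ⟨C₁ + C₂ + C₃ + C₄, by positivity, fun s₁ s₂ u h1 h1' h2 h2' hu => ?_⟩
    have e₁ := b₁ s₁ s₂ u h1 h1' h2 h2' hu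
    have e₂ := b₂ s₁ s₂ u h1 h1' h2 h2' hu
    have e₃ := b₃ s₁ s₂ u h1 h1' h2 h2' hu
    have e₄ := b₄ s₁ s₂ u h1 h1' h2 h2' hu
    have key := congrArg norm (sub_mul_slice h₁ h₂ hφ s₁ s₂ hu)
    rw [norm_mul] at key
    set a₁ := slice (fun x => x * deriv Ψ₁ x) Ψ₂ φ s₁ s₂ u
    set a₂ := slice Ψ₁ (fun y => y * deriv Ψ₂ y) φ s₁ s₂ u
    set a₃ := slice (fun x => x * Ψ₁ x) Ψ₂ (deriv φ) s₁ s₂ u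
    set a₄ := slice Ψ₁ (fun y => y * Ψ₂ y) (deriv φ) s₁ s₂ u
    have tri : ‖-a₁ + a₂ - u * (a₃ + a₄)‖ ≤ ‖a₁‖ + ‖a₂‖ + u * (‖a₃‖ + ‖a₄‖) := by
      refine (norm_sub_le _ _).trans (add_le_add ((norm_add_le _ _).trans_eq (by simp)) ?_)
      rw [norm_mul, Complex.norm_real, Real.norm_of_nonneg hu.le]
      gcongr
      exact norm_add_le _ _
    set D := ‖s₁ + s₂‖ ^ m * ‖s₁ - s₂‖ ^ n with hD
    have hB : 0 ≤ u⁻¹ * (1 + u) ^ n := by positivity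
    set B := u⁻¹ * (1 + u) ^ n with hBdef
    calc _ = D * (‖s₁ - s₂‖ * ‖slice Ψ₁ Ψ₂ φ s₁ s₂ u‖) := by rw [hD]; ring
      _ ≤ D * (‖a₁‖ + ‖a₂‖ + u * (‖a₃‖ + ‖a₄‖)) := by rw [key]; gcongr
      _ = D * ‖a₁‖ + D * ‖a₂‖ + u * (D * ‖a₃‖ + D * ‖a₄‖) := by ring
      _ ≤ C₁ * B + C₂ * B + u * (C₃ * B + C₄ * B) := by gcongr
      _ ≤ (C₁ + C₂ + C₃ + C₄) * (B * (1 + u)) := by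
        have : 0 ≤ (C₁ + C₂) * B * u := by positivity
        have : 0 ≤ (C₃ + C₄) * B := by positivity
        nlinarith
      _ = _ := by rw [hBdef]; ring

section Triple

variable {Ψ₁ Ψ₂ φ : ℝ → ℝ}

lemma exists_sliceKernel_eq_zero (h₁ : IsTest Ψ₁) (h₂ : IsTest Ψ₂) (hφ : IsTest φ) :
    ∃ u₀ > 0, ∀ (s₁ s₂ : ℂ) (u : ℝ) (p : ℝ × ℝ), 0 < u → u < u₀ →
      sliceKernel Ψ₁ Ψ₂ φ s₁ s₂ u p = 0 := by
  obtain ⟨R₁, hR₁, b₁⟩ := h₁.exists_bound_support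
  obtain ⟨R₂, hR₂, b₂⟩ := h₂.exists_bound_support
  obtain ⟨c, hc, b⟩ := hφ.exists_pos_zero
  refine ⟨c / (R₁ + R₂), by positivity, fun s₁ s₂ u p hu hu' => ?_⟩
  rw [lt_div_iff₀ (by positivity)] at hu'
  rcases lt_or_ge R₁ |p.1| with h | h
  · simp [sliceKernel, b₁ _ h]
  rcases lt_or_ge R₂ |p.2| with h' | h'
  · simp [sliceKernel, b₂ _ h']
  have : φ (u * (p.1 - p.2)) = 0 := by
    apply b
    rw [abs_mul, abs_of_pos hu]
    refine lt_of_le_of_lt ?_ hu'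
    gcongr
    exact (abs_sub _ _).trans (add_le_add h h')
  simp [sliceKernel, this]

/-- The triple Mellin transform of `Ψ₁(x) Ψ₂(y) φ(u(x - y))`. -/
noncomputable def tripleMellin (Ψ₁ Ψ₂ φ : ℝ → ℝ) (s₁ s₂ z : ℂ) : ℂ :=
  ∫ x in Ioi (0 : ℝ), ∫ y in Ioi (0 : ℝ), ∫ u in Ioi (0 : ℝ),
    sliceKernel Ψ₁ Ψ₂ φ s₁ s₂ u (x, y) * (u : ℂ) ^ (z - 1)

lemma integrable_sliceKernel_mul_cpow (h₁ : IsTest Ψ₁) (h₂ : IsTest Ψ₂) (hφ : IsTest φ)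
    (s₁ s₂ : ℂ) {z : ℂ} (hz : z.re < 1) :
    Integrable (fun q : (ℝ × ℝ) × ℝ => sliceKernel Ψ₁ Ψ₂ φ s₁ s₂ q.2 q.1 * (q.2 : ℂ) ^ (z - 1))
      (((μ₊).prod μ₊).prod μ₊) := by
  have hm : AEStronglyMeasurable
      (fun q : (ℝ × ℝ) × ℝ => sliceKernel Ψ₁ Ψ₂ φ s₁ s₂ q.2 q.1 * (q.2 : ℂ) ^ (z - 1))
      (((μ₊).prod μ₊).prod μ₊) := by
    have := measurable_sliceKernel_uncurry h₁ h₂ hφ s₁ s₂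
    exact (this.mul (by fun_prop)).aestronglyMeasurable
  rw [integrable_prod_iff' hm]
  refine ⟨?_, ?_⟩
  · filter_upwards [ae_restrict_mem measurableSet_Ioi] with u hu
    exact (integrable_sliceKernel h₁ h₂ hφ s₁ s₂ hu).mul_const _
  · obtain ⟨u₀, hu₀, hzero⟩ := exists_sliceKernel_eq_zero h₁ h₂ hφ
    obtain ⟨C, hC, b⟩ :=
      exists_bound_integral_norm_sliceKernel h₁ h₂ hφ (max |s₁.re| |s₂.re|)
    have b₁ := abs_le.1 (le_max_left |s₁.re| |s₂.re|)
    have b₂ := abs_le.1 (le_max_right |s₁.re| |s₂.re|)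
    have hd : Integrable ((Ioi (u₀ / 2)).indicator fun u : ℝ => C * u ^ (z.re - 2)) :=
      (integrable_indicator_iff measurableSet_Ioi).2
        ((integrableOn_Ioi_rpow_of_lt (by linarith) (by positivity)).const_mul C)
    refine (hd.restrict (s := Ioi 0)).mono' hm.norm.prod_swap.integral_prod_right' ?_
    filter_upwards [ae_restrict_mem measurableSet_Ioi] with u hu
    have hu : 0 < u := hu
    rw [Real.norm_of_nonneg (integral_nonneg fun _ => norm_nonneg _)]
    by_cases h : u₀ / 2 < u
    · rw [indicator_of_mem (show u ∈ Ioi (u₀ / 2) from h)]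
      simp only [norm_mul, integral_mul_const, Complex.norm_cpow_eq_rpow_re_of_pos hu,
        Complex.sub_re, Complex.one_re]
      calc _ ≤ C * u⁻¹ * u ^ (z.re - 1) := by
            gcongr
            exact (b s₁ s₂ u b₁.1 b₁.2 b₂.1 b₂.2 hu).2
        _ = _ := by
          rw [mul_assoc, ← Real.rpow_neg_one, ← Real.rpow_add hu]
          ring_nf
    · rw [indicator_of_notMem (show u ∉ Ioi (u₀ / 2) from h)]
      have : u < u₀ := by linarith
      simp [hzero s₁ s₂ u _ hu this]

lemma tripleMellin_eq (h₁ : IsTest Ψ₁) (h₂ : IsTest Ψ₂) (hφ : IsTest φ)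
    (s₁ s₂ : ℂ) {z : ℂ} (hz : z.re < 1) :
    tripleMellin Ψ₁ Ψ₂ φ s₁ s₂ z =
      ∫ u in Ioi (0 : ℝ), slice Ψ₁ Ψ₂ φ s₁ s₂ u * (u : ℂ) ^ (z - 1) := by
  have hi := integrable_sliceKernel_mul_cpow h₁ h₂ hφ s₁ s₂ hz
  have e1 := integral_prod _ hi.integral_prod_left
  rw [← integral_prod _ hi, integral_prod_symm _ hi] at e1
  simp only [integral_mul_const] at e1
  exact e1.symm

lemma mul_tripleMellin (hφ : IsTest φ) (Ψ₁ Ψ₂ : ℝ → ℝ) (s₁ s₂ z : ℂ) :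
    z * tripleMellin Ψ₁ Ψ₂ φ s₁ s₂ z =
      -tripleMellin Ψ₁ Ψ₂ (fun v => v * deriv φ v) s₁ s₂ z := by
  simp only [tripleMellin, ← integral_const_mul, ← integral_neg]
  refine integral_congr_ae (Eventually.of_forall fun x => ?_)
  refine integral_congr_ae (Eventually.of_forall fun y => ?_)
  simp only [integral_const_mul, integral_neg]
  rcases eq_or_ne x y with rfl | hxy
  · simp [sliceKernel, hφ.eventually_zero.self_of_nhds]
  have hm := (hφ.comp_mul (sub_ne_zero.2 hxy)).mellin_euler z
  have hd (u : ℝ) : deriv (fun u => φ (u * (x - y))) u = deriv φ (u * (x - y)) * (x - y) := by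
    have h : HasDerivAt (fun u : ℝ => u * (x - y)) (x - y) u := by
      simpa using (hasDerivAt_id u).mul_const (x - y)
    exact ((hφ.hasDerivAt _).comp u h).deriv
  simp only [hd] at hm
  have hm' := congrArg (fun w => w * ((Ψ₁ x : ℂ) * (x : ℂ) ^ (s₁ - 1) *
    ((Ψ₂ y : ℂ) * (y : ℂ) ^ (s₂ - 1)))) hm
  simp only [neg_mul, mul_assoc z, ← integral_mul_const] at hm'
  refine Eq.trans ?_ (hm'.trans ?_)
  · refine congrArg (z * ·) (integral_congr_ae (Eventually.of_forall fun u => ?_))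
    simp only [sliceKernel]; push_cast; ring
  · refine congrArg Neg.neg (integral_congr_ae (Eventually.of_forall fun u => ?_))
    simp only [sliceKernel]; push_cast; ring

lemma exists_euler_iterate (hφ : IsTest φ) (k : ℕ) : ∃ χ : ℝ → ℝ, IsTest χ ∧
    ∀ (Ψ₁ Ψ₂ : ℝ → ℝ) (s₁ s₂ z : ℂ),
      ‖z‖ ^ k * ‖tripleMellin Ψ₁ Ψ₂ φ s₁ s₂ z‖ = ‖tripleMellin Ψ₁ Ψ₂ χ s₁ s₂ z‖ := by
  induction k with
  | zero => exact ⟨φ, hφ, by simp⟩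
  | succ k ih =>
    obtain ⟨χ, hχ, h⟩ := ih
    refine ⟨_, hχ.euler, fun Ψ₁ Ψ₂ s₁ s₂ z => ?_⟩
    have := congrArg norm (mul_tripleMellin hχ Ψ₁ Ψ₂ s₁ s₂ z)
    rw [norm_mul, norm_neg, ← h] at this
    rw [← this]
    ring

lemma norm_integral_Ioi_le_of_le_rpow {f : ℝ → ℂ} {K T ρ ε : ℝ} {N : ℕ} (hK : 0 ≤ K)
    (hT : 0 < T) (hε : 0 < ε) (hρ : ρ ≤ 1 - ε) (hN : 2 ≤ N + ρ)
    (hlarge : ∀ u, 0 < u → ‖f u‖ ≤ K * u ^ (ρ - 2))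
    (hsmall : ∀ u, 0 < u → ‖f u‖ ≤ K * (T ^ N)⁻¹ * u ^ (ρ - 2 + N)) :
    ‖∫ u in Ioi (0 : ℝ), f u‖ ≤ K * (1 + ε⁻¹) * T ^ (ρ - 1) := by
  have i₁ : IntegrableOn (fun u : ℝ => K * (T ^ N)⁻¹ * u ^ (ρ - 2 + N)) (Ioc 0 T) := by
    have := intervalIntegral.intervalIntegrable_rpow' (a := 0) (b := T)
      (show -1 < ρ - 2 + N by linarith)
    exact ((intervalIntegrable_iff_integrableOn_Ioc_of_le hT.le).1 this).const_mul _
  have i₂ : IntegrableOn (fun u : ℝ => K * u ^ (ρ - 2)) (Ioi T) :=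
    (integrableOn_Ioi_rpow_of_lt (by linarith) hT).const_mul K
  have I₁ : ∫ u in Ioc 0 T, K * (T ^ N)⁻¹ * u ^ (ρ - 2 + N) ≤ K * T ^ (ρ - 1) := by
    rw [integral_const_mul, ← intervalIntegral.integral_of_le hT.le,
      integral_rpow (Or.inl (by linarith)), Real.zero_rpow (by linarith), sub_zero]
    have : T ^ (ρ - 2 + N + 1) = T ^ (ρ - 1) * T ^ N := by
      rw [← Real.rpow_natCast, ← Real.rpow_add hT]
      ring_nf
    rw [this]
    calc _ = K * T ^ (ρ - 1) * (ρ - 2 + N + 1)⁻¹ := by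
          have : T ^ N ≠ 0 := by positivity
          field_simp
      _ ≤ K * T ^ (ρ - 1) * 1 := by
          gcongr
          exact inv_le_one_of_one_le₀ (by linarith)
      _ = _ := mul_one _
  have I₂ : ∫ u in Ioi T, K * u ^ (ρ - 2) ≤ K * T ^ (ρ - 1) * ε⁻¹ := by
    rw [integral_const_mul, integral_Ioi_rpow_of_lt (by linarith) hT]
    have e : ρ - 2 + 1 = -(1 - ρ) := by ring
    rw [e, neg_div_neg_eq, ← neg_sub 1 ρ, mul_assoc, div_eq_mul_inv]
    gcongr
    linarith
  calc _ ≤ ∫ u in Ioi (0 : ℝ), ((Ioc 0 T).indicator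
        (fun u : ℝ => K * (T ^ N)⁻¹ * u ^ (ρ - 2 + N)) u +
        (Ioi T).indicator (fun u : ℝ => K * u ^ (ρ - 2)) u) := by
        refine norm_integral_le_of_norm_le
          (((integrable_indicator_iff measurableSet_Ioc).2 i₁).restrict.add
            ((integrable_indicator_iff measurableSet_Ioi).2 i₂).restrict) ?_
        filter_upwards [ae_restrict_mem measurableSet_Ioi] with u hu
        have hu : 0 < u := hu
        rcases le_or_gt u T with h | h
        · simpa [indicator, h, hu, not_lt.2 h] using hsmall u hu
        · simpa [indicator, h, hu, not_le.2 h] using hlarge u hu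
    _ = (∫ u in Ioc 0 T, K * (T ^ N)⁻¹ * u ^ (ρ - 2 + N)) + ∫ u in Ioi T, K * u ^ (ρ - 2) := by
        rw [integral_add ((integrable_indicator_iff measurableSet_Ioc).2 i₁).restrict
          ((integrable_indicator_iff measurableSet_Ioi).2 i₂).restrict,
          setIntegral_indicator measurableSet_Ioc, setIntegral_indicator measurableSet_Ioi,
          inter_eq_right.2 Ioc_subset_Ioi_self, inter_eq_right.2 (Ioi_subset_Ioi hT.le)]
    _ ≤ _ := by linarith

lemma one_add_rpow_le {τ X : ℝ} (hτ : 0 ≤ τ) (hX : 0 ≤ X) : 1 + τ ^ X ≤ 2 * (max 1 τ) ^ X := by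
  have h₁ := Real.one_le_rpow (le_max_left 1 τ) hX
  have h₂ := Real.rpow_le_rpow hτ (le_max_right 1 τ) hX
  linarith

/-- The decay of `tripleMellin` in `t₁ + t₂` and `t₁ - t₂`. -/
lemma exists_bound_tripleMellin (h₁ : IsTest Ψ₁) (h₂ : IsTest Ψ₂) (hφ : IsTest φ)
    {ε A : ℝ} (hε : 0 < ε) (ℓ : ℕ) : ∃ C, ∀ s₁ s₂ z : ℂ,
      -A ≤ z.re → z.re ≤ 1 - ε → -A ≤ s₁.re → s₁.re ≤ A → -A ≤ s₂.re → s₂.re ≤ A →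
      ‖tripleMellin Ψ₁ Ψ₂ φ s₁ s₂ z‖ * (1 + |s₁.im + s₂.im| ^ ℓ) *
        (1 + |s₁.im - s₂.im| ^ (1 - z.re)) ≤ C := by
  obtain ⟨N, hN⟩ := exists_nat_ge (A + 2)
  obtain ⟨u₀, hu₀, hzero⟩ := exists_sliceKernel_eq_zero h₁ h₂ hφ
  obtain ⟨C₁, hC₁, b₁⟩ := exists_bound_slice A 0 0 h₁ h₂ hφ
  obtain ⟨C₂, hC₂, b₂⟩ := exists_bound_slice A 0 ℓ h₁ h₂ hφ
  obtain ⟨C₃, hC₃, b₃⟩ := exists_bound_slice A N 0 h₁ h₂ hφ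
  obtain ⟨C₄, hC₄, b₄⟩ := exists_bound_slice A N ℓ h₁ h₂ hφ
  set C := (C₁ + C₂ + C₃ + C₄) * (1 + u₀⁻¹) ^ N with hCdef
  refine ⟨C * (1 + ε⁻¹) * 2, fun s₁ s₂ z hz hz' h1 h1' h2 h2' => ?_⟩
  set Q := 1 + |s₁.im + s₂.im| ^ ℓ with hQdef
  set T := max 1 |s₁.im - s₂.im| with hTdef
  have hQ : 0 < Q := by positivity
  have hT : 0 < T := by positivity
  have hQ' : Q ≤ 1 + ‖s₁ + s₂‖ ^ ℓ := by
    have := Complex.abs_im_le_norm (s₁ + s₂)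
    rw [Complex.add_im] at this
    rw [hQdef]
    gcongr
  have hT' : T ^ N ≤ 1 + ‖s₁ - s₂‖ ^ N := by
    have := Complex.abs_im_le_norm (s₁ - s₂)
    rw [Complex.sub_im] at this
    rcases max_cases 1 |s₁.im - s₂.im| with ⟨h, -⟩ | ⟨h, -⟩
    · rw [hTdef, h, one_pow]
      exact le_add_of_nonneg_right (by positivity)
    · rw [hTdef, h]
      exact (pow_le_pow_left₀ (abs_nonneg _) this N).trans (by linarith)
  have hpow : 1 ≤ (1 + u₀⁻¹) ^ N :=
    one_le_pow₀ (le_add_of_nonneg_right (by positivity))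
  have hC : 0 ≤ C := by positivity
  have hlarge : ∀ u, 0 < u → Q * ‖slice Ψ₁ Ψ₂ φ s₁ s₂ u‖ ≤ C * u⁻¹ := by
    intro u hu
    have e₁ := b₁ s₁ s₂ u h1 h1' h2 h2' hu
    have e₂ := b₂ s₁ s₂ u h1 h1' h2 h2' hu
    simp only [pow_zero, mul_one, one_mul] at e₁ e₂
    calc _ ≤ (1 + ‖s₁ + s₂‖ ^ ℓ) * ‖slice Ψ₁ Ψ₂ φ s₁ s₂ u‖ := by gcongr
      _ ≤ (C₁ + C₂) * 1 * u⁻¹ := by linarith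
      _ ≤ _ := by
        rw [hCdef]
        have : C₁ + C₂ ≤ C₁ + C₂ + C₃ + C₄ := by linarith
        gcongr
  have hsmall : ∀ u, 0 < u → Q * T ^ N * ‖slice Ψ₁ Ψ₂ φ s₁ s₂ u‖ ≤ C * u⁻¹ * u ^ N := by
    intro u hu
    rcases lt_or_ge u u₀ with h | h
    · have : slice Ψ₁ Ψ₂ φ s₁ s₂ u = 0 := by
        simp [slice, hzero s₁ s₂ u _ hu h]
      rw [this, norm_zero, mul_zero]
      positivity
    have e₁ := b₁ s₁ s₂ u h1 h1' h2 h2' hu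
    have e₂ := b₂ s₁ s₂ u h1 h1' h2 h2' hu
    have e₃ := b₃ s₁ s₂ u h1 h1' h2 h2' hu
    have e₄ := b₄ s₁ s₂ u h1 h1' h2 h2' hu
    simp only [pow_zero, mul_one, one_mul] at e₁ e₂ e₃
    have hu1 : u⁻¹ ≤ u⁻¹ * (1 + u) ^ N :=
      le_mul_of_one_le_right (by positivity) (one_le_pow₀ (by linarith))
    have hu2 : 1 + u ≤ (1 + u₀⁻¹) * u := by
      have : 1 ≤ u₀⁻¹ * u := by
        rw [inv_mul_eq_div]
        exact (one_le_div hu₀).2 h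
      linarith
    calc _ ≤ (1 + ‖s₁ + s₂‖ ^ ℓ) * (1 + ‖s₁ - s₂‖ ^ N) * ‖slice Ψ₁ Ψ₂ φ s₁ s₂ u‖ := by gcongr
      _ ≤ (C₁ + C₂) * u⁻¹ + (C₃ + C₄) * (u⁻¹ * (1 + u) ^ N) := by linarith
      _ ≤ (C₁ + C₂) * (u⁻¹ * (1 + u) ^ N) + (C₃ + C₄) * (u⁻¹ * (1 + u) ^ N) := by gcongr
      _ = (C₁ + C₂ + C₃ + C₄) * u⁻¹ * (1 + u) ^ N := by ring
      _ ≤ (C₁ + C₂ + C₃ + C₄) * u⁻¹ * ((1 + u₀⁻¹) * u) ^ N := by gcongr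
      _ = _ := by rw [hCdef, mul_pow]; ring
  have hnorm : ∀ u : ℝ, 0 < u → ‖slice Ψ₁ Ψ₂ φ s₁ s₂ u * (u : ℂ) ^ (z - 1)‖ =
      ‖slice Ψ₁ Ψ₂ φ s₁ s₂ u‖ * u ^ (z.re - 1) := by
    intro u hu
    rw [norm_mul, Complex.norm_cpow_eq_rpow_re_of_pos hu, Complex.sub_re, Complex.one_re]
  have hu_pow : ∀ u : ℝ, 0 < u → u⁻¹ * u ^ (z.re - 1) = u ^ (z.re - 2) := by
    intro u hu
    rw [← Real.rpow_neg_one, ← Real.rpow_add hu]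
    ring_nf
  have main := norm_integral_Ioi_le_of_le_rpow (f := fun u => slice Ψ₁ Ψ₂ φ s₁ s₂ u *
      (u : ℂ) ^ (z - 1)) (K := C / Q) (N := N) (by positivity) hT hε hz' (by linarith)
    (fun u hu => by
      rw [hnorm u hu, ← hu_pow u hu, ← mul_assoc]
      gcongr
      rw [div_mul_eq_mul_div, le_div_iff₀ hQ, mul_comm]
      exact hlarge u hu)
    (fun u hu => by
      rw [hnorm u hu, Real.rpow_add hu, Real.rpow_natCast, ← hu_pow u hu]
      have hTN : 0 < T ^ N := by positivity
      calc _ ≤ C * u⁻¹ * u ^ N / (Q * T ^ N) * u ^ (z.re - 1) := by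
            gcongr
            rw [le_div_iff₀ (by positivity), mul_comm]
            exact hsmall u hu
        _ = _ := by field_simp)
  rw [← tripleMellin_eq h₁ h₂ hφ s₁ s₂ (by linarith)] at main
  have hX := one_add_rpow_le (abs_nonneg (s₁.im - s₂.im)) (show 0 ≤ 1 - z.re by linarith)
  calc _ ≤ (C / Q * (1 + ε⁻¹) * T ^ (z.re - 1)) * Q * (2 * T ^ (1 - z.re)) := by gcongr
    _ = C * (1 + ε⁻¹) * 2 * (T ^ (z.re - 1) * T ^ (1 - z.re)) := by field_simp
    _ = _ := by
      rw [← Real.rpow_add hT, sub_add_sub_cancel, sub_self, Real.rpow_zero, mul_one]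

end Triple

lemma isTest_of_tsupport_subset_Ioi {f : ℝ → ℝ} (hf : ContDiff ℝ (⊤ : ℕ∞) f)
    (hc : HasCompactSupport f) (hs : tsupport f ⊆ Ioi 0) : IsTest f :=
  ⟨hf, hc, fun h => lt_irrefl (0 : ℝ) (hs h)⟩

lemma W3Tilde_eq_tripleMellin {Φ : ℝ → ℝ} (hs : tsupport Φ ⊆ Ioi 0) (Ψ : ℝ → ℝ)
    (s₁ s₂ z : ℂ) : W3Tilde Φ Ψ s₁ s₂ z =
      tripleMellin Ψ Ψ (fun v => Φ v + Φ (-v)) s₁ s₂ z := by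
  have hneg (v : ℝ) (hv : v ≤ 0) : Φ v = 0 :=
    image_eq_zero_of_notMem_tsupport fun h => not_lt.2 hv (hs h)
  refine integral_congr_ae (Eventually.of_forall fun x => ?_)
  refine integral_congr_ae (Eventually.of_forall fun y => ?_)
  refine setIntegral_congr_fun measurableSet_Ioi fun u hu => ?_
  have hu : 0 < u := hu
  have : Φ (u * |x - y|) = Φ (u * (x - y)) + Φ (-(u * (x - y))) := by
    rcases le_total 0 (x - y) with h | h
    · rw [abs_of_nonneg h, hneg (-(u * (x - y))) (neg_nonpos.2 (mul_nonneg hu.le h)), add_zero]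
    · rw [abs_of_nonpos h, hneg (u * (x - y)) (mul_nonpos_of_nonneg_of_nonpos hu.le h),
        zero_add, mul_neg]
  simp only [Wfun, sliceKernel, this]
  ring

/-- decay estimate for `W̃₃` in the range
`−A ≤ Re z ≤ 1 − ε`, `−A ≤ Re s₁, Re s₂ < A`. -/
theorem W3Tilde_decay (Φ Ψ : ℝ → ℝ)
    (hΦsmooth : ContDiff ℝ (⊤ : ℕ∞) Φ) (hΦsupp : HasCompactSupport Φ)
    (hΦpos : ∀ x, 0 ≤ Φ x) (hΦsupp' : tsupport Φ ⊆ Set.Ioi 0)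
    (hΨsmooth : ContDiff ℝ (⊤ : ℕ∞) Ψ) (hΨsupp : HasCompactSupport Ψ)
    (hΨpos : ∀ x, 0 ≤ Ψ x) (hΨsupp' : tsupport Ψ ⊆ Set.Ioi 0)
    (ε A : ℝ) (hε : 0 < ε) (hA : 0 < A) :
    ∀ ℓ : ℕ, 1 ≤ ℓ → ∃ C : ℝ, ∀ s₁ s₂ z : ℂ,
      -A ≤ z.re → z.re ≤ 1 - ε →
      -A ≤ s₁.re → s₁.re < A → -A ≤ s₂.re → s₂.re < A →
      ‖W3Tilde Φ Ψ s₁ s₂ z‖ ≤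
        C * (1 + |z.im|^ℓ)⁻¹ * (1 + |s₁.im + s₂.im|^ℓ)⁻¹ *
          (1 + |s₁.im - s₂.im| ^ (1 - z.re))⁻¹ := by
  intro ℓ _
  have hΨ := isTest_of_tsupport_subset_Ioi hΨsmooth hΨsupp hΨsupp'
  have hΦ := isTest_of_tsupport_subset_Ioi hΦsmooth hΦsupp hΦsupp'
  have hφ : IsTest fun v => Φ v + Φ (-v) :=
    hΦ.add (by simpa using hΦ.comp_mul (d := -1) (by norm_num))
  obtain ⟨χ, hχ, hiter⟩ := exists_euler_iterate hφ ℓ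
  obtain ⟨C₁, b₁⟩ := exists_bound_tripleMellin hΨ hΨ hφ (A := A) hε ℓ
  obtain ⟨C₂, b₂⟩ := exists_bound_tripleMellin hΨ hΨ hχ (A := A) hε ℓ
  refine ⟨C₁ + C₂, fun s₁ s₂ z hz hz' h1 h1' h2 h2' => ?_⟩
  have e₁ := b₁ s₁ s₂ z hz hz' h1 h1'.le h2 h2'.le
  have e₂ := b₂ s₁ s₂ z hz hz' h1 h1'.le h2 h2'.le
  rw [← hiter] at e₂
  rw [W3Tilde_eq_tripleMellin hΦsupp' Ψ s₁ s₂ z]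
  set V := ‖tripleMellin Ψ Ψ (fun v => Φ v + Φ (-v)) s₁ s₂ z‖
  have hz_im : |z.im| ^ ℓ ≤ ‖z‖ ^ ℓ :=
    pow_le_pow_left₀ (abs_nonneg _) (Complex.abs_im_le_norm z) ℓ
  have hτ : 0 ≤ |s₁.im - s₂.im| ^ (1 - z.re) := Real.rpow_nonneg (abs_nonneg _) _
  rw [← div_eq_mul_inv, ← div_eq_mul_inv, ← div_eq_mul_inv, le_div_iff₀ (by positivity),
    le_div_iff₀ (by positivity), le_div_iff₀ (by positivity)]
  calc _ = V * (1 + |s₁.im + s₂.im| ^ ℓ) * (1 + |s₁.im - s₂.im| ^ (1 - z.re)) *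
        (1 + |z.im| ^ ℓ) := by ring
    _ ≤ V * (1 + |s₁.im + s₂.im| ^ ℓ) * (1 + |s₁.im - s₂.im| ^ (1 - z.re)) *
        (1 + ‖z‖ ^ ℓ) := by gcongr
    _ ≤ _ := by linarith
end
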